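/- Let r ≥ 6 be an integer that is not a prime power, let d ≥ 3r, and let N = (d+1)(r−1). Then there exists a continuous map f : σ^N → ℝ^d that has no r-Tverberg point; in other words, the topological Tverberg conjecture fails for all parameters (d,r) with d ≥ 3r and r not a prime power. -/

import Mathlib

open Set

namespace TTC

lemma choose_pow_mul_modEq (p s : ℕ) (hp : p.Prime) (a : ℕ) :
    (p ^ a * s).choose (p ^ a) ≡ s [MOD p] := by
  have := Fact.mk hp
  induction a with
  | zero => simp [Nat.ModEq.refl]
  | succ a ih =>
    refine (Choose.choose_modEq_choose_mod_mul_choose_div_nat).trans ?_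
    have h1 : p ^ (a+1) * s = p * (p ^ a * s) := by ring
    have h2 : p ^ (a+1) = p * p ^ a := by ring
    rw [h1, h2, Nat.mul_mod_right, Nat.mul_mod_right, Nat.mul_div_cancel_left _ hp.pos,
      Nat.mul_div_cancel_left _ hp.pos]
    simpa using ih

lemma gcd_choose_eq_one (r : ℕ) (hr : 2 ≤ r) (hnp : ¬ IsPrimePow r) :
    (Finset.Ico 1 r).gcd (fun k => ((r.choose k : ℕ) : ℤ)) = 1 := by
  set g := (Finset.Ico 1 r).gcd (fun k => ((r.choose k : ℕ) : ℤ)) with hg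
  have hdvd : ∀ k, 1 ≤ k → k < r → g.natAbs ∣ r.choose k := by
    intro k h1 h2
    have : g ∣ ((r.choose k : ℕ) : ℤ) :=
      Finset.gcd_dvd (f := fun k => ((r.choose k : ℕ) : ℤ)) (Finset.mem_Ico.2 ⟨h1, h2⟩)
    exact Int.natAbs_dvd_natAbs.2 this
  have h1 : g.natAbs = 1 := by
    by_contra hne
    obtain ⟨p, hp, hpg⟩ := Nat.exists_prime_and_dvd hne
    have hpr : p ∣ r := by simpa using hpg.trans (hdvd 1 le_rfl (by omega))
    obtain ⟨a, s, hs, hrs⟩ := Nat.exists_eq_pow_mul_and_not_dvd (n := r) (by omega) p hp.ne_one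
    have ha : a ≠ 0 := by
      rintro rfl
      simp at hrs; subst hrs; exact hs hpr
    have hs1 : s ≠ 1 := by
      rintro rfl
      exact hnp (by rw [hrs, mul_one]; exact hp.isPrimePow.pow ha)
    have hs0 : s ≠ 0 := by rintro rfl; simp at hs
    have hpa : 0 < p ^ a := pow_pos hp.pos _
    have hlt : p ^ a < r := by
      rw [hrs]
      have : 2 ≤ s := by omega
      nlinarith
    have h2 := hpg.trans (hdvd (p ^ a) hpa hlt)
    have h3 := choose_pow_mul_modEq p s hp a
    rw [← hrs] at h3
    exact hs ((h3.dvd_iff dvd_rfl).1 h2)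
  have h2 : normalize g = g := Finset.normalize_gcd
  rw [← h2, normalize_eq_one]
  exact Int.isUnit_iff_natAbs_eq.2 h1

/-- proper nonempty subsets of `Fin r` -/
def propSub (r : ℕ) : Finset (Finset (Fin r)) :=
  Finset.univ.filter fun A => 0 < A.card ∧ A.card < r

lemma exists_winding (r : ℕ) (hr : 2 ≤ r) (hnp : ¬ IsPrimePow r) :
    ∃ n : ℕ → ℤ, 1 + ∑ A ∈ propSub r, n A.card = 0 := by
  obtain ⟨f, hf⟩ := Finset.gcd_eq_sum_mul (Finset.Ico 1 r) (fun k => ((r.choose k : ℕ) : ℤ))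
  rw [gcd_choose_eq_one r hr hnp] at hf
  refine ⟨fun k => - f k, ?_⟩
  have : ∑ A ∈ propSub r, - f A.card = ∑ k ∈ Finset.Ico 1 r, ∑ A ∈ propSub r with A.card = k, - f A.card := by
    rw [Finset.sum_fiberwise_of_maps_to]
    intro A hA
    simp [propSub] at hA ⊢
    exact ⟨hA.1, hA.2⟩
  rw [this, hf, ← Finset.sum_add_distrib]
  apply Finset.sum_eq_zero
  intro k hk
  rw [Finset.sum_congr rfl (g := fun _ => - f k) (by intro A hA; rw [(Finset.mem_filter.1 hA).2])]
  have : (propSub r).filter (fun A => A.card = k) = Finset.powersetCard k Finset.univ := by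
    ext A
    simp [propSub] at hk ⊢
    rintro rfl; exact ⟨Finset.card_pos.1 hk.1, hk.2⟩
  rw [this]; simp
end TTC

open Set
open scoped Topology unitInterval

namespace TTC

/-- not on the diagonal -/
def ND {r : ℕ} {P : Type*} (v : Fin r → P) : Prop := ¬ ∀ i j, v i = v j

/-- complement of the diagonal -/
abbrev YY (r : ℕ) (P : Type*) := {v : Fin r → P // ND v}

lemma isOpen_ND {r : ℕ} {P : Type*} [TopologicalSpace P] [T2Space P] :
    IsOpen {v : Fin r → P | ND v} := by
  have : {v : Fin r → P | ND v} = (⋂ i, ⋂ j, {v : Fin r → P | v i = v j})ᶜ := by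
    ext v; simp [ND]
  rw [this, isOpen_compl_iff]
  exact isClosed_iInter fun i => isClosed_iInter fun j =>
    isClosed_eq (continuous_apply i) (continuous_apply j)

lemma homotopicRel_of {r : ℕ} {P X : Type*} [TopologicalSpace P] [TopologicalSpace X]
    {S : Set X} (φ ψ : C(X, YY r P)) (H : I × X → Fin r → P) (hH : Continuous H)
    (hND : ∀ t x, ND (H (t, x))) (h0 : ∀ x, H (0, x) = φ x) (h1 : ∀ x, H (1, x) = ψ x)
    (hS : ∀ t, ∀ x ∈ S, H (t, x) = φ x) : φ.HomotopicRel ψ S := by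
  refine ⟨⟨⟨⟨fun p => ⟨H p, hND p.1 p.2⟩, hH.subtype_mk _⟩, fun x => Subtype.ext (h0 x),
    fun x => Subtype.ext (h1 x)⟩, fun t x hx => Subtype.ext (hS t x hx)⟩⟩

/-- straight-line homotopy -/
lemma homotopicRel_line {r : ℕ} {P X : Type*} [NormedAddCommGroup P] [NormedSpace ℝ P]
    [TopologicalSpace X]
    {S : Set X} (φ : C(X, YY r P)) (G : X → Fin r → P) (hG : Continuous G)
    (hND : ∀ t : ℝ, 0 ≤ t → t ≤ 1 → ∀ x, ND ((φ x).1 + t • (G x - (φ x).1)))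
    (hS : ∀ x ∈ S, G x = φ x) :
    ∃ ψ : C(X, YY r P), (∀ x, (ψ x).1 = G x) ∧ φ.HomotopicRel ψ S := by
  have hG1 : ∀ x, ND (G x) := fun x => by
    have := hND 1 zero_le_one le_rfl x
    simpa using this
  refine ⟨⟨fun x => ⟨G x, hG1 x⟩, hG.subtype_mk _⟩, fun x => rfl, ?_⟩
  refine homotopicRel_of _ _ (fun p => (φ p.2).1 + (p.1 : ℝ) • (G p.2 - (φ p.2).1)) ?_ ?_ ?_ ?_ ?_
  · fun_prop
  · intro t x; exact hND t t.2.1 t.2.2 x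
  · intro x; simp
  · intro x; simp
  · intro t x hx; simp [hS x hx]

lemma margin {r : ℕ} {P X : Type*} [NormedAddCommGroup P] [TopologicalSpace X]
    {K : Set X} (hK : IsCompact K) (φ : X → Fin r → P) (hφ : Continuous φ)
    (hND : ∀ x ∈ K, ND (φ x)) :
    ∃ ε > 0, ∀ x ∈ K, ∀ w : Fin r → P, (∀ i, ‖w i - φ x i‖ < ε) → ND w := by
  obtain ⟨ε, hε, h⟩ := (hK.image hφ).exists_thickening_subset_open (isOpen_ND (r := r) (P := P))
    (by rintro _ ⟨x, hx, rfl⟩; exact hND x hx)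
  refine ⟨ε, hε, fun x hx w hw => h ?_⟩
  rw [Metric.mem_thickening_iff]
  refine ⟨φ x, ⟨x, hx, rfl⟩, ?_⟩
  rw [dist_pi_lt_iff hε]
  intro i; rw [dist_eq_norm]; exact hw i

section generic
variable {E P C : Type*} [NormedAddCommGroup E] [NormedSpace ℝ E] [FiniteDimensional ℝ E]
  [NormedAddCommGroup P] [NormedSpace ℝ P] [FiniteDimensional ℝ P] [Fintype C]

open Module

lemma generic_two (p : C → E → P) (hp : ∀ c, ContDiff ℝ 1 (p c)) {r : ℕ} (π : Fin r → C)
    (hπ : Function.Injective π) (hdim : finrank ℝ E + 1 < r * finrank ℝ P) (c c' : C)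
    (hc : c ∉ range π) (hc' : c' ∉ range π) (hcc : c ≠ c') :
    dimH {a : C → P | ∃ (t : ℝ) (z : E), (∀ i j, p (π i) z + a (π i) = p (π j) z + a (π j)) ∧
      p c (t • z) + a c = p c' (t • z) + a c'} < finrank ℝ (C → P) := by
  classical
  let D := {x : C // x ∉ range π ∧ x ≠ c}
  let Ψ : (ℝ × E) × (P × (D → P)) → (C → P) := fun q x =>
    if hx : x ∈ range π then q.2.1 - p x q.1.2 else
    if hx' : x = c then q.2.2 ⟨c', hc', hcc.symm⟩ + p c' (q.1.1 • q.1.2) - p c (q.1.1 • q.1.2)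
    else q.2.2 ⟨x, hx, hx'⟩
  have hΨ : ContDiff ℝ 1 Ψ := by
    rw [contDiff_pi]
    intro x
    by_cases hx : x ∈ range π
    · simp only [Ψ, hx, dif_pos]
      have := hp x
      fun_prop
    · by_cases hx' : x = c
      · have h1 := hp c
        have h2 := hp c'
        simp only [Ψ, hx, hx', dif_pos, dif_neg, not_false_eq_true]
        simp only [hc, not_false_eq_true, dif_neg]
        fun_prop
      · simp only [Ψ, hx, hx', dif_neg, not_false_eq_true]
        fun_prop
  have hr : 0 < r := by
    rcases Nat.eq_zero_or_pos r with h | h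
    · subst h; simp at hdim
    · exact h
  have hsub : {a : C → P | ∃ (t : ℝ) (z : E),
      (∀ i j, p (π i) z + a (π i) = p (π j) z + a (π j)) ∧
      p c (t • z) + a c = p c' (t • z) + a c'} ⊆ range Ψ := by
    rintro a ⟨t, z, h1, h2⟩
    refine ⟨((t, z), (p (π ⟨0, hr⟩) z + a (π ⟨0, hr⟩), fun x => a x.1)), ?_⟩
    ext x
    by_cases hx : x ∈ range π
    · simp only [Ψ, hx, dif_pos]
      obtain ⟨i, rfl⟩ := hx
      rw [h1 ⟨0, hr⟩ i]; abel
    · by_cases hx' : x = c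
      · subst hx'
        simp only [Ψ, hx, dif_pos, dif_neg, not_false_eq_true]
        rw [add_comm (a c'), ← h2]; abel
      · simp only [Ψ, hx, hx', dif_neg, not_false_eq_true]
  refine (dimH_mono hsub).trans_lt (hΨ.dimH_range_le.trans_lt (Nat.cast_lt.2 ?_))
  have hcard : Fintype.card C = r + 1 + Fintype.card D := by
    have e1 : Fintype.card C = Fintype.card {x : C // x ∈ range π} +
        Fintype.card {x : C // ¬ x ∈ range π} := by
      rw [Fintype.card_subtype_compl]
      have := Fintype.card_subtype_le (fun x : C => x ∈ range π)
      omega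
    have e2 : Fintype.card {x : C // x ∈ range π} = r := by
      have := Fintype.card_congr (Equiv.ofInjective π hπ)
      rw [Fintype.card_fin] at this
      exact this.symm
    have e3 : Fintype.card {x : C // ¬ x ∈ range π} = Fintype.card D + 1 := by
      rw [Fintype.card_subtype, Fintype.card_subtype]
      have : (Finset.univ.filter fun x => ¬ x ∈ range π) =
          insert c (Finset.univ.filter fun x => x ∉ range π ∧ x ≠ c) := by
        ext x
        simp only [Finset.mem_filter, Finset.mem_univ, true_and, Finset.mem_insert]
        by_cases h : x = c
        · subst h; simpa using hc
        · simp [h]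
      rw [this, Finset.card_insert_of_notMem (by simp)]
    omega
  simp only [finrank_prod, finrank_pi_fintype, finrank_self, Finset.sum_const, Finset.card_univ,
    smul_eq_mul]
  rw [hcard]
  nlinarith

lemma generic_one (p : C → E → P) (hP : 0 < finrank ℝ P) (c c' : C)  (hcc : c ≠ c') :
    dimH {a : C → P | p c 0 + a c = p c' 0 + a c'} < finrank ℝ (C → P) := by
  classical
  let D := {x : C // x ≠ c}
  let Ψ : (D → P) → (C → P) := fun q x =>
    if hx' : x = c then q ⟨c', hcc.symm⟩ + p c' 0 - p c 0 else q ⟨x, hx'⟩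
  have hΨ : ContDiff ℝ 1 Ψ := by
    rw [contDiff_pi]
    intro x
    by_cases hx' : x = c
    · simp only [Ψ, hx', dif_pos]
      fun_prop
    · simp only [Ψ, hx', dif_neg, not_false_eq_true]
      fun_prop
  have hsub : {a : C → P | p c 0 + a c = p c' 0 + a c'} ⊆ range Ψ := by
    intro a h2
    refine ⟨fun x => a x.1, ?_⟩
    ext x
    by_cases hx' : x = c
    · subst hx'
      simp only [Ψ, dif_pos]
      rw [add_comm (a c'), ← h2]; abel
    · simp only [Ψ, hx', dif_neg, not_false_eq_true]
  refine (dimH_mono hsub).trans_lt (hΨ.dimH_range_le.trans_lt (Nat.cast_lt.2 ?_))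
  have hcard : Fintype.card D < Fintype.card C :=
    Fintype.card_subtype_lt (x := c) (by simp)
  simp only [finrank_pi_fintype, Finset.sum_const, Finset.card_univ, smul_eq_mul]
  exact (Nat.mul_lt_mul_right hP).2 hcard

lemma dimH_finite_iUnion_lt {ι X : Type*} [Finite ι] [EMetricSpace X] (s : ι → Set X) {n : ℕ}
    (hn : 0 < n) (h : ∀ i, dimH (s i) < n) : dimH (⋃ i, s i) < n := by
  rw [dimH_iUnion]
  rcases isEmpty_or_nonempty ι with h0 | h0
  · simp [hn]
  · obtain ⟨i, hi⟩ := exists_eq_ciSup_of_finite (f := fun i => dimH (s i))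
    rw [← hi]; exact h i

lemma exists_generic (p : C → E → P) (hp : ∀ c, ContDiff ℝ 1 (p c)) {r : ℕ} (π : Fin r → C)
    (hπ : Function.Injective π) (hdim : finrank ℝ E + 1 < r * finrank ℝ P) {ε : ℝ} (hε : 0 < ε) :
    ∃ a : C → P, (∀ c, ‖a c‖ < ε) ∧ ∀ c c', c ∉ range π → c' ∉ range π → c ≠ c' →
      (p c 0 + a c ≠ p c' 0 + a c') ∧
      ∀ (t : ℝ) (z : E), (∀ i j, p (π i) z + a (π i) = p (π j) z + a (π j)) →
      p c (t • z) + a c ≠ p c' (t • z) + a c' := by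
  have hr : 0 < r := by
    rcases Nat.eq_zero_or_pos r with h | h
    · subst h; simp at hdim
    · exact h
  have hP : 0 < finrank ℝ P := by
    rcases Nat.eq_zero_or_pos (finrank ℝ P) with h | h
    · rw [h] at hdim; simp at hdim
    · exact h
  have hn : 0 < finrank ℝ (C → P) := by
    simp only [finrank_pi_fintype, Finset.sum_const, Finset.card_univ, smul_eq_mul]
    exact Nat.mul_pos (Fintype.card_pos_iff.2 ⟨π ⟨0, hr⟩⟩) hP
  let D := {x : C × C // x.1 ∉ range π ∧ x.2 ∉ range π ∧ x.1 ≠ x.2}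
  let s : D → Set (C → P) := fun x => {a | p x.1.1 0 + a x.1.1 = p x.1.2 0 + a x.1.2} ∪
     {a : C → P | ∃ (t : ℝ) (z : E), (∀ i j, p (π i) z + a (π i) = p (π j) z + a (π j)) ∧
      p x.1.1 (t • z) + a x.1.1 = p x.1.2 (t • z) + a x.1.2}
  have h1 : dimH (⋃ x, s x) < finrank ℝ (C → P) := by
    refine dimH_finite_iUnion_lt s hn fun x => ?_
    rw [dimH_union]
    exact max_lt (generic_one p hP _ _ x.2.2.2)
      (generic_two p hp π hπ hdim _ _ x.2.1 x.2.2.1 x.2.2.2)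
  obtain ⟨a, ha, ha'⟩ := Metric.dense_iff.1 (dense_compl_of_dimH_lt_finrank h1) 0 ε hε
  refine ⟨a, fun c => ?_, fun c c' hc hc' hcc => ⟨fun h => ?_, fun t z h h' => ?_⟩⟩
  · rw [mem_ball_zero_iff] at ha
    exact (norm_le_pi_norm a c).trans_lt ha
  · exact ha' (mem_iUnion.2 ⟨⟨(c, c'), hc, hc', hcc⟩, Or.inl h⟩)
  · exact ha' (mem_iUnion.2 ⟨⟨(c, c'), hc, hc', hcc⟩, Or.inr ⟨t, z, h, h'⟩⟩)
end generic

end TTC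

open Set
open scoped Topology unitInterval

namespace TTC

section cell
variable {E P C : Type*} [NormedAddCommGroup E] [NormedSpace ℝ E] [FiniteDimensional ℝ E]
  [NormedAddCommGroup P] [NormedSpace ℝ P]

/-- radial direction -/
noncomputable def dir (x : E) : E := ‖x‖⁻¹ • x

/-- the collapsing map -/
noncomputable def KK {r : ℕ} (Φ Θ : E → Fin r → P) (s : ℝ) (x : E) : Fin r → P :=
  open Classical in
  if x = 0 then Θ 0 else
    Φ (max 0 (1 - 2 * s) • x + min 1 (2 * s) • dir x) + Θ (min 1 (2 - 2 * s) • dir x) - Θ (dir x)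

lemma norm_dir {x : E} (hx : x ≠ 0) : ‖dir x‖ = 1 := by
  rw [dir, norm_smul, norm_inv, norm_norm, inv_mul_cancel₀ (norm_ne_zero_iff.2 hx)]

lemma KK_ge {r : ℕ} {Φ Θ : E → Fin r → P} (h : ∀ x, ‖x‖ = 1 → Φ x = Θ x) {s : ℝ} {x : E}
    (hx : x ≠ 0) (hs : 1 / 2 ≤ s) : KK Φ Θ s x = Θ ((2 - 2 * s) • dir x) := by
  rw [KK, if_neg hx, max_eq_left (by linarith), min_eq_left (by linarith),
    min_eq_right (by linarith), zero_smul, one_smul, zero_add, h _ (norm_dir hx)]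
  abel

lemma KK_le {r : ℕ} {Φ Θ : E → Fin r → P} {s : ℝ} {x : E}
    (hx : x ≠ 0) (hs : s ≤ 1 / 2) : KK Φ Θ s x = Φ ((1 - 2 * s) • x + (2 * s) • dir x) := by
  rw [KK, if_neg hx, max_eq_right (by linarith), min_eq_left (b := 2 - 2 * s) (by linarith),
    min_eq_right (by linarith), one_smul]
  abel

lemma KK_continuous {A : Type*} [TopologicalSpace A] {r : ℕ} {Φ Θ : E → Fin r → P}
    (hΦ : Continuous Φ) (hΘ : Continuous Θ)
    (h : ∀ x, ‖x‖ = 1 → Φ x = Θ x) (sg : A × E → ℝ) (hsg : Continuous sg) (hsg0 : ∀ t, sg (t, 0) = 1) :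
    Continuous (fun p : A × E => KK Φ Θ (sg p) p.2) := by
  rw [continuous_iff_continuousAt]
  rintro ⟨t, x⟩
  by_cases hx : x = 0
  · subst hx
    have h1 : Filter.Tendsto (fun p : A × E => (2 - 2 * sg p) • dir p.2) (𝓝 (t, 0)) (𝓝 0) := by
      have h2 : Filter.Tendsto (fun p : A × E => |2 - 2 * sg p|) (𝓝 (t, 0)) (𝓝 0) := by
        have : Continuous (fun p : A × E => |2 - 2 * sg p|) := by fun_prop
        have := this.tendsto (t, 0)
        simpa [hsg0] using this
      refine squeeze_zero_norm (fun p => ?_) h2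
      rw [norm_smul, Real.norm_eq_abs]
      have : ‖dir p.2‖ ≤ 1 := by
        by_cases hp : p.2 = 0
        · simp [dir, hp]
        · rw [norm_dir hp]
      nlinarith [abs_nonneg (2 - 2 * sg p)]
    have h2 : (fun p : A × E => Θ ((2 - 2 * sg p) • dir p.2)) =ᶠ[𝓝 (t, 0)]
        (fun p : A × E => KK Φ Θ (sg p) p.2) := by
      have : ∀ᶠ p in 𝓝 ((t, 0) : A × E), 1 / 2 < sg p :=
        hsg.continuousAt.eventually (lt_mem_nhds (by rw [hsg0]; norm_num))
      filter_upwards [this] with p hp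
      by_cases hp0 : p.2 = 0
      · simp [KK, hp0, dir]
      · rw [KK_ge h hp0 hp.le]
    have h3 : Filter.Tendsto (fun p : A × E => Θ ((2 - 2 * sg p) • dir p.2)) (𝓝 (t, 0)) (𝓝 (Θ 0)) :=
      (hΘ.tendsto 0).comp h1
    have h4 := h3.congr' h2
    simpa [ContinuousAt, KK] using h4
  · have h0 : ∀ᶠ p in 𝓝 ((t, x) : A × E), p.2 ≠ 0 := by
      have : IsOpen {p : A × E | p.2 ≠ 0} := isOpen_ne_fun continuous_snd continuous_const
      exact this.mem_nhds hx
    have hd : ContinuousAt (fun p : A × E => dir p.2) (t, x) := by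
      unfold dir
      have : ‖(t, x).2‖ ≠ 0 := norm_ne_zero_iff.2 hx
      fun_prop (disch := assumption)
    have h2 : (fun p : A × E => Φ (max 0 (1 - 2 * sg p) • p.2 + min 1 (2 * sg p) • dir p.2) +
        Θ (min 1 (2 - 2 * sg p) • dir p.2) - Θ (dir p.2)) =ᶠ[𝓝 (t, x)]
        (fun p : A × E => KK Φ Θ (sg p) p.2) := by
      filter_upwards [h0] with p hp
      rw [KK, if_neg hp]
    refine ContinuousAt.congr ?_ h2
    have hs : ContinuousAt sg (t, x) := hsg.continuousAt
    refine ContinuousAt.sub (ContinuousAt.add ?_ ?_) ?_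
    · exact hΦ.continuousAt.comp (by fun_prop)
    · exact hΘ.continuousAt.comp (by fun_prop)
    · exact hΘ.continuousAt.comp (by fun_prop)

/-- goodness of a tuple on the unit ball -/
def Good {r : ℕ} (φ : E → Fin r → P) (Θ : C(E, YY r P)) : Prop :=
  ∃ φ' : C(Metric.closedBall (0 : E) 1, YY r P), (∀ x, (φ' x).1 = φ x) ∧
    φ'.HomotopicRel (Θ.restrict _) {x | ‖x.1‖ = 1}

lemma cell_step3 {r : ℕ} [Fintype C] (F : C → E → P) (hF : ∀ c, Continuous (F c)) (π : Fin r → C)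
    (hπ : Function.Injective π) (Θ : C(E, YY r P))
    (hΘ : ∀ x, ‖x‖ = 1 → (Θ x).1 = fun i => F (π i) x)
    (h0 : ∀ c c', c ∉ range π → c' ∉ range π → c ≠ c' → F c 0 ≠ F c' 0)
    (h1 : ∀ c c', c ∉ range π → c' ∉ range π → c ≠ c' → ∀ t : ℝ, 0 ≤ t → t ≤ 1 → ∀ z, ‖z‖ ≤ 1 →
      (¬ ND fun i => F (π i) z) → F c (t • z) ≠ F c' (t • z)) :
    ∃ F' : C → E → P, (∀ c, Continuous (F' c)) ∧ (∀ c x, ‖x‖ = 1 → F' c x = F c x) ∧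
      Good (fun x i => F' (π i) x) Θ ∧
      ∀ (τ : Fin r → C) (T : C(E, YY r P)),
        (∃ i i', τ i ≠ τ i' ∧ τ i ∉ range π ∧ τ i' ∉ range π) →
        Good (fun x i => F (τ i) x) T → Good (fun x i => F' (τ i) x) T := by
  classical
  set Φ : E → Fin r → P := fun x i => F (π i) x with hΦdef
  have hΦ : Continuous Φ := continuous_pi fun i => hF _
  have hΘc : Continuous (fun x => (Θ x).1) := by fun_prop
  have hS : ∀ x, ‖x‖ = 1 → Φ x = (Θ x).1 := fun x hx => (hΘ x hx).symm
  set Z : Set E := {z | ‖z‖ ≤ 1 ∧ ¬ ND (Φ z)} with hZ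
  have hZc : IsCompact Z := by
    have : Z = Metric.closedBall 0 1 ∩ Φ ⁻¹' {v | ND v}ᶜ := by
      ext z; simp [hZ]
    rw [this]
    exact (isCompact_closedBall 0 1).inter_right (isOpen_ND.isClosed_compl.preimage hΦ)
  set S : Set E := (fun p : ℝ × E => p.1 • p.2) '' (Icc 0 1 ×ˢ (insert 0 Z)) with hSdef
  have hSc : IsCompact S := (isCompact_Icc.prod (hZc.insert 0)).image (by fun_prop)
  have hZ1 : ∀ z ∈ insert 0 Z, ‖z‖ < 1 := by
    rintro z (rfl | hz)
    · simp
    · refine lt_of_le_of_ne hz.1 fun h => hz.2 ?_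
      rw [hS z h]; exact (Θ z).2
  set O : Set E := {x | ‖x‖ < 1 ∧ ∀ c c', c ∉ range π → c' ∉ range π → c ≠ c' → F c x ≠ F c' x}
    with hO
  have hOo : IsOpen O := by
    have : O = {x | ‖x‖ < 1} ∩ ⋂ c, ⋂ c', ⋂ (_ : c ∉ range π), ⋂ (_ : c' ∉ range π),
        ⋂ (_ : c ≠ c'), {x | F c x ≠ F c' x} := by
      ext x; simp [hO]
    rw [this]
    refine (isOpen_lt continuous_norm continuous_const).inter ?_
    refine isOpen_iInter_of_finite fun c => isOpen_iInter_of_finite fun c' =>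
      isOpen_iInter_of_finite fun _ => isOpen_iInter_of_finite fun _ =>
      isOpen_iInter_of_finite fun _ => isOpen_ne_fun (hF c) (hF c')
  have hSO : S ⊆ O := by
    rintro _ ⟨⟨t, z⟩, ⟨⟨ht0, ht1⟩, hz⟩, rfl⟩
    simp only at ht0 ht1 hz ⊢
    refine ⟨?_, ?_⟩
    · rw [norm_smul, Real.norm_eq_abs, abs_of_nonneg ht0]
      have := hZ1 z hz
      nlinarith [norm_nonneg z]
    · intro c c' hc hc' hcc
      rcases hz with rfl | hz
      · simpa using h0 c c' hc hc' hcc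
      · exact h1 c c' hc hc' hcc t ht0 ht1 z hz.1 hz.2
  have h0S : (0 : E) ∈ S := ⟨(0, 0), ⟨⟨le_rfl, zero_le_one⟩, mem_insert _ _⟩, by simp⟩
  obtain ⟨u, hu0, hu1, hu⟩ := exists_continuous_zero_one_of_isClosed hOo.isClosed_compl
    hSc.isClosed (disjoint_compl_left_iff_subset.2 hSO)
  -- the modified map
  have hKc : Continuous (fun x => KK Φ (fun x => (Θ x).1) (u x) x) := by
    have := KK_continuous (A := Unit) hΦ hΘc hS (fun p => u p.2) (by fun_prop)
      (fun _ => hu1 h0S)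
    exact this.comp (f := fun x => ((), x)) (by fun_prop)
  let F' : C → E → P := fun c x => if h : c ∈ range π then
    KK Φ (fun x => (Θ x).1) (u x) x h.choose else F c x
  have hF'π : ∀ i x, F' (π i) x = KK Φ (fun x => (Θ x).1) (u x) x i := by
    intro i x
    have h : π i ∈ range π := mem_range_self i
    simp only [F', dif_pos h]
    rw [hπ h.choose_spec]
  have hF'n : ∀ c x, c ∉ range π → F' c x = F c x := by
    intro c x h
    simp only [F', dif_neg h]
  have hF'c : ∀ c, Continuous (F' c) := by
    intro c
    by_cases h : c ∈ range π
    · obtain ⟨i, rfl⟩ := h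
      rw [show F' (π i) = fun x => KK Φ (fun x => (Θ x).1) (u x) x i from funext (hF'π i)]
      exact (continuous_apply i).comp hKc
    · rw [show F' c = F c from funext fun x => hF'n c x h]; exact hF c
  have hF'O : ∀ c x, x ∉ O → F' c x = F c x := by
    intro c x hx
    by_cases h : c ∈ range π
    · obtain ⟨i, rfl⟩ := h
      have hx0 : x ≠ 0 := fun h => hx (h ▸ hSO h0S)
      have : u x = 0 := hu0 hx
      rw [hF'π, this, KK_le hx0 (by norm_num)]
      simp [hΦdef]
    · exact hF'n c x h
  have hS1 : ∀ x : E, ‖x‖ = 1 → x ∉ O := fun x hx h => by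
    have := h.1; linarith
  refine ⟨F', hF'c, fun c x hx => hF'O c x (hS1 x hx), ?_, ?_⟩
  · -- homotopy for π
    let sg : I × E → ℝ := fun p => (1 - (p.1 : ℝ)) * u p.2 + p.1 * (1 - ‖p.2‖ / 2)
    have hsg : Continuous sg := by fun_prop
    have hK2 := KK_continuous hΦ hΘc hS sg hsg (by
      intro t
      have : u (0 : E) = 1 := hu1 h0S
      simp [sg, this])
    have hND : ∀ (t : I) (x : Metric.closedBall (0 : E) 1),
        ND (KK Φ (fun x => (Θ x).1) (sg (t, x.1)) x.1) := by
      rintro t ⟨x, hx⟩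
      rw [mem_closedBall_zero_iff] at hx
      simp only
      by_cases hx0 : x = 0
      · simp only [KK, hx0, if_true]; exact (Θ 0).2
      by_cases hs : 1 / 2 ≤ sg (t, x)
      · rw [KK_ge hS hx0 hs]; exact (Θ _).2
      · push Not at hs
        rw [KK_le hx0 hs.le]
        have hsg0 : 0 ≤ sg (t, x) := by
          have := (hu x).1
          have h2 := t.2.1
          have h3 := t.2.2
          have : 0 ≤ (1 - (t : ℝ)) * u x := mul_nonneg (by linarith) this
          have : 0 ≤ (t : ℝ) * (1 - ‖x‖ / 2) := mul_nonneg (by linarith) (by linarith)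
          simp only [sg]; linarith
        have hxS : x ∉ S := by
          intro hxS
          have : u x = 1 := hu1 hxS
          simp only [sg, this] at hs
          have h2 := t.2.1
          have h3 := t.2.2
          nlinarith
        by_contra hbad
        apply hxS
        have hxp : 0 < ‖x‖ := norm_pos_iff.2 hx0
        set ν : ℝ := (1 - 2 * sg (t, x)) + 2 * sg (t, x) * ‖x‖⁻¹ with hν
        have hinv : 1 ≤ ‖x‖⁻¹ := (one_le_inv₀ hxp).2 hx
        have hν1 : 1 ≤ ν := by rw [hν]; nlinarith
        have hy : (1 - 2 * sg (t, x)) • x + (2 * sg (t, x)) • dir x = ν • x := by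
          rw [hν, add_smul, dir, smul_smul]
        rw [hy] at hbad
        refine ⟨(ν⁻¹, ν • x), ⟨⟨by positivity, inv_le_one_of_one_le₀ hν1⟩,
          mem_insert_of_mem _ ⟨?_, hbad⟩⟩, ?_⟩
        · simp only
          rw [norm_smul, Real.norm_eq_abs, abs_of_nonneg (by linarith), hν, add_mul, mul_assoc,
            inv_mul_cancel₀ hxp.ne']
          nlinarith
        · simp only
          rw [smul_smul, inv_mul_cancel₀ (by linarith), one_smul]
    have hsgt0 : ∀ x, sg (0, x) = u x := fun x => by simp [sg]
    have hK3 : Continuous (fun x : Metric.closedBall (0 : E) 1 => (fun i => F' (π i) x.1)) :=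
      continuous_pi fun i => (hF'c _).comp continuous_subtype_val
    have hND' : ∀ x : Metric.closedBall (0 : E) 1, ND (fun i => F' (π i) x.1) := by
      intro x
      have := hND 0 x
      rw [hsgt0] at this
      simp only [hF'π]; exact this
    refine ⟨⟨fun x => ⟨_, hND' x⟩, hK3.subtype_mk _⟩, fun x => rfl, ?_⟩
    refine homotopicRel_of _ _
      (fun p => KK Φ (fun x => (Θ x).1) (sg (p.1, p.2.1)) p.2.1) ?_ ?_ ?_ ?_ ?_
    · exact hK2.comp (f := fun p : I × Metric.closedBall (0 : E) 1 => (p.1, p.2.1)) (by fun_prop)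
    · exact hND
    · intro x
      ext i
      simp only [hsgt0, ContinuousMap.coe_mk, hF'π]
    · rintro ⟨x, hx⟩
      rw [mem_closedBall_zero_iff] at hx
      simp only [ContinuousMap.restrict_apply]
      by_cases hx0 : x = 0
      · simp [KK, hx0]
      · have hs : sg (1, x) = 1 - ‖x‖ / 2 := by simp [sg]
        rw [KK_ge hS hx0 (by rw [hs]; linarith), hs]
        have : (2 - 2 * (1 - ‖x‖ / 2)) • dir x = x := by
          rw [dir, smul_smul]
          have : (2 - 2 * (1 - ‖x‖ / 2)) * ‖x‖⁻¹ = 1 := by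
            have := norm_ne_zero_iff.2 hx0
            field_simp; ring
          rw [this, one_smul]
        rw [this]
    · rintro t ⟨x, hx⟩ hx1
      simp only [mem_ofPred_eq] at hx1
      have hx0 : x ≠ 0 := by rintro rfl; simp at hx1
      have hux : u x = 0 := hu0 (hS1 x hx1)
      have hs : sg (t, x) = t / 2 := by simp only [sg, hux, hx1]; ring
      ext i
      simp only [ContinuousMap.coe_mk]
      rw [hF'O _ x (hS1 x hx1), KK_le hx0 (by rw [hs]; linarith [t.2.2]), dir, hx1]
      simp only [hΦdef]
      rw [inv_one, one_smul, ← add_smul]; simp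
  · rintro τ T ⟨i, i', hii, hi, hi'⟩ ⟨φ, hφ, hφT⟩
    obtain ⟨ψ, hψ, hψφ⟩ := homotopicRel_line (S := {x | ‖x.1‖ = 1}) φ
      (fun x i => F' (τ i) x.1) (continuous_pi fun i => (hF'c _).comp continuous_subtype_val)
      (by
        intro t _ _ x
        by_cases hx : x.1 ∈ O
        · intro h
          have := h i i'
          simp only [Pi.add_apply, Pi.smul_apply, Pi.sub_apply, hφ, hF'n _ _ hi, hF'n _ _ hi',
            sub_self, smul_zero, add_zero] at this
          exact hx.2 _ _ hi hi' hii this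
        · have : (fun i => F' (τ i) x.1) = (φ x).1 := by
            rw [hφ]; ext i; exact hF'O _ _ hx
          rw [this, sub_self, smul_zero, add_zero]
          exact (φ x).2)
      (by
        intro x hx
        rw [hφ]; ext i; exact hF'O _ _ (hS1 _ hx))
    exact ⟨ψ, hψ, hψφ.symm.trans hφT⟩

end cell
end TTC

open Set
open scoped Topology unitInterval

namespace TTC

section cell
variable {E P C : Type*} [NormedAddCommGroup E] [NormedSpace ℝ E] [FiniteDimensional ℝ E]
  [NormedAddCommGroup P] [NormedSpace ℝ P] [FiniteDimensional ℝ P] [Fintype C]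
open Module

lemma cell_step1 {r : ℕ} (F : C → E → P) (hF : ∀ c, Continuous (F c)) (π : Fin r → C)
    (hπ : Function.Injective π) (hdim : finrank ℝ E + 1 < r * finrank ℝ P)
    (hND : ∀ x, ‖x‖ = 1 → ND (fun i => F (π i) x))
    {ι : Type*} (𝒢 : Finset ι) (τ : ι → Fin r → C) (T : ι → C(E, YY r P))
    (h𝒢 : ∀ κ ∈ 𝒢, Good (fun x i => F (τ κ i) x) (T κ)) :
    ∃ F' : C → E → P, (∀ c, Continuous (F' c)) ∧ (∀ c x, ‖x‖ = 1 → F' c x = F c x) ∧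
      (∀ c c', c ∉ range π → c' ∉ range π → c ≠ c' → F' c 0 ≠ F' c' 0) ∧
      (∀ c c', c ∉ range π → c' ∉ range π → c ≠ c' → ∀ t : ℝ, 0 ≤ t → t ≤ 1 → ∀ z, ‖z‖ ≤ 1 →
        (¬ ND fun i => F' (π i) z) → F' c (t • z) ≠ F' c' (t • z)) ∧
      ∀ κ ∈ 𝒢, Good (fun x i => F' (τ κ i) x) (T κ) := by
  classical
  have hΦ : Continuous (fun x i => F (π i) x) := continuous_pi fun i => hF _
  set Z : Set E := {z | ‖z‖ ≤ 1 ∧ ¬ ND (fun i => F (π i) z)} with hZ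
  have hZc : IsClosed Z := by
    have : Z = Metric.closedBall 0 1 ∩ (fun x i => F (π i) x) ⁻¹' {v | ND v}ᶜ := by
      ext z; simp [hZ]
    rw [this]
    exact Metric.isClosed_closedBall.inter (isOpen_ND.isClosed_compl.preimage hΦ)
  obtain ⟨ρ, ⟨hρ0, hρ1⟩, hρ⟩ := exists_pos_lt_subset_ball (x := (0 : E)) (r := 1) zero_lt_one hZc
    (by
      intro z hz
      rw [mem_ball_zero_iff]
      exact lt_of_le_of_ne hz.1 fun h => hz.2 (hND z h))
  -- margins
  obtain ⟨ε₀, hε₀, hm₀⟩ := margin (K := Metric.closedBall (0 : E) 1 ∩ {x | ρ ≤ ‖x‖})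
    ((isCompact_closedBall 0 1).inter_right (isClosed_le continuous_const continuous_norm))
    (fun x i => F (π i) x) hΦ (by
      rintro x ⟨hx1, hx2⟩
      rw [mem_closedBall_zero_iff] at hx1
      by_contra h
      have := hρ (show x ∈ Z from ⟨hx1, h⟩)
      rw [mem_ball_zero_iff] at this
      exact absurd hx2 (not_le.2 this))
  have hm : ∀ κ : ι, ∃ ε > 0, κ ∈ 𝒢 → ∀ x ∈ Metric.closedBall (0 : E) 1, ∀ w : Fin r → P,
      (∀ i, ‖w i - F (τ κ i) x‖ < ε) → ND w := by
    intro κ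
    by_cases hκ : κ ∈ 𝒢
    · obtain ⟨φ, hφ, -⟩ := h𝒢 κ hκ
      obtain ⟨ε, hε, h⟩ := margin (isCompact_closedBall (0 : E) 1) (fun x i => F (τ κ i) x)
        (continuous_pi fun i => hF _) (by
          intro x hx
          have h := (φ ⟨x, hx⟩).2
          rw [hφ] at h; exact h)
      exact ⟨ε, hε, fun _ => h⟩
    · exact ⟨1, one_pos, fun h => absurd h hκ⟩
  choose ε hε hm using hm
  obtain ⟨δ, hδ, hδ₀, hδ'⟩ : ∃ δ > 0, δ ≤ ε₀ ∧ ∀ κ ∈ 𝒢, δ ≤ ε κ := by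
    rcases 𝒢.eq_empty_or_nonempty with h | h
    · exact ⟨ε₀, hε₀, le_rfl, by simp [h]⟩
    · refine ⟨min ε₀ (𝒢.inf' h ε), lt_min hε₀ ?_, min_le_left _ _, fun κ hκ =>
        (min_le_right _ _).trans (Finset.inf'_le _ hκ)⟩
      rw [Finset.lt_inf'_iff]; exact fun κ _ => hε κ
  have happ : ∀ c, ∃ p : E → P, ContDiff ℝ 1 p ∧ ∀ x, dist (p x) (F c x) < δ / 2 := by
    intro c
    obtain ⟨g, hg, hg', -⟩ := (hF c).exists_contDiff_approx 1 (ε := fun _ => δ / 2)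
      continuous_const (fun _ => half_pos hδ)
    exact ⟨g, hg, hg'⟩
  choose p hp hpF using happ
  obtain ⟨a, ha, hgen⟩ := exists_generic p hp π hπ hdim (half_pos hδ)
  let χ : E → ℝ := fun x => max 0 (min 1 ((1 - ‖x‖) / (1 - ρ)))
  have hχ : Continuous χ := by fun_prop
  have hχ0 : ∀ x, 0 ≤ χ x := fun x => le_max_left _ _
  have hχ1 : ∀ x, χ x ≤ 1 := fun x => max_le zero_le_one (min_le_left _ _)
  have hχρ : ∀ x, ‖x‖ ≤ ρ → χ x = 1 := by
    intro x hx
    have : 1 ≤ (1 - ‖x‖) / (1 - ρ) := by rw [le_div_iff₀ (by linarith)]; linarith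
    simp [χ, this]
  have hχs : ∀ x, ‖x‖ = 1 → χ x = 0 := by
    intro x hx
    simp [χ, hx]
  let F' : C → E → P := fun c x => F c x + χ x • (p c x + a c - F c x)
  have hF'ρ : ∀ c x, ‖x‖ ≤ ρ → F' c x = p c x + a c := by
    intro c x hx
    simp only [F', hχρ x hx, one_smul]; abel
  have hclose0 : ∀ c x, ‖p c x + a c - F c x‖ < δ := by
    intro c x
    have h1 := hpF c x
    rw [dist_eq_norm] at h1
    calc ‖p c x + a c - F c x‖ = ‖(p c x - F c x) + a c‖ := by congr 1; abel
      _ ≤ ‖p c x - F c x‖ + ‖a c‖ := norm_add_le _ _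
      _ < δ := by linarith [ha c]
  have hclose : ∀ (t : ℝ), 0 ≤ t → t ≤ 1 → ∀ c x, ‖t • (F' c x - F c x)‖ < δ := by
    intro t ht0 ht1 c x
    have : F' c x - F c x = χ x • (p c x + a c - F c x) := by simp [F']
    rw [this, smul_smul, norm_smul, Real.norm_eq_abs, abs_of_nonneg (mul_nonneg ht0 (hχ0 x))]
    have h3 : t * χ x ≤ 1 := mul_le_one₀ ht1 (hχ0 x) (hχ1 x)
    have := hclose0 c x
    nlinarith [norm_nonneg (p c x + a c - F c x), mul_nonneg ht0 (hχ0 x)]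
  have hF'c : ∀ c, Continuous (F' c) := fun c => by
    have := hF c
    have := (hp c).continuous
    fun_prop
  have hF's : ∀ c x, ‖x‖ = 1 → F' c x = F c x := fun c x hx => by simp [F', hχs x hx]
  refine ⟨F', hF'c, hF's, ?_, ?_, ?_⟩
  · intro c c' hc hc' hcc
    rw [hF'ρ c 0 (by simpa using hρ0.le), hF'ρ c' 0 (by simpa using hρ0.le)]
    exact (hgen c c' hc hc' hcc).1
  · intro c c' hc hc' hcc t ht0 ht1 z hz hzN
    have hzρ : ‖z‖ ≤ ρ := by
      by_contra h
      push Not at h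
      refine hzN (hm₀ z ⟨by simpa using hz, h.le⟩ _ fun i => ?_)
      have := hclose 1 zero_le_one le_rfl (π i) z
      rw [one_smul] at this
      exact this.trans_le hδ₀
    have htz : ‖t • z‖ ≤ ρ := by
      rw [norm_smul, Real.norm_eq_abs, abs_of_nonneg ht0]
      nlinarith [norm_nonneg z]
    rw [hF'ρ c _ htz, hF'ρ c' _ htz]
    refine (hgen c c' hc hc' hcc).2 t z ?_
    rw [ND, not_not] at hzN
    intro i j
    have := hzN i j
    rwa [hF'ρ _ _ hzρ, hF'ρ _ _ hzρ] at this
  · intro κ hκ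
    obtain ⟨φ, hφ, hφT⟩ := h𝒢 κ hκ
    obtain ⟨ψ, hψ, hψφ⟩ := homotopicRel_line (S := {x | ‖x.1‖ = 1}) φ
      (fun x i => F' (τ κ i) x.1) (continuous_pi fun i => (hF'c _).comp continuous_subtype_val)
      (by
        intro t ht0 ht1 x
        refine hm κ hκ x.1 x.2 _ fun i => ?_
        simp only [hφ, Pi.add_apply, Pi.smul_apply, Pi.sub_apply, add_sub_cancel_left]
        exact (hclose t ht0 ht1 _ _).trans_le (hδ' κ hκ))
      (by
        intro x hx
        rw [hφ]; ext i; exact hF's _ _ hx)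
    exact ⟨ψ, hψ, hψφ.symm.trans hφT⟩

lemma cell_total {r : ℕ} (F : C → E → P) (hF : ∀ c, Continuous (F c))
    (hdim : finrank ℝ E + 1 < r * finrank ℝ P)
    {ι : Type*} [Finite ι] (τ : ι → Fin r → C) (hτ : ∀ κ, Function.Injective (τ κ))
    (hτ2 : ∀ κ κ', κ ≠ κ' → ∃ i i', i ≠ i' ∧ τ κ' i ∉ range (τ κ) ∧ τ κ' i' ∉ range (τ κ))
    (T : ι → C(E, YY r P))
    (hT : ∀ κ x, ‖x‖ = 1 → (T κ x).1 = fun i => F (τ κ i) x) :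
    ∃ F' : C → E → P, (∀ c, Continuous (F' c)) ∧ (∀ c x, ‖x‖ = 1 → F' c x = F c x) ∧
      ∀ κ, Good (fun x i => F' (τ κ i) x) (T κ) := by
  classical
  have := Fintype.ofFinite ι
  suffices h : ∀ 𝒢 : Finset ι, ∃ F' : C → E → P, (∀ c, Continuous (F' c)) ∧
      (∀ c x, ‖x‖ = 1 → F' c x = F c x) ∧ ∀ κ ∈ 𝒢, Good (fun x i => F' (τ κ i) x) (T κ) by
    obtain ⟨F', h1, h2, h3⟩ := h Finset.univ
    exact ⟨F', h1, h2, fun κ => h3 κ (Finset.mem_univ _)⟩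
  intro 𝒢
  induction 𝒢 using Finset.induction with
  | empty => exact ⟨F, hF, fun _ _ _ => rfl, by simp⟩
  | insert κ 𝒢 hκ ih =>
    obtain ⟨F₁, h1, h2, h3⟩ := ih
    obtain ⟨F₂, k1, k2, k3, k4, k5⟩ := cell_step1 F₁ h1 (τ κ) (hτ κ) hdim (by
      intro x hx
      simp only [h2 _ x hx]
      rw [← hT κ x hx]; exact (T κ x).2) 𝒢 τ T h3
    obtain ⟨F₃, l1, l2, l3, l4⟩ := cell_step3 F₂ k1 (τ κ) (hτ κ) (T κ) (by
      intro x hx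
      rw [hT κ x hx]; ext i; rw [k2 _ x hx, h2 _ x hx]) k3 k4
    refine ⟨F₃, l1, fun c x hx => by rw [l2 c x hx, k2 c x hx, h2 c x hx], ?_⟩
    intro κ' hκ'
    rcases Finset.mem_insert.1 hκ' with rfl | hκ'
    · exact l3
    · refine l4 _ _ ?_ (k5 κ' hκ')
      obtain ⟨i, i', hii, hi, hi'⟩ := hτ2 κ κ' (by rintro rfl; exact hκ hκ')
      exact ⟨i, i', (hτ κ').ne hii, hi, hi'⟩

/-- retraction onto the ball -/
noncomputable def ret (x : E) : Metric.closedBall (0 : E) 1 :=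
  ⟨(max 1 ‖x‖)⁻¹ • x, by
    rw [mem_closedBall_zero_iff, norm_smul, norm_inv, Real.norm_eq_abs,
      abs_of_pos (lt_max_of_lt_left one_pos), inv_mul_le_iff₀ (lt_max_of_lt_left one_pos)]
    simp⟩

lemma ret_continuous : Continuous (ret (E := E)) := by
  unfold ret
  refine Continuous.subtype_mk ?_ _
  have : ∀ x : E, max 1 ‖x‖ ≠ 0 := fun x => (lt_max_of_lt_left one_pos).ne'
  fun_prop (disch := assumption)

lemma ret_of_mem (x : Metric.closedBall (0 : E) 1) : ret x.1 = x := by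
  have := mem_closedBall_zero_iff.1 x.2
  ext
  simp [ret, this]

/-- The cell lemma. -/
theorem cell_lemma {X : Type*} [TopologicalSpace X] (S : Set X)
    (e : X ≃ₜ Metric.closedBall (0 : E) 1) (he : ∀ x, x ∈ S ↔ ‖(e x).1‖ = 1) {r : ℕ}
    (F : C → X → P) (hF : ∀ c, Continuous (F c))
    (hdim : finrank ℝ E + 1 < r * finrank ℝ P)
    {ι : Type*} [Finite ι] (τ : ι → Fin r → C) (hτ : ∀ κ, Function.Injective (τ κ))
    (hτ2 : ∀ κ κ', κ ≠ κ' → ∃ i i', i ≠ i' ∧ τ κ' i ∉ range (τ κ) ∧ τ κ' i' ∉ range (τ κ))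
    (T : ι → C(X, YY r P))
    (hT : ∀ κ, ∀ x ∈ S, (T κ x).1 = fun i => F (τ κ i) x) :
    ∃ F' : C → X → P, (∀ c, Continuous (F' c)) ∧ (∀ c, ∀ x ∈ S, F' c x = F c x) ∧
      ∀ κ, ∃ φ : C(X, YY r P), (∀ x, (φ x).1 = fun i => F' (τ κ i) x) ∧
        φ.HomotopicRel (T κ) S := by
  let ρ : C(E, X) := ⟨fun x => e.symm (ret x), e.symm.continuous.comp ret_continuous⟩
  have hρ : ∀ x : Metric.closedBall (0 : E) 1, ρ x.1 = e.symm x := fun x => by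
    simp [ρ, ret_of_mem]
  have hρS : ∀ x : E, ‖x‖ = 1 → ρ x ∈ S := by
    intro x hx
    have hx' : x ∈ Metric.closedBall (0 : E) 1 := by simp [hx]
    rw [he, hρ ⟨x, hx'⟩]; simpa using hx
  obtain ⟨F', h1, h2, h3⟩ := cell_total (fun c x => F c (ρ x)) (fun c => (hF c).comp ρ.continuous)
    hdim τ hτ hτ2 (fun κ => (T κ).comp ρ) (by
      intro κ x hx
      exact hT κ _ (hρS x hx))
  refine ⟨fun c x => F' c (e x).1, fun c => (h1 c).comp (by fun_prop), ?_, ?_⟩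
  · intro c x hx
    simp only
    rw [h2 c _ ((he x).1 hx), hρ, e.symm_apply_apply]
  · intro κ
    obtain ⟨φ, hφ, ⟨H⟩⟩ := h3 κ
    refine ⟨φ.comp ⟨e, e.continuous⟩, fun x => hφ _, ?_⟩
    refine homotopicRel_of _ _ (fun p => (H (p.1, e p.2)).1) (by fun_prop) ?_ ?_ ?_ ?_
    · intro t x; exact (H (t, e x)).2
    · intro x; simp
    · intro x; simp [hρ]
    · intro t x hx
      rw [H.eq_fst t ((he x).1 hx)]; rfl

end cell
end TTC

open Set
open scoped Topology unitInterval RealInnerProductSpace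

namespace TTC

section local_mod
variable {V : Type*} [NormedAddCommGroup V] [InnerProductSpace ℝ V]

/-- clamp to `[-1,1]` -/
noncomputable def cl (t : ℝ) : ℝ := max (-1) (min 1 t)

/-- rotation angle -/
noncomputable def th (N : ℤ) (δ : ℝ) (u x : V) : ℝ := N * (Real.pi * (1 + cl (⟪u, x⟫ / (δ * ‖x‖))))

/-- component orthogonal to the plane -/
noncomputable def qq (a u x : V) : V := x - ⟪a, x⟫ • a - ⟪u, x⟫ • u

/-- cutoff -/
noncomputable def kap (δ : ℝ) (a u x : V) : ℝ := max 0 (1 - ‖qq a u x‖ / (δ * ‖x‖))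

/-- rotation displacement -/
noncomputable def rr (N : ℤ) (δ : ℝ) (a u x : V) : V :=
  ((Real.cos (th N δ u x) - 1) * ⟪a, x⟫ - Real.sin (th N δ u x) * ⟪u, x⟫) • a +
  (Real.sin (th N δ u x) * ⟪a, x⟫ + (Real.cos (th N δ u x) - 1) * ⟪u, x⟫) • u

/-- local modification -/
noncomputable def mm (N : ℤ) (δ : ℝ) (a u x : V) : V :=
  if ⟪a, x⟫ ≤ 0 then 0 else kap δ a u x • rr N δ a u x

/-- orthonormal pair -/
def OP (a u : V) : Prop := ‖a‖ = 1 ∧ ‖u‖ = 1 ∧ ⟪a, u⟫ = 0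

lemma trig_one (N : ℤ) : Real.cos (N * (Real.pi * (1 + 1))) = 1 ∧
    Real.sin (N * (Real.pi * (1 + 1))) = 0 := by
  have : (N : ℝ) * (Real.pi * (1 + 1)) = N * (2 * Real.pi) := by ring
  rw [this]
  refine ⟨Real.cos_int_mul_two_pi N, ?_⟩
  have : (N : ℝ) * (2 * Real.pi) = ((2 * N : ℤ) : ℝ) * Real.pi := by push_cast; ring
  rw [this]; exact Real.sin_int_mul_pi _

lemma cl_of_one_le {t : ℝ} (h : 1 ≤ t) : cl t = 1 := by
  simp [cl, h]

lemma cl_of_le {t : ℝ} (h : t ≤ -1) : cl t = -1 := by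
  rw [cl, min_eq_right (by linarith), max_eq_left h]

lemma rr_zero {N : ℤ} {δ : ℝ} (hδ : 0 < δ) {a u x : V} (hx : x ≠ 0) (h : δ * ‖x‖ ≤ |⟪u, x⟫|) :
    rr N δ a u x = 0 := by
  have hp : 0 < δ * ‖x‖ := mul_pos hδ (norm_pos_iff.2 hx)
  have : Real.cos (th N δ u x) = 1 ∧ Real.sin (th N δ u x) = 0 := by
    rcases le_abs'.1 h with h | h
    · rw [th, cl_of_le]
      · simp
      · rw [div_le_iff₀ hp]; linarith
    · rw [th, cl_of_one_le]
      · exact trig_one N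
      · rw [le_div_iff₀ hp]; linarith
  simp [rr, this.1, this.2]

lemma kap_zero {δ : ℝ} (hδ : 0 < δ) {a u x : V} (hx : x ≠ 0) (h : δ * ‖x‖ ≤ ‖qq a u x‖) :
    kap δ a u x = 0 := by
  have hp : 0 < δ * ‖x‖ := mul_pos hδ (norm_pos_iff.2 hx)
  have : 1 ≤ ‖qq a u x‖ / (δ * ‖x‖) := by rw [le_div_iff₀ hp]; linarith
  rw [kap, max_eq_left]; linarith

lemma inner_qq {a u : V} (h : OP a u) (x : V) : ⟪a, qq a u x⟫ = 0 ∧ ⟪u, qq a u x⟫ = 0 := by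
  obtain ⟨h1, h2, h3⟩ := h
  have h4 : ⟪u, a⟫ = 0 := by rw [real_inner_comm]; exact h3
  constructor
  · simp [qq, inner_sub_right, inner_smul_right, h1, h3]
  · simp [qq, inner_sub_right, inner_smul_right, h2, h4]

lemma norm_comb {a u q : V} (h : OP a u) (h1 : ⟪a, q⟫ = 0) (h2 : ⟪u, q⟫ = 0) (s y : ℝ) :
    ‖s • a + y • u + q‖ ^ 2 = s ^ 2 + y ^ 2 + ‖q‖ ^ 2 := by
  obtain ⟨h3, h4, h5⟩ := h
  rw [norm_add_sq_real, norm_add_sq_real, norm_smul, norm_smul, h3, h4]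
  simp [inner_add_left, inner_smul_left, inner_smul_right, h1, h2, h5]

lemma norm_decomp {a u : V} (h : OP a u) (x : V) :
    ‖x‖ ^ 2 = ⟪a, x⟫ ^ 2 + ⟪u, x⟫ ^ 2 + ‖qq a u x‖ ^ 2 := by
  rw [← norm_comb h (inner_qq h x).1 (inner_qq h x).2]
  congr 2
  simp [qq]

lemma kr_zero_of {N : ℤ} {δ : ℝ} (hδ : 0 < δ) (hδ2 : δ ≤ 1 / 2) {a u x : V} (h : OP a u)
    (hx : x ≠ 0) (hs : ⟪a, x⟫ = 0) : kap δ a u x • rr N δ a u x = 0 := by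
  by_cases h1 : δ * ‖x‖ ≤ ‖qq a u x‖
  · rw [kap_zero hδ hx h1, zero_smul]
  · by_cases h2 : δ * ‖x‖ ≤ |⟪u, x⟫|
    · rw [rr_zero hδ hx h2, smul_zero]
    · exfalso
      push Not at h1 h2
      have h3 := norm_decomp h x
      rw [hs, ← sq_abs ⟪u, x⟫] at h3
      have hx' := norm_pos_iff.2 hx
      have h4 : |⟪u, x⟫| ^ 2 < (δ * ‖x‖) ^ 2 := by gcongr
      have h5 : ‖qq a u x‖ ^ 2 < (δ * ‖x‖) ^ 2 := by gcongr
      have h6 : (δ * ‖x‖) ^ 2 ≤ (1 / 2 * ‖x‖) ^ 2 := by gcongr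
      nlinarith [sq_nonneg ‖x‖]

/-- support of the local modification -/
lemma mm_support {N : ℤ} {δ : ℝ} (hδ : 0 < δ) (hδ2 : δ ≤ 1 / 2) {a u x : V} (h : OP a u)
    (hx : x ≠ 0) (hm : mm N δ a u x ≠ 0) : ‖x - ‖x‖ • a‖ < 2 * δ * ‖x‖ := by
  have hs : 0 < ⟪a, x⟫ := by
    by_contra hs
    push Not at hs
    exact hm (if_pos hs)
  rw [mm, if_neg (not_le.2 hs)] at hm
  have h1 : ‖qq a u x‖ < δ * ‖x‖ := by
    by_contra h1; push Not at h1
    exact hm (by rw [kap_zero hδ hx h1, zero_smul])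
  have h2 : |⟪u, x⟫| < δ * ‖x‖ := by
    by_contra h2; push Not at h2
    exact hm (by rw [rr_zero hδ hx h2, smul_zero])
  have hx' := norm_pos_iff.2 hx
  have h3 := norm_decomp h x
  have h4 : |⟪u, x⟫| ^ 2 < (δ * ‖x‖) ^ 2 := by gcongr
  have h5 : ‖qq a u x‖ ^ 2 < (δ * ‖x‖) ^ 2 := by gcongr
  rw [sq_abs] at h4
  have e : x - ‖x‖ • a = (⟪a, x⟫ - ‖x‖) • a + ⟪u, x⟫ • u + qq a u x := by
    rw [sub_smul, qq]; abel
  refine lt_of_pow_lt_pow_left₀ 2 (by positivity) ?_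
  rw [e, norm_comb h (inner_qq h x).1 (inner_qq h x).2]
  set s := ⟪a, x⟫
  have h6 : ‖x‖ - s ≤ δ * ‖x‖ := by
    have : ‖x‖ * (‖x‖ - s) ≤ ‖x‖ * (δ * ‖x‖) := by
      have : s ≤ ‖x‖ := by nlinarith [sq_nonneg ⟪u, x⟫, sq_nonneg ‖qq a u x‖]
      have k1 : ‖x‖ * (‖x‖ - s) ≤ ‖x‖ ^ 2 - s ^ 2 := by nlinarith
      have k2 : 2 * (δ * ‖x‖) ^ 2 ≤ ‖x‖ * (δ * ‖x‖) := by
        have : 2 * (δ * ‖x‖) ^ 2 = (2 * δ) * (‖x‖ * (δ * ‖x‖)) := by ring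
        rw [this]
        have : 0 ≤ ‖x‖ * (δ * ‖x‖) := by positivity
        nlinarith
      linarith
    exact le_of_mul_le_mul_left this hx'
  have h7 : 0 ≤ ‖x‖ - s := by nlinarith [sq_nonneg ⟪u, x⟫, sq_nonneg ‖qq a u x‖]
  have h8 : (s - ‖x‖) ^ 2 ≤ (δ * ‖x‖) ^ 2 := by
    rw [← neg_sq, neg_sub]; gcongr
  nlinarith [sq_nonneg (δ * ‖x‖)]

lemma mm_disjoint {N N' : ℤ} {δ : ℝ} (hδ : 0 < δ) (hδ2 : δ ≤ 1 / 2) {a u a' u' x : V} (h : OP a u)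
    (h' : OP a' u') (hx : x ≠ 0) (hsep : 4 * δ ≤ ‖a - a'‖) (hm : mm N δ a u x ≠ 0) :
    mm N' δ a' u' x = 0 := by
  by_contra hm'
  have h1 := mm_support hδ hδ2 h hx hm
  have h2 := mm_support hδ hδ2 h' hx hm'
  have hx' := norm_pos_iff.2 hx
  have h3 : ‖‖x‖ • (a - a')‖ < 4 * δ * ‖x‖ := by
    calc ‖‖x‖ • (a - a')‖ = ‖(x - ‖x‖ • a') - (x - ‖x‖ • a)‖ := by
          congr 1; rw [smul_sub]; abel
      _ ≤ _ := norm_sub_le _ _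
      _ < _ := by linarith
  rw [norm_smul, norm_norm] at h3
  nlinarith

lemma mm_nonvanish {N : ℤ} {δ : ℝ} (hδ : 0 < δ) {a u x : V} (h : OP a u)
    (hx : x ≠ 0) : x + mm N δ a u x ≠ 0 := by
  intro h0
  by_cases hs : ⟪a, x⟫ ≤ 0
  · rw [mm, if_pos hs, add_zero] at h0; exact hx h0
  rw [mm, if_neg hs] at h0
  push Not at hs
  set θ := th N δ u x with hθ
  set κ := kap δ a u x with hκ
  have e : x + κ • rr N δ a u x = (⟪a, x⟫ + κ * ((Real.cos θ - 1) * ⟪a, x⟫ - Real.sin θ * ⟪u, x⟫)) • a +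
      (⟪u, x⟫ + κ * (Real.sin θ * ⟪a, x⟫ + (Real.cos θ - 1) * ⟪u, x⟫)) • u + qq a u x := by
    rw [rr, qq, ← hθ]; module
  have h1 := norm_comb h (inner_qq h x).1 (inner_qq h x).2
    (⟪a, x⟫ + κ * ((Real.cos θ - 1) * ⟪a, x⟫ - Real.sin θ * ⟪u, x⟫))
    (⟪u, x⟫ + κ * (Real.sin θ * ⟪a, x⟫ + (Real.cos θ - 1) * ⟪u, x⟫))
  rw [← e, h0, norm_zero] at h1
  have hq : ‖qq a u x‖ = 0 := by
    have : ‖qq a u x‖ ^ 2 = 0 := le_antisymm (by nlinarith [sq_nonneg (⟪a, x⟫ + κ * ((Real.cos θ - 1) * ⟪a, x⟫ - Real.sin θ * ⟪u, x⟫)), sq_nonneg (⟪u, x⟫ + κ * (Real.sin θ * ⟪a, x⟫ + (Real.cos θ - 1) * ⟪u, x⟫))]) (sq_nonneg _)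
    exact pow_eq_zero_iff (two_ne_zero) |>.1 this
  have hκ1 : κ = 1 := by rw [hκ, kap, hq]; simp
  rw [hκ1, hq] at h1
  have := Real.sin_sq_add_cos_sq θ
  have h2 : ⟪a, x⟫ ^ 2 + ⟪u, x⟫ ^ 2 = 0 := by
    have h3 : (⟪a, x⟫ + 1 * ((Real.cos θ - 1) * ⟪a, x⟫ - Real.sin θ * ⟪u, x⟫)) ^ 2 +
      (⟪u, x⟫ + 1 * (Real.sin θ * ⟪a, x⟫ + (Real.cos θ - 1) * ⟪u, x⟫)) ^ 2 =
       (Real.sin θ ^ 2 + Real.cos θ ^ 2) * (⟪a, x⟫ ^ 2 + ⟪u, x⟫ ^ 2) := by ring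
    rw [this] at h3
    linarith
  nlinarith [sq_nonneg ⟪u, x⟫]

lemma mm_continuous {A : Type*} [TopologicalSpace A] (N : ℤ) {δ : ℝ} (hδ : 0 < δ)
    (hδ2 : δ ≤ 1 / 2) (a u x : A → V) (ha : Continuous a) (hu : Continuous u) (hx : Continuous x)
    (hOP : ∀ t, OP (a t) (u t)) (hx0 : ∀ t, x t ≠ 0) :
    Continuous (fun t => mm N δ (a t) (u t) (x t)) := by
  unfold mm
  have hd : ∀ t, δ * ‖x t‖ ≠ 0 := fun t => (mul_pos hδ (norm_pos_iff.2 (hx0 t))).ne'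
  have hth : Continuous (fun t => th N δ (u t) (x t)) := by
    unfold th cl
    fun_prop (disch := assumption)
  have hk : Continuous (fun t => kap δ (a t) (u t) (x t)) := by
    unfold kap qq
    fun_prop (disch := assumption)
  refine Continuous.if_le continuous_const ?_ (by fun_prop) continuous_const ?_
  · unfold rr; fun_prop
  · intro t ht
    rw [kr_zero_of hδ hδ2 (hOP t) (hx0 t) ht]

/-- the global modification -/
noncomputable def gg {L : Type*} [Fintype L] (N : L → ℤ) (δ : ℝ) (a u : L → V) (x : V) : V :=
  x + ∑ l, mm (N l) δ (a l) (u l) x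

variable {L : Type*} [Fintype L]

lemma gg_ne_zero (N : L → ℤ) {δ : ℝ} (hδ : 0 < δ) (hδ2 : δ ≤ 1 / 2) (a u : L → V)
    (hOP : ∀ l, OP (a l) (u l)) (hsep : ∀ l l', l ≠ l' → 4 * δ ≤ ‖a l - a l'‖) {x : V} (hx : x ≠ 0) :
    gg N δ a u x ≠ 0 := by
  rw [gg]
  by_cases h : ∃ l, mm (N l) δ (a l) (u l) x ≠ 0
  · obtain ⟨l, hl⟩ := h
    rw [Finset.sum_eq_single l]
    · exact mm_nonvanish hδ (hOP l) hx
    · intro l' _ hll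
      exact mm_disjoint hδ hδ2 (hOP l) (hOP l') hx (hsep l l' hll.symm) hl
    · simp
  · push Not at h
    simpa [h] using hx

/-- `gg` on nonzero vectors -/
noncomputable def ggC (N : L → ℤ) {δ : ℝ} (hδ : 0 < δ) (hδ2 : δ ≤ 1 / 2) (a u : L → V)
    (hOP : ∀ l, OP (a l) (u l)) (hsep : ∀ l l', l ≠ l' → 4 * δ ≤ ‖a l - a l'‖) :
    C({x : V // x ≠ 0}, {x : V // x ≠ 0}) :=
  ⟨fun x => ⟨gg N δ a u x.1, gg_ne_zero N hδ hδ2 a u hOP hsep x.2⟩, by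
    refine Continuous.subtype_mk ?_ _
    unfold gg
    refine continuous_subtype_val.add (continuous_finsetSum _ fun l _ => ?_)
    exact mm_continuous (N l) hδ hδ2 _ _ _ continuous_const continuous_const continuous_subtype_val
      (fun _ => hOP l) (fun x => x.2)⟩

lemma ggC_homotopic (N : L → ℤ) {δ : ℝ} (hδ : 0 < δ) (hδ2 : δ ≤ 1 / 2) (a u : I → L → V)
    (ha : ∀ l, Continuous fun t => a t l) (hu : ∀ l, Continuous fun t => u t l)
    (hOP : ∀ t l, OP (a t l) (u t l)) (hsep : ∀ t l l', l ≠ l' → 4 * δ ≤ ‖a t l - a t l'‖) :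
    (ggC N hδ hδ2 (a 0) (u 0) (hOP 0) (hsep 0)).Homotopic
      (ggC N hδ hδ2 (a 1) (u 1) (hOP 1) (hsep 1)) := by
  refine ⟨⟨⟨fun p => ⟨gg N δ (a p.1) (u p.1) p.2.1,
    gg_ne_zero N hδ hδ2 _ _ (hOP p.1) (hsep p.1) p.2.2⟩, ?_⟩, fun x => rfl, fun x => rfl⟩⟩
  refine Continuous.subtype_mk ?_ _
  unfold gg
  refine (by fun_prop : Continuous fun p : I × {x : V // x ≠ 0} => p.2.1).add
    (continuous_finsetSum _ fun l _ => ?_)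
  exact mm_continuous (N l) hδ hδ2 (fun p : I × {x : V // x ≠ 0} => a p.1 l) (fun p => u p.1 l)
    (fun p => p.2.1) ((ha l).comp continuous_fst) ((hu l).comp continuous_fst) (by fun_prop)
    (fun p => hOP p.1 l) (fun p => p.2.2)
end local_mod
end TTC

open Set
open scoped Topology unitInterval RealInnerProductSpace

namespace TTC

/-- local winding map -/
noncomputable def EE (δ : ℝ) (ω z : ℂ) : ℂ :=
  if (starRingEnd ℂ ω * z).re ≤ 0 then 1 else
    Complex.exp ((Real.pi * (1 + cl ((starRingEnd ℂ ω * z).im / (δ * ‖z‖))) : ℝ) * Complex.I)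

lemma norm_EE (δ : ℝ) (ω z : ℂ) : ‖EE δ ω z‖ = 1 := by
  unfold EE; split_ifs
  · simp
  · exact Complex.norm_exp_ofReal_mul_I _

lemma EE_continuous {δ : ℝ} (hδ : 0 < δ) (hδ2 : δ ≤ 1 / 2) (ω : ℂ) (hω : ‖ω‖ = 1) {A : Type*}
    [TopologicalSpace A] (z : A → ℂ) (hz : Continuous z) (hz0 : ∀ t, z t ≠ 0) :
    Continuous fun t => EE δ ω (z t) := by
  unfold EE
  have hd : ∀ t, δ * ‖z t‖ ≠ 0 := fun t => (mul_pos hδ (norm_pos_iff.2 (hz0 t))).ne'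
  refine Continuous.if_le continuous_const ?_ ?_ continuous_const ?_
  · unfold cl
    have : Continuous fun t => (starRingEnd ℂ ω * z t).im :=
      Complex.continuous_im.comp (continuous_const.mul hz)
    fun_prop (disch := assumption)
  · exact Complex.continuous_re.comp (continuous_const.mul hz)
  · intro t ht
    have hp : 0 < ‖z t‖ := norm_pos_iff.2 (hz0 t)
    have h1 : |(starRingEnd ℂ ω * z t).im| = ‖z t‖ := by
      have := Complex.sq_norm (starRingEnd ℂ ω * z t)
      rw [Complex.normSq_apply, ht, norm_mul, Complex.norm_conj, hω, one_mul] at this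
      rw [← abs_of_pos hp, ← sq_eq_sq_iff_abs_eq_abs]; linarith
    have hdp : 0 < δ * ‖z t‖ := mul_pos hδ hp
    rcases abs_choice (starRingEnd ℂ ω * z t).im with h | h
    · rw [cl_of_one_le]
      · have : ((Real.pi * (1 + 1) : ℝ) : ℂ) * Complex.I = 2 * Real.pi * Complex.I := by
          push_cast; ring
        rw [this, Complex.exp_two_pi_mul_I]
      · rw [le_div_iff₀ hdp]; nlinarith
    · rw [cl_of_le]
      · simp
      · rw [div_le_iff₀ hdp]; nlinarith

lemma EE_ne {δ : ℝ} (hδ : 0 < δ) (ω : ℂ) (hω : ‖ω‖ = 1) {z : ℂ} (hz : z ≠ 0) (t : ℝ)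
    (ht0 : 0 ≤ t) (ht1 : t ≤ 1) :
    (1 - t : ℂ) * EE δ ω z + t * (-(starRingEnd ℂ ω * z / ‖z‖)) ≠ 0 := by
  intro h
  have hp : 0 < ‖z‖ := norm_pos_iff.2 hz
  set ζ := starRingEnd ℂ ω * z with hζ
  have hn : ‖ζ / ‖z‖‖ = 1 := by
    rw [norm_div, hζ, norm_mul, Complex.norm_conj, hω, one_mul, Complex.norm_real, norm_norm,
      div_self hp.ne']
  have h1 : ((1 - t : ℝ) : ℂ) * EE δ ω z = (t : ℂ) * (ζ / ‖z‖) := by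
    push_cast; linear_combination h
  have h2 := congrArg norm h1
  rw [norm_mul, norm_mul, norm_EE, hn, Complex.norm_real, Complex.norm_real, Real.norm_eq_abs,
    Real.norm_eq_abs, abs_of_nonneg ht0, abs_of_nonneg (by linarith)] at h2
  have ht : t = 1 / 2 := by linarith
  have h3 : EE δ ω z = ζ / ‖z‖ := by
    rw [ht] at h1
    push_cast at h1
    linear_combination 2 * h1
  have hre : (EE δ ω z).re = ζ.re / ‖z‖ := by rw [h3, Complex.div_ofReal_re]
  have him : (EE δ ω z).im = ζ.im / ‖z‖ := by rw [h3, Complex.div_ofReal_im]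
  unfold EE at hre him
  rw [← hζ] at hre him
  split_ifs at hre him with h5
  · have : ζ.re / ‖z‖ ≤ 0 := div_nonpos_of_nonpos_of_nonneg h5 hp.le
    rw [Complex.one_re] at hre; linarith
  · push Not at h5
    have hpos : 0 < ζ.re / ‖z‖ := div_pos h5 hp
    rw [Complex.exp_ofReal_mul_I_re] at hre
    rw [Complex.exp_ofReal_mul_I_im] at him
    have e : ∀ k : ℝ, Real.pi * (1 + k) = Real.pi * k + Real.pi := fun k => by ring
    rw [e, Real.cos_add_pi] at hre
    rw [e, Real.sin_add_pi] at him
    have hdp : 0 < δ * ‖z‖ := mul_pos hδ hp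
    have hpi := Real.pi_pos
    rcases lt_trichotomy ζ.im 0 with hi | hi | hi
    · have k1 : ζ.im / (δ * ‖z‖) < 0 := div_neg_of_neg_of_pos hi hdp
      have k2 : cl (ζ.im / (δ * ‖z‖)) ≤ 0 := max_le (by norm_num) ((min_le_right _ _).trans k1.le)
      have k3 : -1 ≤ cl (ζ.im / (δ * ‖z‖)) := le_max_left _ _
      have k4 : Real.sin (Real.pi * cl (ζ.im / (δ * ‖z‖))) ≤ 0 :=
        Real.sin_nonpos_of_nonpos_of_neg_pi_le (by nlinarith) (by nlinarith)
      have : ζ.im / ‖z‖ < 0 := div_neg_of_neg_of_pos hi hp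
      linarith
    · rw [hi] at hre
      simp [cl] at hre
      linarith
    · have k1 : 0 < ζ.im / (δ * ‖z‖) := div_pos hi hdp
      have k2 : 0 ≤ cl (ζ.im / (δ * ‖z‖)) := le_max_of_le_right (le_min zero_le_one k1.le)
      have k3 : cl (ζ.im / (δ * ‖z‖)) ≤ 1 := max_le (by norm_num) (min_le_left _ _)
      have k4 : 0 ≤ Real.sin (Real.pi * cl (ζ.im / (δ * ‖z‖))) :=
        Real.sin_nonneg_of_nonneg_of_le_pi (by nlinarith) (by nlinarith)
      have : 0 < ζ.im / ‖z‖ := div_pos hi hp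
      linarith

/-- straight line between EE and the rotated identity -/
noncomputable def ww (δ : ℝ) (ω : ℂ) (t : ℝ) (z : ℂ) : ℂ :=
  (1 - t : ℂ) * EE δ ω z + t * (-(starRingEnd ℂ ω * z / ‖z‖))

/-- normalized -/
noncomputable def hh (δ : ℝ) (ω : ℂ) (t : ℝ) (z : ℂ) : ℂ := ww δ ω t z / ‖ww δ ω t z‖

section
variable {L : Type*} [Fintype L]

/-- the homotopy in the plane -/
noncomputable def GG (N : L → ℤ) (δ : ℝ) (ω : L → ℂ) (t : ℝ) (z : ℂ) : ℂ :=
  z * ∏ l, hh δ (ω l) t z ^ N l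

lemma norm_hh {δ : ℝ} (hδ : 0 < δ) (ω : L → ℂ) (hω : ∀ l, ‖ω l‖ = 1) (l : L) {t : ℝ} (ht0 : 0 ≤ t) (ht1 : t ≤ 1) {z : ℂ} (hz : z ≠ 0) :
    ‖hh δ (ω l) t z‖ = 1 := by
  rw [hh, norm_div, Complex.norm_real, norm_norm, div_self]
  exact norm_ne_zero_iff.2 (EE_ne hδ (ω l) (hω l) hz t ht0 ht1)

lemma norm_GG (N : L → ℤ) {δ : ℝ} (hδ : 0 < δ) (ω : L → ℂ) (hω : ∀ l, ‖ω l‖ = 1)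
    {t : ℝ} (ht0 : 0 ≤ t) (ht1 : t ≤ 1) (z : ℂ) : ‖GG N δ ω t z‖ = ‖z‖ := by
  by_cases hz : z = 0
  · simp [GG, hz]
  · rw [GG, norm_mul, norm_prod, Finset.prod_eq_one, mul_one]
    intro l _
    rw [norm_zpow, norm_hh hδ ω hω l ht0 ht1 hz, one_zpow]

lemma GG_zero (N : L → ℤ) {δ : ℝ} (_ : 0 < δ) (ω : L → ℂ) (_ : ∀ l, ‖ω l‖ = 1)
    (z : ℂ) : GG N δ ω 0 z = z * ∏ l, EE δ (ω l) z ^ N l := by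
  simp [GG, hh, ww, norm_EE]

lemma GG_one (N : L → ℤ) {δ : ℝ} (_ : 0 < δ) (ω : L → ℂ) (hω : ∀ l, ‖ω l‖ = 1)
    (hN : 1 + ∑ l, N l = 0) (z : ℂ) :
    GG N δ ω 1 z = ‖z‖ * ∏ l, (-(starRingEnd ℂ (ω l))) ^ N l := by
  by_cases hz : z = 0
  · simp [GG, hz]
  have hp : (‖z‖ : ℂ) ≠ 0 := by simpa using hz
  have h1 : ∀ l, hh δ (ω l) 1 z = -(starRingEnd ℂ (ω l)) * (z / ‖z‖) := by
    intro l
    have : ww δ (ω l) 1 z = -(starRingEnd ℂ (ω l)) * (z / ‖z‖) := by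
      simp [ww]; ring
    rw [hh, this]
    have hn : ‖-(starRingEnd ℂ (ω l)) * (z / ‖z‖)‖ = 1 := by
      rw [norm_mul, norm_neg, Complex.norm_conj, hω, norm_div, Complex.norm_real, norm_norm,
        div_self (norm_ne_zero_iff.2 hz), one_mul]
    rw [hn]; simp
  have h0 : z / (‖z‖ : ℂ) ≠ 0 := div_ne_zero hz hp
  have h2 : ∏ l, (z / (‖z‖ : ℂ)) ^ N l = (z / ‖z‖) ^ (∑ l, N l) := by
    classical
    induction (Finset.univ : Finset L) using Finset.induction with
    | empty => simp
    | insert a s ha ih => rw [Finset.prod_insert ha, Finset.sum_insert ha, zpow_add₀ h0, ih]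
  rw [GG]
  simp only [h1, mul_zpow]
  rw [Finset.prod_mul_distrib, h2]
  have : ∑ l, N l = -1 := by linarith
  rw [this, zpow_neg_one]
  field_simp

lemma GG_continuous (N : L → ℤ) {δ : ℝ} (hδ : 0 < δ) (hδ2 : δ ≤ 1 / 2) (ω : L → ℂ)
    (hω : ∀ l, ‖ω l‖ = 1) : Continuous fun p : I × ℂ => GG N δ ω p.1 p.2 := by
  rw [continuous_iff_continuousAt]
  rintro ⟨t, z⟩
  by_cases hz : z = 0
  · subst hz
    have h0 : GG N δ ω t 0 = 0 := by simp [GG]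
    rw [ContinuousAt, h0]
    refine squeeze_zero_norm (a := fun p : I × ℂ => ‖p.2‖) (fun p => ?_) ?_
    · rw [norm_GG N hδ ω hω p.1.2.1 p.1.2.2]
    · have : Continuous fun p : I × ℂ => ‖p.2‖ := by fun_prop
      simpa using this.tendsto (t, 0)
  · have hop : IsOpen {p : I × ℂ | p.2 ≠ 0} := isOpen_ne_fun continuous_snd continuous_const
    have hon : ContinuousOn (fun p : I × ℂ => GG N δ ω p.1 p.2) {p : I × ℂ | p.2 ≠ 0} := by
      rw [continuousOn_iff_continuous_domRestrict]
      unfold GG Set.domRestrict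
      have hc2 : Continuous fun p : {p : I × ℂ | p.2 ≠ 0} => p.1.2 := by fun_prop
      refine hc2.mul (continuous_finsetProd _ fun l _ => ?_)
      have hw : Continuous fun p : {p : I × ℂ | p.2 ≠ 0} => ww δ (ω l) p.1.1 p.1.2 := by
        unfold ww
        have h1 := EE_continuous hδ hδ2 (ω l) (hω l) (fun p : {p : I × ℂ | p.2 ≠ 0} => p.1.2) hc2
          (fun p => p.2)
        have h2 : ∀ p : {p : I × ℂ | p.2 ≠ 0}, ((‖p.1.2‖ : ℝ) : ℂ) ≠ 0 := fun p =>
          Complex.ofReal_ne_zero.2 (norm_ne_zero_iff.2 p.2)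
        fun_prop (disch := assumption)
      have hw0 : ∀ p : {p : I × ℂ | p.2 ≠ 0}, ((‖ww δ (ω l) p.1.1 p.1.2‖ : ℝ) : ℂ) ≠ 0 := fun p => by
        exact Complex.ofReal_ne_zero.2 (norm_ne_zero_iff.2
          (EE_ne hδ (ω l) (hω l) p.2 p.1.1 p.1.1.2.1 p.1.1.2.2))
      have hhc : Continuous fun p : {p : I × ℂ | p.2 ≠ 0} => hh δ (ω l) p.1.1 p.1.2 := by
        unfold hh
        fun_prop (disch := assumption)
      refine hhc.zpow₀ _ fun p => Or.inl ?_
      have := norm_hh hδ ω hω l p.1.1.2.1 p.1.1.2.2 p.2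
      intro h
      rw [h] at this; simp at this
    exact hon.continuousAt (hop.mem_nhds hz)
end

end TTC

open Set
open scoped Topology unitInterval RealInnerProductSpace

namespace TTC

section planar
variable {V : Type*} [NormedAddCommGroup V] [InnerProductSpace ℝ V]

/-- embedding of the plane -/
noncomputable def JJ (l q : V) (z : ℂ) : V := z.re • l + z.im • q

/-- plane coordinate -/
noncomputable def zc (l q : V) (x : V) : ℂ := ⟨⟪l, x⟫, ⟪q, x⟫⟩

lemma zc_eq (l q x : V) : zc l q x = (⟪l, x⟫ : ℂ) + ⟪q, x⟫ * Complex.I := by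
  apply Complex.ext <;> simp [zc]

lemma zc_cont (l q : V) : Continuous (zc l q) := by
  have : zc l q = fun x => (⟪l, x⟫ : ℂ) + ⟪q, x⟫ * Complex.I := funext (zc_eq l q)
  rw [this]
  fun_prop

lemma JJ_add (l q : V) (z w : ℂ) : JJ l q (z + w) = JJ l q z + JJ l q w := by
  simp [JJ, add_smul]; abel

lemma JJ_sum {L : Type*} (s : Finset L) (l q : V) (z : L → ℂ) :
    JJ l q (∑ i ∈ s, z i) = ∑ i ∈ s, JJ l q (z i) := by
  classical
  induction s using Finset.induction_on with
  | empty => simp [JJ]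
  | insert a s h ih => rw [Finset.sum_insert h, Finset.sum_insert h, JJ_add, ih]

lemma JJ_smul (l q : V) (t : ℝ) (z : ℂ) : JJ l q (t * z) = t • JJ l q z := by
  simp [JJ, smul_smul]

lemma zc_qq (l q x : V) : x = JJ l q (zc l q x) + qq l q x := by
  simp [JJ, zc, qq]

lemma JJ_qq_zero {l q : V} (h : OP l q) {x : V} {z : ℂ} (c : ℝ) (h0 : JJ l q z + c • qq l q x = 0) :
    z = 0 ∧ c • qq l q x = 0 := by
  have h1 := norm_comb (q := c • qq l q x) h (by simp [inner_smul_right, (inner_qq h x).1])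
    (by simp [inner_smul_right, (inner_qq h x).2]) z.re z.im
  have h2 : z.re • l + z.im • q + c • qq l q x = 0 := h0
  rw [h2] at h1
  simp only [norm_zero] at h1
  have a1 := sq_nonneg z.re
  have a2 := sq_nonneg z.im
  have a3 := sq_nonneg ‖c • qq l q x‖
  refine ⟨Complex.ext ?_ ?_, ?_⟩
  · have : z.re ^ 2 = 0 := by linarith
    simpa using this
  · have : z.im ^ 2 = 0 := by linarith
    simpa using this
  · have : ‖c • qq l q x‖ ^ 2 = 0 := by linarith
    simpa using this

lemma qq_cont (l q : V) : Continuous (qq l q) := by unfold qq; fun_prop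

lemma JJ_cont {l q : V} : Continuous (JJ l q) := by unfold JJ; fun_prop

/-- unit vectors in the plane form frames -/
lemma OP_JJ {l q : V} (h : OP l q) {w : ℂ} (hw : ‖w‖ = 1) : OP (JJ l q w) (JJ l q (Complex.I * w)) := by
  obtain ⟨h1, h2, h3⟩ := h
  have h4 : ⟪q, l⟫ = 0 := by rw [real_inner_comm]; exact h3
  have hn : w.re ^ 2 + w.im ^ 2 = 1 := by
    have := Complex.sq_norm w
    rw [hw, Complex.normSq_apply] at this
    nlinarith
  have e1 : ⟪l, l⟫ = 1 := by rw [real_inner_self_eq_norm_sq, h1]; norm_num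
  have e2 : ⟪q, q⟫ = 1 := by rw [real_inner_self_eq_norm_sq, h2]; norm_num
  have sq1 : ∀ v : V, ⟪v, v⟫ = 1 → ‖v‖ = 1 := by
    intro v hv
    rw [real_inner_self_eq_norm_sq] at hv
    have := norm_nonneg v
    nlinarith
  refine ⟨sq1 _ ?_, sq1 _ ?_, ?_⟩
  · simp only [JJ, inner_add_left, inner_add_right, inner_smul_left, inner_smul_right, h3, h4, e1, e2]
    simp
    nlinarith
  · simp only [JJ, inner_add_left, inner_add_right, inner_smul_left, inner_smul_right, h3, h4, e1, e2]
    simp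
    nlinarith
  · simp [JJ, inner_add_left, inner_add_right, inner_smul_left, inner_smul_right, h3, h4, h1, h2]
    nlinarith

lemma inner_JJ (l q : V) (w : ℂ) (x : V) : ⟪JJ l q w, x⟫ = (starRingEnd ℂ w * zc l q x).re := by
  simp [JJ, zc, inner_add_left, inner_smul_left]

lemma inner_JJI (l q : V) (w : ℂ) (x : V) :
    ⟪JJ l q (Complex.I * w), x⟫ = (starRingEnd ℂ w * zc l q x).im := by
  simp [JJ, zc, inner_add_left, inner_smul_left]; ring

lemma rr_JJ (N : ℤ) (δ : ℝ) (l q : V) {w : ℂ} (hw : ‖w‖ = 1) (x : V) :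
    rr N δ (JJ l q w) (JJ l q (Complex.I * w)) x =
    JJ l q ((Complex.exp ((th N δ (JJ l q (Complex.I * w)) x : ℝ) * Complex.I) - 1) * zc l q x) := by
  have hn : w.re ^ 2 + w.im ^ 2 = 1 := by
    have := Complex.sq_norm w
    rw [hw, Complex.normSq_apply] at this
    nlinarith
  set t := th N δ (JJ l q (Complex.I * w)) x
  rw [rr, inner_JJ, inner_JJI, ← JJ_smul, ← JJ_smul, ← JJ_add]
  congr 1
  change (((Real.cos t - 1) * _ - Real.sin t * _ : ℝ) : ℂ) * w + ((Real.sin t * _ + (Real.cos t - 1) * _ : ℝ) : ℂ) * (Complex.I * w) = _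
  rw [Complex.exp_mul_I, ← Complex.ofReal_cos, ← Complex.ofReal_sin]
  have key : starRingEnd ℂ w * w = 1 := by
    rw [mul_comm, Complex.mul_conj, Complex.normSq_apply, ← Complex.ofReal_one]
    congr 1; nlinarith
  set ζ := starRingEnd ℂ w * zc l q x with hζ
  have hz : zc l q x = ζ * w := by
    rw [hζ, mul_right_comm, key, one_mul]
  rw [hz]
  have hd : ζ = ζ.re + ζ.im * Complex.I := (Complex.re_add_im ζ).symm
  conv_rhs => rw [hd]
  push_cast
  linear_combination (-(ζ.im : ℂ) * Complex.sin t * w) * Complex.I_sq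

lemma qq_JJ {l q : V} {w : ℂ} (hw : ‖w‖ = 1) (x : V) :
    qq (JJ l q w) (JJ l q (Complex.I * w)) x = qq l q x := by
  have key : starRingEnd ℂ w * w = 1 := by
    rw [mul_comm, Complex.mul_conj, Complex.normSq_eq_norm_sq, hw]; simp
  rw [qq, inner_JJ, inner_JJI, sub_sub, ← JJ_smul, ← JJ_smul, ← JJ_add]
  have : ((((starRingEnd ℂ) w * zc l q x).re : ℂ) * w + (((starRingEnd ℂ) w * zc l q x).im : ℂ) * (Complex.I * w)) = zc l q x := by
    have h := Complex.re_add_im (starRingEnd ℂ w * zc l q x)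
    linear_combination w * h + zc l q x * key
  rw [this]
  conv_lhs => rw [zc_qq l q x]
  conv_lhs => rw [← zc_qq l q x]
  nth_rewrite 1 [zc_qq l q x]
  abel

lemma mm_JJ (N : ℤ) {δ : ℝ} {l q : V} (h : OP l q) {w : ℂ} (hw : ‖w‖ = 1) {x : V}
    (hx : qq l q x = 0) :
    mm N δ (JJ l q w) (JJ l q (Complex.I * w)) x =
      JJ l q ((EE δ w (zc l q x) ^ N - 1) * zc l q x) := by
  have hnx : ‖x‖ = ‖zc l q x‖ := by
    have h1 := norm_decomp h x
    rw [hx, norm_zero] at h1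
    have h2 := Complex.sq_norm (zc l q x)
    rw [Complex.normSq_apply] at h2
    simp only [zc] at h2 ⊢
    rw [← sq_eq_sq₀ (norm_nonneg _) (norm_nonneg _), h2, h1]; ring
  rw [mm, EE, inner_JJ]
  split_ifs with hh
  · simp [JJ]
  · rw [rr_JJ N δ l q hw, kap, qq_JJ hw, hx]
    simp only [norm_zero, zero_div, sub_zero, th, inner_JJI, hnx]
    rw [max_eq_right zero_le_one, one_smul, ← Complex.exp_int_mul]
    congr 4
    push_cast; ring

variable {L : Type*} [Fintype L]

lemma gg_JJ (N : L → ℤ) {δ : ℝ} (hδ : 0 < δ) (hδ2 : δ ≤ 1 / 2) {l q : V} (h : OP l q) (w : L → ℂ)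
    (hw : ∀ i, ‖w i‖ = 1)
    (hsep : ∀ i j, i ≠ j → 4 * δ ≤ ‖JJ l q (w i) - JJ l q (w j)‖) {x : V} (hx0 : x ≠ 0)
    (hx : qq l q x = 0) :
    gg N δ (fun i => JJ l q (w i)) (fun i => JJ l q (Complex.I * w i)) x =
      JJ l q (GG N δ w 0 (zc l q x)) := by
  classical
  rw [GG_zero N hδ w hw, gg]
  have hxz : x = JJ l q (zc l q x) := by
    conv_lhs => rw [zc_qq l q x, hx, add_zero]
  have hz0 : zc l q x ≠ 0 := by
    intro h0; rw [h0] at hxz; exact hx0 (by rw [hxz]; simp [JJ])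
  have hE : ∀ i, mm (N i) δ (JJ l q (w i)) (JJ l q (Complex.I * w i)) x = 0 →
      EE δ (w i) (zc l q x) ^ N i = 1 := by
    intro i hi
    rw [mm_JJ (N i) h (hw i) hx] at hi
    have := (JJ_qq_zero h (x := 0) 0 (by rw [hi]; simp)).1
    rw [mul_eq_zero, or_iff_left hz0, sub_eq_zero] at this
    exact this
  by_cases hm : ∃ i, mm (N i) δ (JJ l q (w i)) (JJ l q (Complex.I * w i)) x ≠ 0
  · obtain ⟨i, hi⟩ := hm
    have h0 : ∀ j, j ≠ i → mm (N j) δ (JJ l q (w j)) (JJ l q (Complex.I * w j)) x = 0 := fun j hj =>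
      mm_disjoint hδ hδ2 (OP_JJ h (hw i)) (OP_JJ h (hw j)) hx0 (hsep i j hj.symm) hi
    rw [Finset.sum_eq_single i (fun j _ hj => h0 j hj) (by simp),
      Finset.prod_eq_single i (fun j _ hj => hE j (h0 j hj)) (by simp), mm_JJ (N i) h (hw i) hx]
    conv_lhs => enter [1]; rw [hxz]
    rw [← JJ_add]
    congr 1; ring
  · push Not at hm
    rw [Finset.sum_eq_zero (fun i _ => hm i), Finset.prod_eq_one (fun i _ => hE i (hm i)),
      add_zero, mul_one, ← hxz]

lemma qq_gg (N : L → ℤ) {δ : ℝ} {l q : V} (h : OP l q) (w : L → ℂ)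
    (hw : ∀ i, ‖w i‖ = 1) (x : V) :
    qq l q (gg N δ (fun i => JJ l q (w i)) (fun i => JJ l q (Complex.I * w i)) x) = qq l q x := by
  have hJ : ∀ i, ∃ z, mm (N i) δ (JJ l q (w i)) (JJ l q (Complex.I * w i)) x = JJ l q z := by
    intro i
    rw [mm]
    split_ifs
    · exact ⟨0, by simp [JJ]⟩
    · exact ⟨_, by rw [rr_JJ _ _ _ _ (hw i), ← JJ_smul]⟩
  choose z hz using hJ
  rw [gg]
  simp only [hz]
  rw [← JJ_sum]
  generalize ∑ i, z i = y
  obtain ⟨h1, h2, h3⟩ := h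
  have h4 : ⟪q, l⟫ = 0 := by rw [real_inner_comm]; exact h3
  simp only [qq, JJ, inner_add_right, inner_smul_right, h3, h4, real_inner_self_eq_norm_sq, h1, h2]
  module

/-- generic homotopy with fixed orthogonal component -/
lemma hom_generic {l q : V} (h : OP l q) (Z : I × {x : V // x ≠ 0} → ℂ) (hZ : Continuous Z)
    (hZ0 : ∀ t x, qq l q x.1 = 0 → Z (t, x) ≠ 0) (f g : C({x : V // x ≠ 0}, {x : V // x ≠ 0}))
    (hf : ∀ x, (f x).1 = JJ l q (Z (0, x)) + qq l q x.1)
    (hg : ∀ x, (g x).1 = JJ l q (Z (1, x)) + qq l q x.1) : f.Homotopic g := by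
  refine ⟨⟨⟨fun p => ⟨JJ l q (Z p) + qq l q p.2.1, ?_⟩, ?_⟩, fun x => ?_, fun x => ?_⟩⟩
  · intro h0
    rw [← one_smul ℝ (qq l q p.2.1)] at h0
    obtain ⟨h1, h2⟩ := JJ_qq_zero h 1 h0
    exact hZ0 p.1 p.2 (by simpa using h2) h1
  · refine Continuous.subtype_mk ((JJ_cont.comp hZ).add ((qq_cont l q).comp ?_)) _
    fun_prop
  · exact Subtype.ext (hf x).symm
  · exact Subtype.ext (hg x).symm

lemma planar_null (N : L → ℤ) (hN : 1 + ∑ i, N i = 0) {δ : ℝ} (hδ : 0 < δ) (hδ2 : δ ≤ 1 / 2)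
    {l q : V} (h : OP l q) (w : L → ℂ) (hw : ∀ i, ‖w i‖ = 1)
    (hsep : ∀ i j, i ≠ j → 4 * δ ≤ ‖JJ l q (w i) - JJ l q (w j)‖) :
    (ggC N hδ hδ2 (fun i => JJ l q (w i)) (fun i => JJ l q (Complex.I * w i))
      (fun i => OP_JJ h (hw i)) hsep).Nullhomotopic := by
  have hz0 : ∀ x : {x : V // x ≠ 0}, qq l q x.1 = 0 → zc l q x.1 ≠ 0 := by
    intro x hx h0
    apply x.2
    rw [zc_qq l q x.1, h0, hx]; simp [JJ]
  set c : ℂ := ∏ i, (-(starRingEnd ℂ (w i))) ^ N i with hc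
  have hc1 : c ≠ 0 := by
    rw [hc, Finset.prod_ne_zero_iff]
    intro i _
    apply zpow_ne_zero
    rw [neg_ne_zero, map_ne_zero]
    rw [← norm_ne_zero_iff, hw i]; norm_num
  have hGGn : ∀ (t : I) (z : ℂ), z ≠ 0 → GG N δ w t z ≠ 0 := by
    intro t z hz
    rw [← norm_ne_zero_iff, norm_GG N hδ w hw t.2.1 t.2.2]
    exact norm_ne_zero_iff.2 hz
  have hGGc := GG_continuous N hδ hδ2 w hw
  -- the intermediate maps
  have hmk : ∀ t : I, ∃ f : C({x : V // x ≠ 0}, {x : V // x ≠ 0}),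
      ∀ x, (f x).1 = JJ l q (GG N δ w t (zc l q x.1)) + qq l q x.1 := by
    intro t
    refine ⟨⟨fun x => ⟨JJ l q (GG N δ w t (zc l q x.1)) + qq l q x.1, ?_⟩, ?_⟩, fun x => rfl⟩
    · intro h0
      rw [← one_smul ℝ (qq l q x.1)] at h0
      obtain ⟨h1, h2⟩ := JJ_qq_zero h 1 h0
      exact hGGn t _ (hz0 x (by simpa using h2)) h1
    · refine Continuous.subtype_mk ((JJ_cont.comp (hGGc.comp (f := fun x : {x : V // x ≠ 0} => (t, zc l q x.1)) ?_)).add ((qq_cont l q).comp continuous_subtype_val)) _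
      exact continuous_const.prodMk ((zc_cont l q).comp continuous_subtype_val)
  obtain ⟨f0, hf0⟩ := hmk 0
  obtain ⟨f1, hf1⟩ := hmk 1
  set g0 := ggC N hδ hδ2 (fun i => JJ l q (w i)) (fun i => JJ l q (Complex.I * w i))
      (fun i => OP_JJ h (hw i)) hsep with hg0
  have hg0v : ∀ x, (g0 x).1 = gg N δ (fun i => JJ l q (w i)) (fun i => JJ l q (Complex.I * w i)) x.1 :=
    fun x => rfl
  have hgq : ∀ x, (g0 x).1 = JJ l q (zc l q (g0 x).1) + qq l q x.1 := by
    intro x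
    conv_lhs => rw [zc_qq l q (g0 x).1]
    rw [hg0v, qq_gg N h w hw]
  have H1 : g0.Homotopic f0 := by
    refine hom_generic h (fun p => ((1 - (p.1 : ℝ) : ℝ) : ℂ) * zc l q (g0 p.2).1 +
      ((p.1 : ℝ) : ℂ) * GG N δ w 0 (zc l q p.2.1)) ?_ ?_ _ _ ?_ ?_
    · have a1 : Continuous fun p : I × {x : V // x ≠ 0} => zc l q (g0 p.2).1 :=
        (zc_cont l q).comp (continuous_subtype_val.comp (g0.continuous.comp continuous_snd))
      have a2 : Continuous fun p : I × {x : V // x ≠ 0} => GG N δ w 0 (zc l q p.2.1) :=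
        hGGc.comp (f := fun p : I × {x : V // x ≠ 0} => ((0:I), zc l q p.2.1))
          (continuous_const.prodMk ((zc_cont l q).comp (continuous_subtype_val.comp continuous_snd)))
      fun_prop
    · intro t x hx
      have e1 := gg_JJ N hδ hδ2 h w hw hsep x.2 hx
      have e2 : zc l q (g0 x).1 = GG N δ w 0 (zc l q x.1) := by
        have e3 := hgq x
        rw [hx, add_zero, hg0v, e1] at e3
        have : JJ l q (GG N δ w 0 (zc l q x.1) - zc l q (g0 x).1) = 0 := by
          rw [sub_eq_add_neg, JJ_add, e3, ← JJ_add, hg0v, e1, ← sub_eq_add_neg, sub_self]; simp [JJ]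
        have := (JJ_qq_zero h (x := 0) 0 (by rw [this]; simp)).1
        exact (sub_eq_zero.1 this).symm
      simp only
      rw [e2, ← add_mul, ← Complex.ofReal_add, sub_add_cancel, Complex.ofReal_one, one_mul]
      exact hGGn 0 _ (hz0 x hx)
    · intro x
      simpa using hgq x
    · intro x
      simpa using hf0 x
  have H2 : f0.Homotopic f1 := by
    refine hom_generic h (fun p => GG N δ w p.1 (zc l q p.2.1)) ?_ ?_ _ _ hf0 hf1
    · exact hGGc.comp (f := fun p : I × {x : V // x ≠ 0} => (p.1, zc l q p.2.1))
          (continuous_fst.prodMk ((zc_cont l q).comp (continuous_subtype_val.comp continuous_snd)))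
    · intro t x hx
      exact hGGn t _ (hz0 x hx)
  have hJc : JJ l q c ≠ 0 := by
    intro h0
    exact hc1 (JJ_qq_zero h (x := 0) 0 (by rw [h0]; simp)).1
  have H3 : f1.Homotopic (ContinuousMap.const _ ⟨JJ l q c, hJc⟩) := by
    refine ⟨⟨⟨fun p => ⟨JJ l q ((((1 - (p.1 : ℝ)) * ‖zc l q p.2.1‖ + p.1 : ℝ) : ℂ) * c) +
        (1 - (p.1 : ℝ)) • qq l q p.2.1, ?_⟩, ?_⟩, fun x => ?_, fun x => ?_⟩⟩
    · intro h0
      obtain ⟨h1, h2⟩ := JJ_qq_zero h _ h0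
      rw [mul_eq_zero, or_iff_left hc1, Complex.ofReal_eq_zero] at h1
      have b1 := p.1.2.1
      have b2 := p.1.2.2
      have b3 : 0 ≤ (1 - (p.1 : ℝ)) * ‖zc l q p.2.1‖ := mul_nonneg (by linarith) (norm_nonneg _)
      have b4 : (p.1 : ℝ) = 0 := by linarith
      rw [b4] at h1 h2
      simp at h1 h2
      exact hz0 p.2 h2 h1
    · refine Continuous.subtype_mk ((JJ_cont.comp ?_).add ?_) _
      · have a1 : Continuous fun p : I × {x : V // x ≠ 0} => zc l q p.2.1 :=
          (zc_cont l q).comp (continuous_subtype_val.comp continuous_snd)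
        fun_prop
      · have a1 : Continuous fun p : I × {x : V // x ≠ 0} => qq l q p.2.1 :=
          (qq_cont l q).comp (continuous_subtype_val.comp continuous_snd)
        fun_prop
    · apply Subtype.ext
      rw [hf1 x]
      have := GG_one N hδ w hw hN (zc l q x.1)
      simp [this, hc]
    · apply Subtype.ext
      simp
  exact ⟨_, (H1.trans H2).trans H3⟩
end planar
end TTC

open Set
open scoped Topology unitInterval RealInnerProductSpace

namespace TTC

lemma avoid {V : Type*} [AddCommGroup V] [Module ℝ V] {ι : Type*} [Finite ι]
    (p : ι → Submodule ℝ V) (h : ∀ i, p i ≠ ⊤) : ∃ x, ∀ i, x ∉ p i := by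
  classical
  have := Fintype.ofFinite ι
  by_contra hc
  push Not at hc
  refine Subspace.biUnion_ne_univ_of_top_notMem (k := ℝ) (s := Finset.univ.image p) ?_ ?_
  · simpa using h
  · ext x
    simpa using hc x

lemma fin_pos {ι : Type*} [Finite ι] (f : ι → ℝ) (hf : ∀ i, 0 < f i) : ∃ ε > 0, ∀ i, ε ≤ f i := by
  rcases isEmpty_or_nonempty ι with h | h
  · exact ⟨1, one_pos, fun i => h.elim i⟩
  · obtain ⟨i, hi⟩ := Finite.exists_min f
    exact ⟨f i, hf i, hi⟩

section
variable {V : Type*} [NormedAddCommGroup V] [InnerProductSpace ℝ V]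

lemma sphere_path [FiniteDimensional ℝ V] (hV : 3 ≤ Module.finrank ℝ V) {a : V} (ha : ‖a‖ = 1)
    {p q : V} (hp : OP a p) (hq : OP a q) :
    ∃ γ : I → V, Continuous γ ∧ γ 0 = p ∧ γ 1 = q ∧ ∀ t, OP a (γ t) := by
  set K : Submodule ℝ V := (Submodule.span ℝ {a})ᗮ with hK
  have hKm : ∀ x, x ∈ K ↔ ⟪a, x⟫ = 0 := fun x => Submodule.mem_orthogonal_singleton_iff_inner_right
  have ha0 : a ≠ 0 := by rw [← norm_ne_zero_iff, ha]; norm_num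
  have hdim : 1 < Module.finrank ℝ K := by
    have := Submodule.finrank_add_finrank_orthogonal (Submodule.span ℝ {a})
    rw [finrank_span_singleton ha0] at this
    rw [hK]; omega
  have hr : 1 < Module.rank ℝ K := by
    rw [← Module.finrank_eq_rank]; exact_mod_cast hdim
  have hc := isPathConnected_sphere hr (0 : K) (zero_le_one)
  have hj := hc.joinedIn ⟨p, (hKm p).2 hp.2.2⟩ (by simpa using hp.2.1) ⟨q, (hKm q).2 hq.2.2⟩
    (by simpa using hq.2.1)
  obtain ⟨γ, hγ⟩ := hj
  refine ⟨fun t => (γ t).1, by fun_prop, by simp, by simp, fun t => ⟨ha, ?_, (hKm _).1 (γ t).2⟩⟩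
  have := hγ t
  simpa using this

variable {L : Type*} [Fintype L]

lemma ggC_homotopic' (N : L → ℤ) {δ : ℝ} (hδ : 0 < δ) (hδ2 : δ ≤ 1 / 2) (a0 u0 a1 u1 : L → V)
    (hOP0 : ∀ l, OP (a0 l) (u0 l)) (hsep0 : ∀ l l', l ≠ l' → 4 * δ ≤ ‖a0 l - a0 l'‖)
    (hOP1 : ∀ l, OP (a1 l) (u1 l)) (hsep1 : ∀ l l', l ≠ l' → 4 * δ ≤ ‖a1 l - a1 l'‖)
    (a u : I → L → V)
    (ha : ∀ l, Continuous fun t => a t l) (hu : ∀ l, Continuous fun t => u t l)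
    (hOP : ∀ t l, OP (a t l) (u t l)) (hsep : ∀ t l l', l ≠ l' → 4 * δ ≤ ‖a t l - a t l'‖)
    (e1 : a 0 = a0) (e2 : u 0 = u0) (e3 : a 1 = a1) (e4 : u 1 = u1) :
    (ggC N hδ hδ2 a0 u0 hOP0 hsep0).Homotopic (ggC N hδ hδ2 a1 u1 hOP1 hsep1) := by
  subst e1 e2 e3 e4
  exact ggC_homotopic N hδ hδ2 a u ha hu hOP hsep

lemma inner_l_JJ {l q : V} (h : OP l q) (w : ℂ) : ⟪l, JJ l q w⟫ = w.re := by
  simp [JJ, inner_add_right, inner_smul_right, h.1, h.2.2]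

theorem null_general [FiniteDimensional ℝ V] (hV : 3 ≤ Module.finrank ℝ V) (N : L → ℤ)
    (hN : 1 + ∑ i, N i = 0) (a u : L → V) (hOP : ∀ l, OP (a l) (u l)) (hinj : Function.Injective a) :
    ∃ δ1 > 0, ∀ δ (hδ : 0 < δ), δ ≤ δ1 →
      ∃ (hδ2 : δ ≤ 1 / 2) (hsep : ∀ l l', l ≠ l' → 4 * δ ≤ ‖a l - a l'‖),
        (ggC N hδ hδ2 a u hOP hsep).Nullhomotopic := by
  classical
  -- choice of ℓ
  obtain ⟨x, hx⟩ := avoid (ι := {p : L × L // p.1 ≠ p.2} ⊕ L ⊕ Unit)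
    (Sum.elim (fun p => (Submodule.span ℝ {a p.1.1 - a p.1.2})ᗮ)
      (Sum.elim (fun i => Submodule.span ℝ {a i}) (fun _ => (⊥ : Submodule ℝ V)))) (by
    rintro (⟨⟨i, j⟩, hij⟩ | i | _)
    · simp only [Sum.elim_inl]
      intro h
      have : a i - a j ∈ (Submodule.span ℝ {a i - a j})ᗮ := by rw [h]; trivial
      rw [Submodule.mem_orthogonal_singleton_iff_inner_right, inner_self_eq_zero, sub_eq_zero] at this
      exact hij (hinj this)
    · simp only [Sum.elim_inr, Sum.elim_inl]
      intro h
      have h1 := finrank_span_le_card (R := ℝ) ({a i} : Set V)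
      rw [h, finrank_top] at h1
      simp at h1
      omega
    · simp only [Sum.elim_inr]
      intro h
      have h1 : Module.finrank ℝ (⊥ : Submodule ℝ V) = 0 := finrank_bot ℝ V
      rw [h, finrank_top] at h1
      omega)
  have hx1 : ∀ i j, i ≠ j → ⟪a i - a j, x⟫ ≠ 0 := by
    intro i j hij
    have := hx (Sum.inl ⟨(i, j), hij⟩)
    simpa [Submodule.mem_orthogonal_singleton_iff_inner_right] using this
  have hx2 : ∀ i, x ∉ Submodule.span ℝ {a i} := fun i => hx (Sum.inr (Sum.inl i))
  have hx3 : x ≠ 0 := by simpa using hx (Sum.inr (Sum.inr ()))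
  have hxn := norm_pos_iff.2 hx3
  obtain ⟨l, hlx, hl1⟩ : ∃ l : V, x = ‖x‖ • l ∧ ‖l‖ = 1 := by
    refine ⟨‖x‖⁻¹ • x, by rw [smul_smul, mul_inv_cancel₀ hxn.ne', one_smul], ?_⟩
    rw [norm_smul, norm_inv, norm_norm, inv_mul_cancel₀ hxn.ne']
  set lam : L → ℝ := fun i => ⟪l, a i⟫ with hlam
  have hd : ∀ i j, i ≠ j → 0 < |lam i - lam j| := by
    intro i j hij
    rw [abs_pos]
    intro h
    apply hx1 i j hij
    rw [hlx, inner_smul_right, real_inner_comm, inner_sub_right]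
    rw [h, mul_zero]
  have hsq : ∀ i, ‖a i - lam i • l‖ ^ 2 = 1 - lam i ^ 2 := by
    intro i
    rw [norm_sub_sq_real, norm_smul, hl1, (hOP i).1, inner_smul_right, real_inner_comm]
    simp only [Real.norm_eq_abs, mul_one, sq_abs, hlam]; ring
  have hlt : ∀ i, 0 < 1 - lam i ^ 2 := by
    intro i
    rw [← hsq]
    refine pow_pos (norm_pos_iff.2 ?_) 2
    intro h
    rw [sub_eq_zero] at h
    apply hx2 i
    have h0 : lam i ≠ 0 := by
      intro h0; rw [h0, zero_smul] at h
      have := (hOP i).1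
      rw [h] at this; simp at this
    rw [Submodule.mem_span_singleton]
    refine ⟨‖x‖ * (lam i)⁻¹, ?_⟩
    rw [h, smul_smul, mul_assoc, inv_mul_cancel₀ h0, mul_one, ← hlx]
  set mu : L → ℝ := fun i => Real.sqrt (1 - lam i ^ 2) with hmu
  have hmu0 : ∀ i, 0 < mu i := fun i => Real.sqrt_pos.2 (hlt i)
  have hmu2 : ∀ i, mu i ^ 2 = 1 - lam i ^ 2 := fun i => Real.sq_sqrt (hlt i).le
  set q : L → V := fun i => (mu i)⁻¹ • (a i - lam i • l) with hq
  have hOq : ∀ i, OP l (q i) := by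
    intro i
    refine ⟨hl1, ?_, ?_⟩
    · have : ‖a i - lam i • l‖ = mu i := by
        rw [← sq_eq_sq₀ (norm_nonneg _) (hmu0 i).le, hsq, hmu2]
      rw [hq]; simp only
      rw [norm_smul, this, norm_inv, Real.norm_of_nonneg (hmu0 i).le, inv_mul_cancel₀ (hmu0 i).ne']
    · simp [hq, inner_smul_right, inner_sub_right, hl1, hlam]
  set w : L → ℂ := fun i => ⟨lam i, mu i⟩ with hw
  have hwn : ∀ i, ‖w i‖ = 1 := by
    intro i
    have := Complex.sq_norm (w i)
    rw [Complex.normSq_apply] at this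
    have h2 := hmu2 i
    have h3 : ‖w i‖ ^ 2 = 1 := by rw [this]; simp only [hw]; nlinarith
    have := norm_nonneg (w i)
    nlinarith
  have haJ : ∀ i, a i = JJ l (q i) (w i) := by
    intro i
    simp [JJ, hw, hq, smul_smul, mul_inv_cancel₀ (hmu0 i).ne']
  -- common q0
  rcases isEmpty_or_nonempty L with hL | ⟨⟨i0⟩⟩
  · simp at hN
  set q0 := q i0 with hq0
  have hsepl : ∀ (δ : ℝ), (∀ i j, i ≠ j → 4 * δ ≤ |lam i - lam j|) → ∀ Q : L → V, (∀ i, OP l (Q i)) →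
      ∀ i j, i ≠ j → 4 * δ ≤ ‖JJ l (Q i) (w i) - JJ l (Q j) (w j)‖ := by
    intro δ h Q hQ i j hij
    refine (h i j hij).trans ?_
    have h1 := abs_real_inner_le_norm l (JJ l (Q i) (w i) - JJ l (Q j) (w j))
    rw [inner_sub_right, inner_l_JJ (hQ i), inner_l_JJ (hQ j), hl1, one_mul] at h1
    exact h1
  obtain ⟨ε, hε, hε2⟩ := fin_pos (fun p : {p : L × L // p.1 ≠ p.2} => |lam p.1.1 - lam p.1.2|)
    (fun p => hd _ _ p.2)
  refine ⟨min (1 / 2) (ε / 4), lt_min (by norm_num) (by linarith), fun δ hδ hδ1 => ?_⟩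
  have hδ2 : δ ≤ 1 / 2 := hδ1.trans (min_le_left _ _)
  have hδl : ∀ i j, i ≠ j → 4 * δ ≤ |lam i - lam j| := by
    intro i j hij
    have h1 := hε2 ⟨(i, j), hij⟩
    have h2 := hδ1.trans (min_le_right _ _)
    simp only at h1
    linarith
  have haJ' : a = fun i => JJ l (q i) (w i) := funext haJ
  have hsep : ∀ l l', l ≠ l' → 4 * δ ≤ ‖a l - a l'‖ := by
    intro i j hij
    rw [haJ i, haJ j]
    exact hsepl δ hδl q hOq i j hij
  refine ⟨hδ2, hsep, ?_⟩
  have hO1 : ∀ i, OP (a i) (JJ l (q i) (Complex.I * w i)) := by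
    intro i; rw [haJ i]; exact OP_JJ (hOq i) (hwn i)
  choose γ hγ1 hγ2 hγ3 hγ4 using fun i => sphere_path hV (hOP i).1 (hOP i) (hO1 i)
  choose η hη1 hη2 hη3 hη4 using fun i => sphere_path hV hl1 (hOq i) (hOq i0)
  have H1 : (ggC N hδ hδ2 a u hOP hsep).Homotopic
      (ggC N hδ hδ2 a (fun i => JJ l (q i) (Complex.I * w i)) hO1 hsep) := by
    refine ggC_homotopic' N hδ hδ2 _ _ _ _ _ _ _ _ (fun _ => a) (fun t i => γ i t)
      (fun _ => continuous_const) hγ1 (fun t i => hγ4 i t) (fun _ => hsep) rfl (funext hγ2) rfl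
      (funext hγ3)
  have H2 : (ggC N hδ hδ2 a (fun i => JJ l (q i) (Complex.I * w i)) hO1 hsep).Homotopic
      (ggC N hδ hδ2 (fun i => JJ l q0 (w i)) (fun i => JJ l q0 (Complex.I * w i))
        (fun i => OP_JJ (hOq i0) (hwn i)) (hsepl δ hδl _ (fun _ => hOq i0))) := by
    refine ggC_homotopic' N hδ hδ2 _ _ _ _ _ _ _ _ (fun t i => JJ l (η i t) (w i))
      (fun t i => JJ l (η i t) (Complex.I * w i)) ?_ ?_ (fun t i => OP_JJ (hη4 i t) (hwn i))
      (fun t => hsepl δ hδl _ (fun i => hη4 i t)) ?_ ?_ ?_ ?_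
    · intro i; have := hη1 i; unfold JJ; fun_prop
    · intro i; have := hη1 i; unfold JJ; fun_prop
    · funext i; rw [hη2, haJ i]
    · funext i; rw [hη2]
    · funext i; rw [hη3]
    · funext i; rw [hη3]
  obtain ⟨y, hy⟩ := planar_null N hN hδ hδ2 (hOq i0) w hwn (hsepl δ hδl _ (fun _ => hOq i0))
  exact ⟨y, (H1.trans H2).trans hy⟩
end
end TTC

open Set
open scoped Topology unitInterval RealInnerProductSpace

namespace TTC

section equiv
variable {V : Type*} [NormedAddCommGroup V] [InnerProductSpace ℝ V]

lemma mm_equiv (N : ℤ) (δ : ℝ) (R : V →ₗ[ℝ] V) (hR : ∀ x y, ⟪R x, R y⟫ = ⟪x, y⟫) (a u x : V) :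
    mm N δ (R a) (R u) (R x) = R (mm N δ a u x) := by
  have hn : ∀ x, ‖R x‖ = ‖x‖ := by
    intro x
    rw [← sq_eq_sq₀ (norm_nonneg _) (norm_nonneg _), ← real_inner_self_eq_norm_sq,
      ← real_inner_self_eq_norm_sq, hR]
  have hq : qq (R a) (R u) (R x) = R (qq a u x) := by simp [qq, hR]
  simp only [mm, kap, rr, th, hq, hR, hn]
  split_ifs <;> simp

lemma gg_equiv {L : Type*} [Fintype L] (N : L → ℤ) (δ : ℝ) (a u : L → V)
    (R : V →ₗ[ℝ] V) (hR : ∀ x y, ⟪R x, R y⟫ = ⟪x, y⟫)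
    (e : L → L) (he : Function.Bijective e) (hN : ∀ l, N (e l) = N l) (ha : ∀ l, a (e l) = R (a l))
    (hu : ∀ l, u (e l) = R (u l)) (x : V) : gg N δ a u (R x) = R (gg N δ a u x) := by
  rw [gg, gg, map_add, map_sum, ← he.sum_comp]
  congr 1
  refine Finset.sum_congr rfl fun l _ => ?_
  rw [hN, ha, hu, mm_equiv (N l) δ R hR]
end equiv

section abs
variable {P : Type*} [NormedAddCommGroup P] [InnerProductSpace ℝ P]
variable {V : Type*} [NormedAddCommGroup V] [InnerProductSpace ℝ V] [FiniteDimensional ℝ V]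
variable {L : Type*} [Fintype L]

theorem exists_g_abs {r : ℕ} (hV : 3 ≤ Module.finrank ℝ V) (pr : (Fin r → P) →L[ℝ] V)
    (inc : V →L[ℝ] (Fin r → P)) (hpi : ∀ x, pr (inc x) = x)
    (hpr : ∀ v, pr v ≠ 0 ↔ ND v) (R : Equiv.Perm (Fin r) → V →ₗ[ℝ] V)
    (hR : ∀ s x y, ⟪R s x, R s y⟫ = ⟪x, y⟫) (hpR : ∀ (s : Equiv.Perm (Fin r)) v, pr (v ∘ s) = R s (pr v))
    (hiR : ∀ (s : Equiv.Perm (Fin r)) x, inc (R s x) = inc x ∘ s) (N : L → ℤ) (hN : 1 + ∑ l, N l = 0)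
    (a u : L → V) (hOP : ∀ l, OP (a l) (u l)) (hinj : Function.Injective a)
    (e : Equiv.Perm (Fin r) → L → L) (heN : ∀ s l, N (e s l) = N l)
    (hea : ∀ s l, a (e s l) = R s (a l)) (heu : ∀ s l, u (e s l) = R s (u l))
    (K : Set (Fin r → P)) (hK : IsCompact K) (hKND : ∀ v ∈ K, ND v)
    (hKa : ∀ v ∈ K, ∀ l, ∀ c : ℝ, pr v ≠ c • a l) :
    ∃ g : C(YY r P, YY r P), g.Nullhomotopic ∧
      (∀ (s : Equiv.Perm (Fin r)) (v w : YY r P), w.1 = v.1 ∘ s → (g w).1 = (g v).1 ∘ s) ∧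
      ∀ v : YY r P, v.1 ∈ K → g v = v := by
  obtain ⟨δ1, hδ1, hnull⟩ := null_general hV N hN a u hOP hinj
  have hRi : ∀ s, Function.Injective (R s) := by
    intro s
    rw [← LinearMap.ker_eq_bot, LinearMap.ker_eq_bot']
    intro x hx
    have := hR s x x
    rw [hx] at this
    simpa using this.symm
  have heb : ∀ s, Function.Bijective (e s) := by
    intro s
    refine Finite.injective_iff_bijective.1 fun l l' h => ?_
    apply hinj
    apply hRi s
    rw [← hea, ← hea, h]
  -- margin
  obtain ⟨η, hη, hηK⟩ : ∃ η > 0, ∀ v ∈ K, ∀ l, η * ‖pr v‖ ≤ ‖pr v - ‖pr v‖ • a l‖ := by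
    have h1 : ∀ l, ∃ η > 0, ∀ v ∈ K, η * ‖pr v‖ ≤ ‖pr v - ‖pr v‖ • a l‖ := by
      intro l
      have hp : ∀ v ∈ K, 0 < ‖pr v‖ := fun v hv => norm_pos_iff.2 ((hpr v).2 (hKND v hv))
      rcases K.eq_empty_or_nonempty with h0 | h0
      · exact ⟨1, one_pos, by simp [h0]⟩
      · obtain ⟨v0, hv0, hmin⟩ := hK.exists_isMinOn h0
          (f := fun v => ‖pr v - ‖pr v‖ • a l‖ / ‖pr v‖) (by
            refine ContinuousOn.div (by fun_prop) (by fun_prop) fun v hv => (hp v hv).ne')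
        refine ⟨‖pr v0 - ‖pr v0‖ • a l‖ / ‖pr v0‖, div_pos (norm_pos_iff.2 ?_) (hp v0 hv0),
          fun v hv => ?_⟩
        · exact sub_ne_zero.2 (hKa v0 hv0 l _)
        · rw [← le_div_iff₀ (hp v hv)]
          exact hmin hv
    choose η hη1 hη2 using h1
    obtain ⟨ε, hε, h⟩ := fin_pos η hη1
    exact ⟨ε, hε, fun v hv l => (mul_le_mul_of_nonneg_right (h l) (norm_nonneg _)).trans (hη2 l v hv)⟩
  set δ := min δ1 (η / 2) with hδdef
  have hδ : 0 < δ := lt_min hδ1 (by linarith)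
  obtain ⟨hδ2, hsep, y, ⟨H⟩⟩ := hnull δ hδ (min_le_left _ _)
  -- the map
  let g0 : (Fin r → P) → (Fin r → P) := fun v => (v - inc (pr v)) + inc (gg N δ a u (pr v))
  have hprg : ∀ v, pr (g0 v) = gg N δ a u (pr v) := by
    intro v; simp [g0, hpi]
  have hg0ND : ∀ v : YY r P, ND (g0 v.1) := by
    intro v
    rw [← hpr, hprg]
    exact gg_ne_zero N hδ hδ2 a u hOP hsep ((hpr _).2 v.2)
  let prY : C(YY r P, {x : V // x ≠ 0}) :=
    ⟨fun v => ⟨pr v.1, (hpr _).2 v.2⟩, by fun_prop⟩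
  have hggc : Continuous fun v : YY r P => gg N δ a u (pr v.1) :=
    continuous_subtype_val.comp ((ggC N hδ hδ2 a u hOP hsep).comp prY).continuous
  let g : C(YY r P, YY r P) := ⟨fun v => ⟨g0 v.1, hg0ND v⟩, by
    refine Continuous.subtype_mk ?_ _
    have := inc.continuous.comp hggc
    have h2 : Continuous fun v : YY r P => v.1 - inc (pr v.1) := by fun_prop
    exact h2.add this⟩
  refine ⟨g, ?_, ?_, ?_⟩
  · refine ⟨⟨inc y.1, by rw [← hpr, hpi]; exact y.2⟩, ⟨⟨⟨fun p => ⟨(1 - (p.1 : ℝ)) • (p.2.1 - inc (pr p.2.1)) +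
      inc (H (p.1, prY p.2)).1, ?_⟩, ?_⟩, ?_, ?_⟩⟩⟩
    · rw [← hpr]
      have : pr ((1 - (p.1 : ℝ)) • (p.2.1 - inc (pr p.2.1)) + inc (H (p.1, prY p.2)).1) =
        (H (p.1, prY p.2)).1 := by
        rw [map_add, map_smul, map_sub, hpi, hpi, sub_self, smul_zero, zero_add]
      rw [this]
      exact (H (p.1, prY p.2)).2
    · refine Continuous.subtype_mk (Continuous.add (by fun_prop) (inc.continuous.comp
        (continuous_subtype_val.comp (H.continuous.comp ?_)))) _
      exact continuous_fst.prodMk (prY.continuous.comp continuous_snd)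
    · intro v
      apply Subtype.ext
      have : (H (0, prY v)).1 = gg N δ a u (pr v.1) := by rw [H.apply_zero]; rfl
      change (1 - ((0 : I) : ℝ)) • (v.1 - inc (pr v.1)) + inc (H (0, prY v)).1 = g0 v.1
      rw [this]
      simp [g0]
    · intro v
      apply Subtype.ext
      have : (H (1, prY v)) = y := by rw [H.apply_one]; rfl
      change (1 - ((1 : I) : ℝ)) • (v.1 - inc (pr v.1)) + inc (H (1, prY v)).1 = inc y.1
      rw [this]
      simp
  · intro s v w hw
    change g0 w.1 = g0 v.1 ∘ s
    simp only [g0]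
    rw [hw, hpR, hiR, gg_equiv N δ a u (R s) (hR s) (e s) (heb s) (heN s) (hea s) (heu s), hiR]
    rfl
  · intro v hv
    apply Subtype.ext
    change g0 v.1 = v.1
    have : gg N δ a u (pr v.1) = pr v.1 := by
      rw [gg, Finset.sum_eq_zero, add_zero]
      intro l _
      by_contra hm
      have h1 := mm_support hδ hδ2 (hOP l) ((hpr _).2 v.2) hm
      have h2 := hηK v.1 hv l
      have h3 : 2 * δ ≤ η := by
        have := min_le_right δ1 (η / 2)
        rw [← hδdef] at this; linarith
      have h4 := mul_le_mul_of_nonneg_right h3 (norm_nonneg (pr v.1))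
      linarith
    simp [g0, this]
end abs
end TTC

open Set
open scoped Topology unitInterval RealInnerProductSpace

namespace TTC

/-- the target block -/
abbrev PP := EuclideanSpace ℝ (Fin 3)

/-- mean zero vectors -/
def V0 (r : ℕ) : Submodule ℝ (PiLp 2 (fun _ : Fin r => PP)) where
  carrier := {x | ∑ i, x i = 0}
  add_mem' := by
    intro a b ha hb
    simp only [Set.mem_ofPred_eq] at *
    simp [Finset.sum_add_distrib, ha, hb]
  zero_mem' := by simp
  smul_mem' := by
    intro c x hx
    simp only [Set.mem_ofPred_eq] at *
    simp [← Finset.smul_sum, hx]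

lemma mem_V0 {r : ℕ} (x : PiLp 2 (fun _ : Fin r => PP)) : x ∈ V0 r ↔ ∑ i, x i = 0 := Iff.rfl

lemma V0_sum {r : ℕ} (x : V0 r) : ∑ i, x.1 i = 0 := x.2

/-- make an element of `V0` -/
def mkV {r : ℕ} (v : Fin r → PP) (h : ∑ i, v i = 0) : V0 r := ⟨WithLp.toLp 2 v, h⟩

@[simp] lemma mkV_apply {r : ℕ} (v : Fin r → PP) (h : ∑ i, v i = 0) (i : Fin r) :
    (mkV v h).1 i = v i := rfl

lemma V0_ext {r : ℕ} {x y : V0 r} (h : ∀ i, x.1 i = y.1 i) : x = y := by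
  apply Subtype.ext
  ext1 i
  exact h i

lemma V0_inner {r : ℕ} (x y : V0 r) : ⟪x, y⟫ = ∑ i, ⟪x.1 i, y.1 i⟫ := by
  rw [Submodule.coe_inner, PiLp.inner_apply]

/-- inclusion -/
noncomputable def incV (r : ℕ) : V0 r →L[ℝ] (Fin r → PP) :=
  ⟨{ toFun := fun x i => x.1 i
     map_add' := by intros; rfl
     map_smul' := by intros; rfl }, by
    refine continuous_pi fun i => ?_
    change Continuous fun x : V0 r => x.1 i
    fun_prop⟩

@[simp] lemma incV_apply {r : ℕ} (x : V0 r) (i : Fin r) : incV r x i = x.1 i := rfl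

lemma sum_sub_mean {r : ℕ} (v : Fin r → PP) :
    ∑ i, (v i - (r : ℝ)⁻¹ • ∑ j, v j) = 0 := by
  rcases Nat.eq_zero_or_pos r with h | h
  · subst h; simp
  · rw [Finset.sum_sub_distrib, Finset.sum_const, Finset.card_univ, Fintype.card_fin,
      ← Nat.cast_smul_eq_nsmul ℝ, smul_smul, mul_inv_cancel₀ (by positivity), one_smul, sub_self]

/-- projection, linear version -/
noncomputable def prL (r : ℕ) : (Fin r → PP) →ₗ[ℝ] V0 r where
  toFun := fun v => mkV (fun i => v i - (r : ℝ)⁻¹ • ∑ j, v j) (sum_sub_mean v)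
  map_add' := by
    intro v w
    refine V0_ext fun i => ?_
    change (v i + w i) - (r : ℝ)⁻¹ • ∑ j, (v j + w j) =
      (v i - (r : ℝ)⁻¹ • ∑ j, v j) + (w i - (r : ℝ)⁻¹ • ∑ j, w j)
    rw [Finset.sum_add_distrib, smul_add]
    abel
  map_smul' := by
    intro c v
    refine V0_ext fun i => ?_
    change c • v i - (r : ℝ)⁻¹ • ∑ j, c • v j = c • (v i - (r : ℝ)⁻¹ • ∑ j, v j)
    rw [← Finset.smul_sum, smul_sub, smul_comm c]

/-- projection -/
noncomputable def prV (r : ℕ) : (Fin r → PP) →L[ℝ] V0 r :=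
  ⟨prL r, by
    change Continuous fun v : Fin r → PP => mkV (fun i => v i - (r : ℝ)⁻¹ • ∑ j, v j) (sum_sub_mean v)
    unfold mkV
    refine Continuous.subtype_mk ((PiLp.continuous_toLp 2 _).comp ?_) _
    fun_prop⟩

@[simp] lemma prV_apply {r : ℕ} (v : Fin r → PP) (i : Fin r) :
    (prV r v).1 i = v i - (r : ℝ)⁻¹ • ∑ j, v j := rfl

lemma pr_inc {r : ℕ} (x : V0 r) : prV r (incV r x) = x := by
  refine V0_ext fun i => ?_
  simp [V0_sum]

lemma pr_ne {r : ℕ} (v : Fin r → PP) : prV r v ≠ 0 ↔ ND v := by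
  unfold ND
  rw [not_iff_not]
  constructor
  · intro h i j
    have h1 : ∀ i, v i - (r : ℝ)⁻¹ • ∑ j, v j = 0 := by
      intro i; rw [← prV_apply, h]; rfl
    rw [sub_eq_zero.1 (h1 i), sub_eq_zero.1 (h1 j)]
  · intro h
    refine V0_ext fun i => ?_
    have hr : (r : ℝ) ≠ 0 := by
      have := i.pos
      positivity
    rw [prV_apply, Finset.sum_congr rfl (fun j _ => h j i), Finset.sum_const, Finset.card_univ,
      Fintype.card_fin, ← Nat.cast_smul_eq_nsmul ℝ, smul_smul, inv_mul_cancel₀ hr, one_smul, sub_self]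
    rfl

/-- permutation action -/
noncomputable def RV {r : ℕ} (s : Equiv.Perm (Fin r)) : V0 r →ₗ[ℝ] V0 r where
  toFun x := mkV (fun i => x.1 (s i)) (by rw [Equiv.sum_comp s (fun i => x.1 i)]; exact V0_sum x)
  map_add' := by
    intro x y; refine V0_ext fun i => ?_; simp
  map_smul' := by
    intro x y; refine V0_ext fun i => ?_; simp

@[simp] lemma RV_apply {r : ℕ} (s : Equiv.Perm (Fin r)) (x : V0 r) (i : Fin r) :
    (RV s x).1 i = x.1 (s i) := rfl

/-- indicator minus mean -/
noncomputable def bA {r : ℕ} (A : Finset (Fin r)) (i : Fin r) : ℝ :=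
  (if i ∈ A then 1 else 0) - (A.card : ℝ) / r

lemma sum_bA {r : ℕ} (hr : 2 ≤ r) (A : Finset (Fin r)) : ∑ i, bA A i = 0 := by
  have : (r : ℝ) ≠ 0 := by positivity
  simp [bA, Finset.sum_sub_distrib]
  field_simp
  simp

/-- frame vector -/
noncomputable def fV {r : ℕ} (hr : 2 ≤ r) (A : Finset (Fin r)) : PP →ₗ[ℝ] V0 r where
  toFun f := mkV (fun i => bA A i • f) (by rw [← Finset.sum_smul, sum_bA hr, zero_smul])
  map_add' := by intro x y; refine V0_ext fun i => ?_; simp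
  map_smul' := by intro x y; refine V0_ext fun i => ?_; simp [smul_smul, mul_comm]

@[simp] lemma fV_apply {r : ℕ} (hr : 2 ≤ r) (A : Finset (Fin r)) (f : PP) (i : Fin r) :
    (fV hr A f).1 i = bA A i • f := rfl

lemma bA_pos_iff {r : ℕ} {A : Finset (Fin r)} (hA : A ∈ propSub r) (i : Fin r) :
    (i ∈ A → 0 < bA A i) ∧ (i ∉ A → bA A i < 0) := by
  simp only [propSub, Finset.mem_filter] at hA
  have h1 : (0 : ℝ) < A.card := by exact_mod_cast hA.2.1
  have h2 : (A.card : ℝ) < r := by exact_mod_cast hA.2.2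
  have h3 : (0 : ℝ) < r := h1.trans h2
  have h4 : (A.card : ℝ) / r < 1 := by rw [div_lt_one h3]; exact h2
  have h5 : 0 < (A.card : ℝ) / r := div_pos h1 h3
  constructor <;> intro h <;> simp [bA, h]
  · exact h4
  · omega

lemma sA_pos {r : ℕ} {A : Finset (Fin r)} (hA : A ∈ propSub r) : 0 < ∑ i, bA A i ^ 2 := by
  have h := hA
  simp only [propSub, Finset.mem_filter] at hA
  obtain ⟨i, hi⟩ := Finset.card_pos.1 hA.2.1
  refine Finset.sum_pos' (fun i _ => sq_nonneg _) ⟨i, Finset.mem_univ _, ?_⟩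
  have := (bA_pos_iff h i).1 hi
  positivity

lemma fV_inner {r : ℕ} (hr : 2 ≤ r) (A : Finset (Fin r)) (f g : PP) :
    ⟪fV hr A f, fV hr A g⟫ = (∑ i, bA A i ^ 2) * ⟪f, g⟫ := by
  rw [V0_inner, Finset.sum_mul]
  refine Finset.sum_congr rfl fun i _ => ?_
  rw [fV_apply, fV_apply, inner_smul_left, inner_smul_right]
  simp; ring

lemma fV_RV {r : ℕ} (hr : 2 ≤ r) (A : Finset (Fin r)) (s : Equiv.Perm (Fin r)) (f : PP) :
    fV hr (A.map s.symm.toEmbedding) f = RV s (fV hr A f) := by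
  refine V0_ext fun i => ?_
  simp only [fV_apply, RV_apply]
  congr 1
  simp [bA]

theorem exists_g {r : ℕ} (hr : 2 ≤ r) (hnp : ¬ IsPrimePow r) :
    ∃ (L : Type) (_ : Fintype L) (bad : L → Fin r → PP), ∀ K : Set (Fin r → PP), IsCompact K →
      (∀ v ∈ K, ND v) → (∀ v ∈ K, ∀ l, ∀ (c : ℝ) (p : PP), v ≠ fun i => c • bad l i + p) →
      ∃ g : C(YY r PP, YY r PP), g.Nullhomotopic ∧
      (∀ (s : Equiv.Perm (Fin r)) (v w : YY r PP), w.1 = v.1 ∘ s → (g w).1 = (g v).1 ∘ s) ∧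
      ∀ v : YY r PP, v.1 ∈ K → g v = v := by
  classical
  obtain ⟨n, hn⟩ := exists_winding r hr hnp
  set f1 : PP := EuclideanSpace.single 0 1 with hf1
  set f2 : PP := EuclideanSpace.single 1 1 with hf2
  have e11 : ⟪f1, f1⟫ = 1 := by simp [hf1]
  have e22 : ⟪f2, f2⟫ = 1 := by simp [hf2]
  have e12 : ⟪f1, f2⟫ = 0 := by simp [hf1, hf2, EuclideanSpace.inner_single_left]
  let L := {A : Finset (Fin r) // A ∈ propSub r}
  let sc : L → ℝ := fun A => Real.sqrt (∑ i, bA A.1 i ^ 2)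
  have hsc : ∀ A, 0 < sc A := fun A => Real.sqrt_pos.2 (sA_pos A.2)
  have hsc2 : ∀ A, sc A * sc A = ∑ i, bA A.1 i ^ 2 := fun A => Real.mul_self_sqrt (sA_pos A.2).le
  let a : L → V0 r := fun A => (sc A)⁻¹ • fV hr A.1 f1
  let u : L → V0 r := fun A => (sc A)⁻¹ • fV hr A.1 f2
  have hin : ∀ (A : L) (f g : PP), ⟪(sc A)⁻¹ • fV hr A.1 f, (sc A)⁻¹ • fV hr A.1 g⟫ = ⟪f, g⟫ := by
    intro A f g
    rw [← map_smul, ← map_smul, fV_inner, ← hsc2, real_inner_smul_left, real_inner_smul_right]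
    have := (hsc A).ne'
    field_simp
  have hnorm1 : ∀ v : V0 r, ⟪v, v⟫ = 1 → ‖v‖ = 1 := by
    intro v hv
    rw [real_inner_self_eq_norm_sq] at hv
    have := norm_nonneg v
    nlinarith
  have hOP : ∀ A, OP (a A) (u A) := fun A =>
    ⟨hnorm1 _ (by rw [hin, e11]), hnorm1 _ (by rw [hin, e22]), by rw [hin, e12]⟩
  have hval : ∀ (A : L) i, (a A).1 i = ((sc A)⁻¹ * bA A.1 i) • f1 := by
    intro A i
    change (sc A)⁻¹ • (bA A.1 i • f1) = _
    rw [smul_smul]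
  have hmem : ∀ (A : L) i, i ∈ A.1 ↔ 0 < ⟪(a A).1 i, f1⟫ := by
    intro A i
    rw [hval, inner_smul_left, e11]
    simp only [conj_trivial, mul_one]
    rw [mul_pos_iff_of_pos_left (inv_pos.2 (hsc A))]
    constructor
    · exact (bA_pos_iff A.2 i).1
    · intro h
      by_contra h'
      exact absurd ((bA_pos_iff A.2 i).2 h') (not_lt.2 h.le)
  have hinj : Function.Injective a := by
    intro A B h
    apply Subtype.ext
    ext i
    rw [hmem A, hmem B, h]
  let e : Equiv.Perm (Fin r) → L → L := fun s A => ⟨A.1.map s.symm.toEmbedding, by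
    have := (Finset.mem_filter.1 A.2).2
    refine Finset.mem_filter.2 ⟨Finset.mem_univ _, ?_⟩
    rwa [Finset.card_map]⟩
  have hesc : ∀ s A, sc (e s A) = sc A := by
    intro s A
    simp only [sc, e]
    congr 1
    rw [← Equiv.sum_comp s (fun i => bA A.1 i ^ 2)]
    refine Finset.sum_congr rfl fun i _ => ?_
    simp [bA]
  have hdim : 3 ≤ Module.finrank ℝ (V0 r) := by
    let A : Finset (Fin r) := {⟨0, by omega⟩}
    have hA : A ∈ propSub r := by
      refine Finset.mem_filter.2 ⟨Finset.mem_univ _, ?_⟩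
      rw [Finset.card_singleton]
      omega
    have hi : Function.Injective (fV hr A) := by
      rw [← LinearMap.ker_eq_bot, LinearMap.ker_eq_bot']
      intro f hf
      have h1 := fV_inner hr A f f
      rw [hf, inner_zero_left, eq_comm, mul_eq_zero, or_iff_right (sA_pos hA).ne'] at h1
      simpa using h1
    have := LinearMap.finrank_le_finrank_of_injective hi
    simpa using this
  refine ⟨L, inferInstance, fun A => incV r (a A), fun K hK hND hKa => ?_⟩
  refine exists_g_abs hdim (prV r) (incV r) pr_inc pr_ne RV ?_ ?_ ?_ (fun A : L => n A.1.card) ?_ a u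
    hOP hinj e ?_ ?_ ?_ K hK hND ?_
  · intro s x y
    rw [V0_inner, V0_inner, ← Equiv.sum_comp s (fun i => ⟪x.1 i, y.1 i⟫)]
    rfl
  · intro s v
    refine V0_ext fun i => ?_
    simp only [prV_apply, RV_apply, Function.comp]
    rw [Equiv.sum_comp s]
  · intro s x; rfl
  · rw [← hn]
    congr 1
    exact Finset.sum_coe_sort (propSub r) (fun A => n A.card)
  · intro s A
    simp [e]
  · intro s A
    simp only [a]
    rw [hesc, map_smul, ← fV_RV]
  · intro s A
    simp only [u]
    rw [hesc, map_smul, ← fV_RV]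
  · intro v hv A c h
    refine hKa v hv A c ((r : ℝ)⁻¹ • ∑ j, v j) ?_
    funext i
    have h1 := prV_apply v i
    rw [h] at h1
    simp only [incV_apply]
    rw [← sub_eq_iff_eq_add, ← h1]
    rfl
end TTC

open Set
open scoped Topology unitInterval RealInnerProductSpace

namespace TTC

lemma generic_family {W : Type*} [AddCommGroup W] [Module ℝ W] [FiniteDimensional ℝ W] {Γ : Type*}
    [Finite Γ] (T : Γ → W ≃ₗ[ℝ] W) {ι : Type*} [Finite ι] (U : ι → Submodule ℝ W) (k : ℕ) :
    ∃ X : Fin k → W, ∀ (γ : Fin k → Γ) (u : ι) (w : Fin k → ℝ), w ≠ 0 →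
      (Finset.univ.filter fun j => w j ≠ 0).card + Module.finrank ℝ (U u) ≤ Module.finrank ℝ W →
      ∑ j, w j • T (γ j) (X j) ∉ U u := by
  classical
  induction k with
  | zero =>
    refine ⟨fun j => j.elim0, fun γ u w hw => ?_⟩
    exact absurd (Subsingleton.elim _ _) hw
  | succ k ih =>
    obtain ⟨X, hX⟩ := ih
    let Idx := {q : ((Fin k → Γ) × Γ) × ι × Finset (Fin k) //
      q.2.2.card + Module.finrank ℝ (U q.2.1) < Module.finrank ℝ W}
    let p0 : Idx → Submodule ℝ W := fun q => U q.1.2.1 ⊔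
      Submodule.span ℝ ((q.1.2.2.image fun j => T (q.1.1.1 j) (X j) : Finset W) : Set W)
    have hp0 : ∀ q, p0 q ≠ ⊤ := by
      intro q h
      have h1 : Module.finrank ℝ (p0 q) ≤ _ := Submodule.finrank_add_le_finrank_add_finrank _ _
      have h2 : Module.finrank ℝ (Submodule.span ℝ ((q.1.2.2.image fun j => T (q.1.1.1 j) (X j) : Finset W) : Set W)) ≤ _ := finrank_span_finset_le_card _
      have h3 : (q.1.2.2.image fun j => T (q.1.1.1 j) (X j)).card ≤ _ := Finset.card_image_le
      rw [h, finrank_top] at h1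
      have := q.2
      omega
    obtain ⟨x, hx⟩ := avoid (fun q : Idx => (p0 q).comap (T q.1.1.2 : W →ₗ[ℝ] W)) (by
      intro q h
      apply hp0 q
      rw [eq_top_iff]
      intro y _
      have : (T q.1.1.2).symm y ∈ (p0 q).comap (T q.1.1.2 : W →ₗ[ℝ] W) := by rw [h]; trivial
      simpa using this)
    refine ⟨Fin.snoc X x, fun γ u w hw hc hmem => ?_⟩
    rw [Fin.sum_univ_castSucc] at hmem
    simp only [Fin.snoc_castSucc, Fin.snoc_last] at hmem
    have hcard : (Finset.univ.filter fun j => w j ≠ 0).card =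
        (Finset.univ.filter fun j : Fin k => w j.castSucc ≠ 0).card + if w (Fin.last k) ≠ 0 then 1 else 0 := by
      rw [Finset.card_filter, Finset.card_filter, Fin.sum_univ_castSucc]
    by_cases hl : w (Fin.last k) = 0
    · rw [hl, zero_smul, add_zero] at hmem
      refine hX (fun j => γ j.castSucc) u (fun j => w j.castSucc) ?_ ?_ hmem
      · intro h0
        apply hw
        funext j
        refine Fin.lastCases hl (fun i => ?_) j
        exact congrFun h0 i
      · rw [hcard] at hc
        omega
    · rw [hcard, if_pos hl] at hc
      refine hx ⟨((fun j => γ j.castSucc, γ (Fin.last k)), u, Finset.univ.filter fun j : Fin k => w j.castSucc ≠ 0), by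
        simp only; omega⟩ ?_
      simp only [Submodule.mem_comap, p0]
      set S := Submodule.span ℝ (((Finset.univ.filter fun j : Fin k => w j.castSucc ≠ 0).image
        fun j => T (γ j.castSucc) (X j) : Finset W) : Set W) with hS
      have h1 : ∑ j : Fin k, w j.castSucc • T (γ j.castSucc) (X j) ∈ S := by
        refine Submodule.sum_mem _ fun j _ => ?_
        by_cases hj : w j.castSucc = 0
        · rw [hj, zero_smul]; exact S.zero_mem
        · refine S.smul_mem _ (Submodule.subset_span ?_)
          rw [Finset.mem_coe, Finset.mem_image]
          exact ⟨j, by simpa using hj, rfl⟩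
      have h2 : w (Fin.last k) • T (γ (Fin.last k)) x ∈ U u ⊔ S := by
        have := Submodule.sub_mem _ (Submodule.mem_sup_left (S := U u) (T := S) hmem)
          (Submodule.mem_sup_right (S := U u) (T := S) h1)
        simpa using this
      exact (Submodule.smul_mem_iff _ hl).1 h2

/-- constant tuples -/
def DD (r : ℕ) : Submodule ℝ (Fin r → PP) :=
  LinearMap.range (LinearMap.pi (fun _ => LinearMap.id) : PP →ₗ[ℝ] (Fin r → PP))

lemma finrank_DD (r : ℕ) : Module.finrank ℝ (DD r) ≤ 3 := by
  have := LinearMap.finrank_range_le (LinearMap.pi (fun _ => LinearMap.id) : PP →ₗ[ℝ] (Fin r → PP))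
  exact this.trans (by simp)

lemma mem_DD {r : ℕ} (p : PP) : (fun _ => p) ∈ DD r := ⟨p, rfl⟩

/-- the affine tuple -/
noncomputable def Phi0 {r m : ℕ} (X : Fin m → Fin r → PP) (ρ : Fin m → Equiv.Perm (Fin r)) (w : Fin m → ℝ) :
    Fin r → PP := fun i => ∑ j, w j • X j (ρ j i)

theorem generic_X {r m : ℕ} (hr : 2 ≤ r) (hm : m + 2 = 3 * r) {L : Type} [Fintype L]
    (bad : L → Fin r → PP) : ∃ X : Fin m → Fin r → PP,
    ∀ (ρ : Fin m → Equiv.Perm (Fin r)) (w : Fin m → ℝ), w ≠ 0 →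
      ((∃ j, w j = 0) → ND (Phi0 X ρ w)) ∧
      ((∃ j j', j ≠ j' ∧ w j = 0 ∧ w j' = 0) → ∀ l (c : ℝ) (p : PP),
        Phi0 X ρ w ≠ fun i => c • bad l i + p) := by
  classical
  obtain ⟨U, hU⟩ : ∃ U : Option L → Submodule ℝ (Fin r → PP),
    U = fun o => o.elim (DD r) fun l => Submodule.span ℝ {bad l} ⊔ DD r := ⟨_, rfl⟩
  have hUn : U none = DD r := by rw [hU]; rfl
  have hUs : ∀ l, U (some l) = Submodule.span ℝ {bad l} ⊔ DD r := by intro l; rw [hU]; rfl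
  have hfn : Module.finrank ℝ (U none) ≤ 3 := by rw [hUn]; exact finrank_DD r
  have hfs : ∀ l, Module.finrank ℝ (U (some l)) ≤ 4 := by
    intro l
    rw [hUs]
    have h4 := Submodule.finrank_add_le_finrank_add_finrank (Submodule.span ℝ {bad l}) (DD r)
    have h5 := finrank_span_finset_le_card (R := ℝ) ({bad l} : Finset (Fin r → PP))
    rw [Finset.coe_singleton, Finset.card_singleton] at h5
    exact h4.trans (Nat.add_le_add h5 (finrank_DD r))
  obtain ⟨X, hX⟩ := generic_family (W := Fin r → PP) (Γ := Equiv.Perm (Fin r))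
    (fun s => LinearEquiv.funCongrLeft ℝ PP s) U m
  have hW : Module.finrank ℝ (Fin r → PP) = 3 * r := by
    rw [Module.finrank_pi_fintype]
    simp [mul_comm]
  have hP : ∀ (ρ : Fin m → Equiv.Perm (Fin r)) (w : Fin m → ℝ),
      ∑ j, w j • LinearEquiv.funCongrLeft ℝ PP (ρ j) (X j) = Phi0 X ρ w := by
    intro ρ w
    funext i
    simp [Phi0, Finset.sum_apply, LinearEquiv.funCongrLeft_apply, LinearMap.funLeft_apply]
  refine ⟨X, fun ρ w hw => ⟨?_, ?_⟩⟩
  · rintro ⟨j0, hj0⟩ hc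
    refine hX ρ none w hw ?_ ?_
    · have h1 : (Finset.univ.filter fun j => w j ≠ 0) ⊆ Finset.univ.erase j0 := by
        intro j hj
        simp only [Finset.mem_filter, Finset.mem_univ, true_and] at hj
        simp only [Finset.mem_erase, Finset.mem_univ, and_true]
        rintro rfl; exact hj hj0
      have h2 := Finset.card_le_card h1
      rw [Finset.card_erase_of_mem (Finset.mem_univ _), Finset.card_univ, Fintype.card_fin] at h2
      rw [hW]
      omega
    · rw [hP, hUn]
      have : Phi0 X ρ w = fun _ => Phi0 X ρ w ⟨0, by omega⟩ := by
        funext i; exact hc _ _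
      rw [this]
      exact mem_DD _
  · rintro ⟨j0, j1, hj, hj0, hj1⟩ l c p hc
    refine hX ρ (some l) w hw ?_ ?_
    · have h1 : (Finset.univ.filter fun j => w j ≠ 0) ⊆ (Finset.univ.erase j0).erase j1 := by
        intro j hw'
        simp only [Finset.mem_filter, Finset.mem_univ, true_and] at hw'
        simp only [Finset.mem_erase, Finset.mem_univ, and_true]
        constructor
        · rintro rfl; exact hw' hj1
        · rintro rfl; exact hw' hj0
      have h2 := Finset.card_le_card h1
      rw [Finset.card_erase_of_mem (by simp [hj.symm]), Finset.card_erase_of_mem (Finset.mem_univ _),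
        Finset.card_univ, Fintype.card_fin] at h2
      have h3 := hfs l
      have h6 : 4 ≤ m := by omega
      rw [hW]
      omega
    · rw [hP, hc, hUs]
      exact Submodule.add_mem _ (Submodule.mem_sup_left (Submodule.smul_mem _ c
        (Submodule.mem_span_singleton_self _))) (Submodule.mem_sup_right (mem_DD p))
end TTC

open Set
open scoped Topology unitInterval RealInnerProductSpace

namespace TTC

/-- standard simplex as a type -/
abbrev Sx (n : ℕ) := stdSimplex ℝ (Fin (n + 1))

/-- boundary of the simplex -/
def Bx (n : ℕ) : Set (Sx n) := {w | ∃ j, w.1 j = 0}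

lemma exists_simplex_homeo (n : ℕ) :
    ∃ e : Sx n ≃ₜ Metric.closedBall (0 : EuclideanSpace ℝ (Fin n)) 1,
      ∀ x, x ∈ Bx n ↔ ‖(e x).1‖ = 1 := by
  set s : Set (EuclideanSpace ℝ (Fin n)) := {y | (∀ i, 0 ≤ y i) ∧ ∑ i, y i ≤ 1} with hs
  let a : Sx n → s := fun w => ⟨WithLp.toLp 2 (fun i => w.1 i.succ), fun i => w.2.1 _, by
    have := w.2.2
    rw [Fin.sum_univ_succ] at this
    have h0 := w.2.1 0
    simp only
    linarith⟩
  let b : s → Sx n := fun y => ⟨Fin.cons (1 - ∑ i, y.1 i) (fun i => y.1 i), by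
    constructor
    · intro i
      refine Fin.cases ?_ (fun i => ?_) i
      · have := y.2.2; simp; linarith
      · simpa using y.2.1 i
    · rw [Fin.sum_univ_succ]; simp⟩
  have ha : Continuous a := by
    refine Continuous.subtype_mk ?_ _
    refine (PiLp.continuous_toLp 2 _).comp ?_
    exact continuous_pi fun i => (continuous_apply _).comp continuous_subtype_val
  have hb : Continuous b := by
    refine Continuous.subtype_mk ?_ _
    refine continuous_pi fun i => ?_
    refine Fin.cases ?_ (fun i => ?_) i
    · simp only [Fin.cons_zero]; fun_prop
    · simp only [Fin.cons_succ]; fun_prop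
  let e1 : Sx n ≃ₜ s :=
    { toFun := a
      invFun := b
      left_inv := by
        intro w
        apply Subtype.ext
        funext i
        refine Fin.cases ?_ (fun i => ?_) i
        · have := w.2.2
          rw [Fin.sum_univ_succ] at this
          simp only [a, b, Fin.cons_zero]
          linarith
        · simp [a, b]
      right_inv := by
        intro y
        apply Subtype.ext
        ext i
        simp [a, b]
      continuous_toFun := ha
      continuous_invFun := hb }
  have hcpt : IsCompact s := by
    have : CompactSpace s := e1.compactSpace
    exact isCompact_iff_compactSpace.2 this
  have hconv : Convex ℝ s := by
    intro x hx y hy p q hp hq hpq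
    refine ⟨fun i => ?_, ?_⟩
    · have h1 := hx.1 i; have h2 := hy.1 i
      simp only [PiLp.add_apply, PiLp.smul_apply, smul_eq_mul]
      positivity
    · simp only [PiLp.add_apply, PiLp.smul_apply, smul_eq_mul, Finset.sum_add_distrib, ← Finset.mul_sum]
      nlinarith [hx.2, hy.2]
  have hintr : ∀ y ∈ s, (y ∈ interior s ↔ (∀ i, 0 < y i) ∧ ∑ i, y i < 1) := by
    intro y hy
    constructor
    · intro hyi
      have key : ∀ v : EuclideanSpace ℝ (Fin n), ∃ t > 0, y + (t : ℝ) • v ∈ s := by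
        intro v
        have hc : Filter.Tendsto (fun t : ℝ => y + t • v) (𝓝[>] 0) (𝓝 y) := by
          have : Continuous (fun t : ℝ => y + t • v) := by fun_prop
          have h2 := this.tendsto 0
          simp only [zero_smul, add_zero] at h2
          exact h2.mono_left nhdsWithin_le_nhds
        have h1 := hc.eventually (mem_interior_iff_mem_nhds.1 hyi)
        obtain ⟨t, ht1, ht2⟩ := (h1.and self_mem_nhdsWithin).exists
        exact ⟨t, ht2, ht1⟩
      constructor
      · intro i
        obtain ⟨t, ht, h⟩ := key (-EuclideanSpace.single i 1)
        have := h.1 i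
        simp at this
        linarith
      · obtain ⟨t, ht, h⟩ := key y
        have := h.2
        simp only [PiLp.add_apply, PiLp.smul_apply, smul_eq_mul, Finset.sum_add_distrib, ← Finset.mul_sum] at this
        by_contra h1
        have := mul_pos ht (lt_of_lt_of_le one_pos (not_lt.1 h1))
        linarith [hy.2]
    · intro h
      have ho : IsOpen {y : EuclideanSpace ℝ (Fin n) | (∀ i, 0 < y i) ∧ ∑ i, y i < 1} := by
        refine IsOpen.inter ?_ ?_
        · have : {y : EuclideanSpace ℝ (Fin n) | ∀ i, 0 < y i} = ⋂ i, {y | 0 < y i} := by ext; simp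
          change IsOpen {y : EuclideanSpace ℝ (Fin n) | ∀ i, 0 < y i}
          rw [this]
          exact isOpen_iInter_of_finite fun i => isOpen_lt continuous_const (by fun_prop)
        · have hc : Continuous fun y : EuclideanSpace ℝ (Fin n) => ∑ i, y i := by fun_prop
          exact isOpen_lt hc continuous_const
      have hsub : {y : EuclideanSpace ℝ (Fin n) | (∀ i, 0 < y i) ∧ ∑ i, y i < 1} ⊆ s :=
        fun z hz => ⟨fun i => (hz.1 i).le, hz.2.le⟩
      exact interior_maximal hsub ho h
  have hne : (interior s).Nonempty := by
    let y : EuclideanSpace ℝ (Fin n) := WithLp.toLp 2 fun _ => (1 / (n + 1) : ℝ)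
    have h1 : ∀ i, 0 < y i := fun i => by simp only [y]; positivity
    have h2 : ∑ i, y i < 1 := by
      simp only [y, Finset.sum_const, Finset.card_univ, Fintype.card_fin, nsmul_eq_mul]
      rw [mul_one_div, div_lt_one (by positivity)]
      linarith
    exact ⟨y, (hintr y ⟨fun i => (h1 i).le, h2.le⟩).2 ⟨h1, h2⟩⟩
  obtain ⟨h, h1, h2, h3⟩ := exists_homeomorph_image_interior_closure_frontier_eq_unitBall hconv hne
    hcpt.isBounded
  rw [hcpt.isClosed.closure_eq] at h2
  let e2 : s ≃ₜ Metric.closedBall (0 : EuclideanSpace ℝ (Fin n)) 1 :=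
    (h.image s).trans (Homeomorph.setCongr h2)
  refine ⟨e1.trans e2, fun w => ?_⟩
  have h4 : ((e1.trans e2 w).1 : EuclideanSpace ℝ (Fin n)) = h (e1 w).1 := rfl
  rw [h4]
  have h5 : ‖h (e1 w).1‖ = 1 ↔ (e1 w).1 ∉ interior s := by
    have : ‖h (e1 w).1‖ = 1 ↔ h (e1 w).1 ∈ h '' frontier s := by rw [h3]; simp
    rw [this, h.injective.mem_set_image, hcpt.isClosed.frontier_eq]
    exact ⟨fun q => q.2, fun q => ⟨(e1 w).2, q⟩⟩
  rw [h5, hintr _ (e1 w).2]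
  have hv : ∀ i, (e1 w).1 i = w.1 i.succ := fun i => rfl
  have hsum := w.2.2
  rw [Fin.sum_univ_succ] at hsum
  simp only [hv]
  have hw : ∀ j, w.1 j = 0 ↔ ¬ 0 < w.1 j := fun j => by
    have := w.2.1 j
    constructor
    · intro h; simp [h]
    · intro h; linarith
  have h0 : ∑ i : Fin n, w.1 i.succ < 1 ↔ 0 < w.1 0 := by constructor <;> intro <;> linarith
  rw [h0]
  simp only [Bx, Set.mem_ofPred_eq, hw]
  rw [← not_forall, Fin.forall_fin_succ, and_comm]

end TTC

open Set
open scoped Topology unitInterval RealInnerProductSpace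

namespace TTC

lemma perm_two {r : ℕ} {s t : Equiv.Perm (Fin r)} (h : s ≠ t) :
    ∃ i i', i ≠ i' ∧ s i ≠ t i ∧ s i' ≠ t i' := by
  by_contra hc
  push Not at hc
  apply h
  have : ∃ i, s i ≠ t i := by
    by_contra h2
    push Not at h2
    exact h (Equiv.ext h2)
  obtain ⟨i, hi⟩ := this
  exfalso
  let i' := s.symm (t i)
  have h1 : s i' = t i := by simp [i']
  have h2 : i ≠ i' := fun h3 => hi (by rw [← h1, ← h3])
  have h3 := hc i i' h2 hi
  rw [h1] at h3
  exact h2 (t.injective h3)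

/-- normalized tuples of permutations -/
abbrev NP (n r : ℕ) := {ρ : Fin (n + 1) → Equiv.Perm (Fin r) // ρ 0 = 1}

theorem simplex_cell_norm {n r : ℕ} (hn : n + 1 < 3 * r)
    (F : (Fin (n + 1) → Fin r) → Sx n → PP) (hF : ∀ c, Continuous (F c))
    (T : NP n r → C(Sx n, YY r PP))
    (hT : ∀ ρ, ∀ x ∈ Bx n, (T ρ x).1 = fun i => F (fun j => ρ.1 j i) x) :
    ∃ F' : (Fin (n + 1) → Fin r) → Sx n → PP, (∀ c, Continuous (F' c)) ∧
      (∀ c, ∀ x ∈ Bx n, F' c x = F c x) ∧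
      ∀ ρ : NP n r, ∃ φ : C(Sx n, YY r PP), (∀ x, (φ x).1 = fun i => F' (fun j => ρ.1 j i) x) ∧
        φ.HomotopicRel (T ρ) (Bx n) := by
  obtain ⟨e, he⟩ := exists_simplex_homeo n
  refine cell_lemma (Bx n) e he F hF ?_ (fun (ρ : NP n r) i j => ρ.1 j i) ?_ ?_ T hT
  · simp; omega
  · intro ρ i i' h
    have := congrFun h 0
    simpa using this
  · intro ρ ρ' h
    have : ∃ j, ρ'.1 j ≠ ρ.1 j := by
      by_contra hc
      push Not at hc
      exact h (Subtype.ext (funext hc)).symm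
    obtain ⟨j, hj⟩ := this
    have key : ∀ i, ρ'.1 j i ≠ ρ.1 j i → (fun j => ρ'.1 j i) ∉ range fun (i : Fin r) j => ρ.1 j i := by
      rintro i hi ⟨i0, h0⟩
      have h1 := congrFun h0 0
      simp only [ρ.2, ρ'.2, Equiv.Perm.one_apply] at h1
      subst h1
      exact hi (congrFun h0 j).symm
    obtain ⟨i, i', h1, h2, h3⟩ := perm_two hj
    exact ⟨i, i', h1, key i h2, key i' h3⟩

lemma ND_perm {r : ℕ} {P : Type*} {v : Fin r → P} (h : ND v) (s : Equiv.Perm (Fin r)) :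
    ND (v ∘ s) := by
  intro h2
  apply h
  intro i j
  simpa using h2 (s.symm i) (s.symm j)

/-- permuting the coordinates -/
def permY {r : ℕ} {P : Type*} [TopologicalSpace P] (s : Equiv.Perm (Fin r)) : C(YY r P, YY r P) :=
  ⟨fun v => ⟨v.1 ∘ s, ND_perm v.2 s⟩, by
    refine Continuous.subtype_mk ?_ _
    exact continuous_pi fun i => (continuous_apply _).comp continuous_subtype_val⟩

/-- normalization -/
def nrm {n r : ℕ} (ρ : Fin (n + 1) → Equiv.Perm (Fin r)) : NP n r :=
  ⟨fun j => (ρ 0).symm.trans (ρ j), by ext; simp⟩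

lemma nrm_spec {n r : ℕ} (ρ : Fin (n + 1) → Equiv.Perm (Fin r)) (j i) :
    (nrm ρ).1 j (ρ 0 i) = ρ j i := by simp [nrm]

lemma nrm_spec' {n r : ℕ} (ρ : Fin (n + 1) → Equiv.Perm (Fin r)) :
    (fun j => (ρ 0).trans ((nrm ρ).1 j)) = ρ := by
  funext j; ext i; simp [nrm]

theorem simplex_cell {n r : ℕ} (hn : n + 1 < 3 * r)
    (F : (Fin (n + 1) → Fin r) → Sx n → PP) (hF : ∀ c, Continuous (F c))
    (T : (Fin (n + 1) → Equiv.Perm (Fin r)) → C(Sx n, YY r PP))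
    (hTe : ∀ ρ (s : Equiv.Perm (Fin r)) x, (T (fun j => s.trans (ρ j)) x).1 = (T ρ x).1 ∘ s)
    (hT : ∀ ρ, ∀ x ∈ Bx n, (T ρ x).1 = fun i => F (fun j => ρ j i) x) :
    ∃ F' : (Fin (n + 1) → Fin r) → Sx n → PP, (∀ c, Continuous (F' c)) ∧
      (∀ c, ∀ x ∈ Bx n, F' c x = F c x) ∧
      ∀ ρ, ∃ φ : C(Sx n, YY r PP), (∀ x, (φ x).1 = fun i => F' (fun j => ρ j i) x) ∧
        φ.HomotopicRel (T ρ) (Bx n) := by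
  obtain ⟨F', h1, h2, h3⟩ := simplex_cell_norm hn F hF (fun ρ => T ρ.1) (fun ρ => hT ρ.1)
  refine ⟨F', h1, h2, fun ρ => ?_⟩
  obtain ⟨φ, hφ, hh⟩ := h3 (nrm ρ)
  refine ⟨(permY (ρ 0)).comp φ, fun x => ?_, ?_⟩
  · funext i
    change (φ x).1 (ρ 0 i) = _
    rw [hφ]
    simp only [nrm_spec]
  · have h4 : T ρ = (permY (ρ 0)).comp (T (nrm ρ).1) := by
      ext1 x
      apply Subtype.ext
      have := hTe (nrm ρ).1 (ρ 0) x
      rw [nrm_spec'] at this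
      exact this
    rw [h4]
    exact hh.comp_continuousMap (permY (ρ 0))

end TTC

open Set
open scoped Topology unitInterval RealInnerProductSpace

namespace TTC

lemma extend_null {X E Z : Type*} [TopologicalSpace X] [TopologicalSpace Z]
    [NormedAddCommGroup E] [NormedSpace ℝ E] (S : Set X)
    (e : X ≃ₜ Metric.closedBall (0 : E) 1) (he : ∀ x, x ∈ S ↔ ‖(e x).1‖ = 1)
    (φ : C(S, Z)) (hφ : φ.Nullhomotopic) : ∃ T : C(X, Z), ∀ x : S, T x.1 = φ x := by
  classical
  obtain ⟨z0, ⟨H⟩⟩ := hφ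
  have hdir : ∀ x, 1 / 2 ≤ ‖(e x).1‖ → ‖‖(e x).1‖⁻¹ • (e x).1‖ = 1 := by
    intro x hx
    rw [norm_smul, norm_inv, norm_norm, inv_mul_cancel₀]
    linarith
  have hmem : ∀ x, 1 / 2 ≤ ‖(e x).1‖ → ‖(e x).1‖⁻¹ • (e x).1 ∈ Metric.closedBall (0 : E) 1 :=
    fun x hx => by rw [mem_closedBall_zero_iff]; exact (hdir x hx).le
  let q : {x // 1 / 2 ≤ ‖(e x).1‖} → S := fun x => ⟨e.symm ⟨_, hmem x.1 x.2⟩, by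
    rw [he, e.apply_symm_apply]; exact hdir x.1 x.2⟩
  have hq : Continuous q := by
    refine Continuous.subtype_mk (e.symm.continuous.comp (Continuous.subtype_mk ?_ _)) _
    have h1 : Continuous fun x : {x // 1 / 2 ≤ ‖(e x).1‖} => (e x.1).1 :=
      continuous_subtype_val.comp (e.continuous.comp continuous_subtype_val)
    refine Continuous.smul (Continuous.inv₀ h1.norm fun x => ?_) h1
    have := x.2
    linarith
  let u : X → I := fun x => ⟨max 0 (min 1 (2 - 2 * ‖(e x).1‖)), le_max_left _ _,
    max_le zero_le_one (min_le_left _ _)⟩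
  have hn : Continuous fun x : X => ‖(e x).1‖ := (continuous_subtype_val.comp e.continuous).norm
  have hu : Continuous u := by
    refine Continuous.subtype_mk ?_ _
    fun_prop
  let g' : X → Z := fun x => if h : 1 / 2 ≤ ‖(e x).1‖ then H (u x, q ⟨x, h⟩) else z0
  have hc : Continuous fun x => if ‖(e x).1‖ ≤ 1 / 2 then z0 else g' x := by
    refine continuous_if_le hn continuous_const continuousOn_const ?_ ?_
    · rw [continuousOn_iff_continuous_domRestrict]
      have : Set.domRestrict {x | 1 / 2 ≤ ‖(e x).1‖} g' = fun x => H (u x.1, q x) := by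
        funext x
        have hx : 1 / 2 ≤ ‖(e x.1).1‖ := x.2
        simp only [Set.domRestrict_apply, g', dif_pos hx]
        rfl
      rw [this]
      exact H.continuous.comp ((hu.comp continuous_subtype_val).prodMk hq)
    · intro x hx
      have h1 : u x = 1 := by
        apply Subtype.ext
        simp only [u, hx]
        norm_num
      simp only [g', dif_pos hx.ge, h1]
      simp
  refine ⟨⟨_, hc⟩, fun x => ?_⟩
  have hx := (he x.1).1 x.2
  have h0 : u x.1 = 0 := by
    apply Subtype.ext
    simp only [u, hx]
    norm_num
  have hge : 1 / 2 ≤ ‖(e x.1).1‖ := by rw [hx]; norm_num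
  have h2 : q ⟨x.1, hge⟩ = x := by
    apply Subtype.ext
    simp [q, hx]
  simp only [ContinuousMap.coe_mk]
  rw [if_neg (by rw [hx]; norm_num)]
  simp only [g', dif_pos hge, h0, h2]
  simp

/-- restriction to a facet -/
def res {k : ℕ} (j : Fin (k + 2)) (w : Sx (k + 1)) (hj : w.1 j = 0) : Sx k :=
  ⟨fun i => w.1 (j.succAbove i), fun i => w.2.1 _, by
    have := w.2.2
    rw [Fin.sum_univ_succAbove _ j, hj, zero_add] at this
    exact this⟩

/-- inclusion of a facet -/
def emb {k : ℕ} (j : Fin (k + 2)) (w : Sx k) : Sx (k + 1) :=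
  ⟨j.insertNth (α := fun _ => ℝ) 0 w.1, by
    constructor
    · intro i
      refine Fin.succAboveCases j ?_ (fun i => ?_) i
      · simp
      · simpa using w.2.1 i
    · rw [Fin.sum_univ_succAbove _ j]
      simpa using w.2.2⟩

lemma emb_same {k : ℕ} (j : Fin (k + 2)) (w : Sx k) : (emb j w).1 j = 0 := by simp [emb]

lemma emb_succ {k : ℕ} (j : Fin (k + 2)) (w : Sx k) (i) : (emb j w).1 (j.succAbove i) = w.1 i := by
  simp [emb]

lemma emb_mem {k : ℕ} (j : Fin (k + 2)) (w : Sx k) : emb j w ∈ Bx (k + 1) := ⟨j, emb_same j w⟩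

lemma emb_continuous {k : ℕ} (j : Fin (k + 2)) : Continuous (emb j) := by
  refine Continuous.subtype_mk ?_ _
  exact Continuous.finInsertNth j continuous_const continuous_subtype_val

lemma emb_res {k : ℕ} (j : Fin (k + 2)) (w : Sx (k + 1)) (hj : w.1 j = 0) :
    emb j (res j w hj) = w := by
  apply Subtype.ext
  funext i
  refine Fin.succAboveCases j ?_ (fun i => ?_) i
  · rw [emb_same, hj]
  · rw [emb_succ]; rfl

lemma res_mem {k : ℕ} {j j' : Fin (k + 2)} (w : Sx (k + 1)) (hj : w.1 j = 0) (h : j' ≠ j)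
    (hj' : w.1 j' = 0) : res j w hj ∈ Bx k := by
  obtain ⟨i, rfl⟩ := Fin.exists_succAbove_eq h
  exact ⟨i, hj'⟩

lemma glue {k : ℕ} {A Z : Type*} [TopologicalSpace A] [TopologicalSpace Z]
    (G : Fin (k + 2) → A × Sx k → Z) (hG : ∀ j, Continuous (G j))
    (hc : ∀ w : Sx (k + 1), ∀ j j' (hj : w.1 j = 0) (hj' : w.1 j' = 0) (a : A), j ≠ j' →
      G j (a, res j w hj) = G j' (a, res j' w hj')) :
    ∃ G' : A × Bx (k + 1) → Z, Continuous G' ∧ ∀ a (w : Bx (k + 1)) j (hj : w.1.1 j = 0),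
      G' (a, w) = G j (a, res j w.1 hj) := by
  let G' : A × Bx (k + 1) → Z := fun p => G p.2.2.choose (p.1, res _ p.2.1 p.2.2.choose_spec)
  have h1 : ∀ a (w : Bx (k + 1)) j (hj : w.1.1 j = 0), G' (a, w) = G j (a, res j w.1 hj) := by
    intro a w j hj
    by_cases h : w.2.choose = j
    · subst h; rfl
    · exact hc w.1 _ _ _ _ a h
  refine ⟨G', ?_, h1⟩
  refine (locallyFinite_of_finite fun j : Fin (k + 2) =>
    {p : A × Bx (k + 1) | p.2.1.1 j = 0}).continuous ?_ ?_ ?_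
  · ext p
    simp only [mem_iUnion, mem_univ, iff_true]
    exact p.2.2
  · intro j
    exact isClosed_eq ((continuous_apply j).comp (continuous_subtype_val.comp
      (continuous_subtype_val.comp continuous_snd))) continuous_const
  · intro j
    rw [continuousOn_iff_continuous_domRestrict]
    have : Set.domRestrict {p : A × Bx (k + 1) | p.2.1.1 j = 0} G' =
        fun p => G j (p.1.1, res j p.1.2.1 p.2) := by
      funext p
      exact h1 _ _ _ _
    rw [this]
    refine (hG j).comp (Continuous.prodMk (continuous_fst.comp continuous_subtype_val) ?_)
    refine Continuous.subtype_mk ?_ _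
    exact continuous_pi fun i => (continuous_apply _).comp (continuous_subtype_val.comp
      (continuous_subtype_val.comp (continuous_snd.comp continuous_subtype_val)))

end TTC

open Set
open scoped Topology unitInterval RealInnerProductSpace

namespace TTC

/-- the linear model -/
noncomputable def F0 {r m : ℕ} (X : Fin m → Fin r → PP) (c : Fin m → Fin r) (w : Fin m → ℝ) : PP :=
  ∑ j, w j • X j (c j)

lemma F0_congr {r m : ℕ} (X : Fin m → Fin r → PP) {c c' : Fin m → Fin r} {w : Fin m → ℝ}
    (h : ∀ j, w j ≠ 0 → c j = c' j) : F0 X c w = F0 X c' w := by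
  refine Finset.sum_congr rfl fun j _ => ?_
  by_cases hj : w j = 0
  · simp [hj]
  · rw [h j hj]

lemma F0_continuous {r m : ℕ} (X : Fin m → Fin r → PP) (c : Fin m → Fin r) :
    Continuous (F0 X c) := by
  unfold F0
  fun_prop

lemma simplex_ne_zero {n : ℕ} (w : Sx n) : w.1 ≠ 0 := by
  intro h
  have := w.2.2
  rw [h] at this
  simp at this

theorem main_F {r k : ℕ} (hr : 2 ≤ r) (hnp : ¬ IsPrimePow r) (hk : k + 4 = 3 * r) :
    ∃ F : (Fin (k + 2) → Fin r) → Sx (k + 1) → PP, (∀ c, Continuous (F c)) ∧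
      (∀ c c' (w : Sx (k + 1)), (∀ j, w.1 j ≠ 0 → c j = c' j) → F c w = F c' w) ∧
      ∀ (ρ : Fin (k + 2) → Equiv.Perm (Fin r)) w, ND (fun i => F (fun j => ρ j i) w) := by
  classical
  obtain ⟨L, hL, bad, hbad⟩ := exists_g hr hnp
  obtain ⟨X, hX⟩ := generic_X (m := k + 2) hr (by omega) bad
  have hPhi : ∀ ρ w, Phi0 X ρ w = fun i => F0 X (fun j => ρ j i) w := fun ρ w => rfl
  have hPc : ∀ ρ, Continuous (Phi0 X ρ) := fun ρ => by
    refine continuous_pi fun i => ?_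
    exact F0_continuous X _
  let i0 : Fin r := ⟨0, by omega⟩
  -- compact set
  let D : Set (Fin (k + 2) → ℝ) := stdSimplex ℝ (Fin (k + 2)) ∩
    ⋃ j, ⋃ j', ⋃ (_ : j ≠ j'), {w | w j = 0 ∧ w j' = 0}
  have hDmem : ∀ w, w ∈ D ↔ w ∈ stdSimplex ℝ (Fin (k + 2)) ∧ ∃ j j', j ≠ j' ∧ w j = 0 ∧ w j' = 0 := by
    intro w
    simp only [D, Set.mem_inter_iff, Set.mem_iUnion, Set.mem_ofPred_eq, exists_prop]
  have hD : IsCompact D := by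
    refine (isCompact_stdSimplex _ _).inter_right ?_
    refine isClosed_iUnion_of_finite fun j => isClosed_iUnion_of_finite fun j' =>
      isClosed_iUnion_of_finite fun _ => ?_
    exact (isClosed_eq (continuous_apply j) continuous_const).inter
      (isClosed_eq (continuous_apply j') continuous_const)
  let K : Set (Fin r → PP) := ⋃ ρ : Fin (k + 2) → Equiv.Perm (Fin r), Phi0 X ρ '' D
  have hK : IsCompact K := isCompact_iUnion fun ρ => hD.image (hPc ρ)
  have hne : ∀ w ∈ stdSimplex ℝ (Fin (k + 2)), w ≠ 0 := fun w hw => simplex_ne_zero (n := k + 1) ⟨w, hw⟩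
  obtain ⟨g, hgn, hgs, hgK⟩ := hbad K hK (by
      intro v hv
      obtain ⟨ρ, w, hw, rfl⟩ := mem_iUnion.1 hv
      obtain ⟨h1, j, j', h2, h3, h4⟩ := (hDmem w).1 hw
      exact (hX ρ w (hne w h1)).1 ⟨j, h3⟩) (by
      intro v hv
      obtain ⟨ρ, w, hw, rfl⟩ := mem_iUnion.1 hv
      obtain ⟨h1, h2⟩ := (hDmem w).1 hw
      exact (hX ρ w (hne w h1)).2 h2)
  -- maps on the boundary
  let Q : (Fin (k + 2) → Equiv.Perm (Fin r)) → C(Bx (k + 1), YY r PP) := fun ρ =>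
    ⟨fun w => ⟨Phi0 X ρ w.1.1, (hX ρ _ (simplex_ne_zero w.1)).1 w.2⟩, by
      refine Continuous.subtype_mk ?_ _
      exact (hPc ρ).comp (continuous_subtype_val.comp continuous_subtype_val)⟩
  have hQv : ∀ ρ w, (Q ρ w).1 = fun i => F0 X (fun j => ρ j i) w.1.1 := fun ρ w => rfl
  have hQK : ∀ ρ (w : Bx (k + 1)), (∃ j j', j ≠ j' ∧ w.1.1 j = 0 ∧ w.1.1 j' = 0) → g (Q ρ w) = Q ρ w := by
    intro ρ w h
    refine hgK _ (mem_iUnion.2 ⟨ρ, w.1.1, (hDmem _).2 ⟨w.1.2, h⟩, rfl⟩)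
  let EB : ∀ j : Fin (k + 2), C(Sx k, Bx (k + 1)) := fun j =>
    ⟨fun w => ⟨emb j w, emb_mem j w⟩, (emb_continuous j).subtype_mk _⟩
  let ins : Fin (k + 2) → (Fin (k + 1) → Equiv.Perm (Fin r)) → (Fin (k + 2) → Equiv.Perm (Fin r)) :=
    fun j ρ => j.insertNth (α := fun _ => Equiv.Perm (Fin r)) 1 ρ
  have hins : ∀ j ρ i, ins j ρ (j.succAbove i) = ρ i := by intro j ρ i; simp [ins]
  let insc : Fin (k + 2) → (Fin (k + 1) → Fin r) → (Fin (k + 2) → Fin r) :=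
    fun j c => j.insertNth (α := fun _ => Fin r) i0 c
  have hinsc : ∀ j c i, insc j c (j.succAbove i) = c i := by intro j ρ i; simp [insc]
  -- agreement off j
  have hoff : ∀ (j : Fin (k + 2)) (w : Sx (k + 1)) (_ : w.1 j = 0) (c c' : Fin (k + 2) → Fin r),
      (∀ i, c (j.succAbove i) = c' (j.succAbove i)) → F0 X c w.1 = F0 X c' w.1 := by
    intro j w hj c c' h
    refine F0_congr X fun l hl => ?_
    have : l ≠ j := fun h => hl (by rw [h, hj])
    obtain ⟨i, rfl⟩ := Fin.exists_succAbove_eq this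
    exact h i
  have facet : ∀ j : Fin (k + 2), ∃ F' : (Fin (k + 1) → Fin r) → Sx k → PP, (∀ c, Continuous (F' c)) ∧
      (∀ c, ∀ x ∈ Bx k, F' c x = F0 X (insc j c) (emb j x).1) ∧
      ∀ ρ, ∃ φ : C(Sx k, YY r PP), (∀ x, (φ x).1 = fun i => F' (fun j => ρ j i) x) ∧
        φ.HomotopicRel (g.comp ((Q (ins j ρ)).comp (EB j))) (Bx k) := by
    intro j
    refine simplex_cell (n := k) (by omega) (fun c x => F0 X (insc j c) (emb j x).1) ?_
      (fun ρ => g.comp ((Q (ins j ρ)).comp (EB j))) ?_ ?_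
    · intro c
      exact (F0_continuous X _).comp (continuous_subtype_val.comp (emb_continuous j))
    · intro ρ s x
      refine hgs s _ _ ?_
      funext i
      refine hoff j _ (emb_same j x) _ _ fun l => ?_
      simp only [hins]
      rfl
    · intro ρ x hx
      have h1 : g (Q (ins j ρ) (EB j x)) = Q (ins j ρ) (EB j x) := by
        refine hQK _ _ ?_
        obtain ⟨i, hi⟩ := hx
        exact ⟨j, j.succAbove i, (Fin.succAbove_ne j i).symm, emb_same j x, (emb_succ j x i).trans hi⟩
      change (g (Q (ins j ρ) (EB j x))).1 = _
      rw [h1]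
      funext i
      refine hoff j _ (emb_same j x) _ _ fun l => ?_
      simp only [hins, hinsc]
  choose F1 hF1c hF1b hF1h using facet
  have hF1two : ∀ (c : Fin (k + 2) → Fin r) (w : Sx (k + 1)) (j j' : Fin (k + 2)) (hj : w.1 j = 0)
      (_ : w.1 j' = 0), j' ≠ j → F1 j (fun i => c (j.succAbove i)) (res j w hj) = F0 X c w.1 := by
    intro c w j j' hj hj' h
    rw [hF1b _ _ _ (res_mem w hj h hj'), emb_res]
    exact hoff j w hj _ _ fun i => by simp only [hinsc]
  have FBex : ∀ c : Fin (k + 2) → Fin r, ∃ FB : C(Bx (k + 1), PP), ∀ (w : Bx (k + 1)) j (hj : w.1.1 j = 0),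
      FB w = F1 j (fun i => c (j.succAbove i)) (res j w.1 hj) := by
    intro c
    obtain ⟨G, hG, hG2⟩ := glue (A := Unit) (fun j p => F1 j (fun i => c (j.succAbove i)) p.2)
      (fun j => (hF1c j _).comp continuous_snd) (by
        intro w j j' hj hj' _ h
        simp only
        rw [hF1two c w j j' hj hj' h.symm, hF1two c w j' j hj' hj h])
    exact ⟨⟨fun w => G ((), w), hG.comp (by fun_prop)⟩, fun w j hj => hG2 () w j hj⟩
  choose FB hFB using FBex
  -- the boundary maps
  have hbd : ∀ ρ : Fin (k + 2) → Equiv.Perm (Fin r), ∃ φ : C(Bx (k + 1), YY r PP),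
      (∀ w, (φ w).1 = fun i => FB (fun j => ρ j i) w) ∧ φ.Nullhomotopic := by
    intro ρ
    have hh := fun j => hF1h j (fun i => ρ (j.succAbove i))
    choose φ hφ1 hφ2 using hh
    have hTv : ∀ (w : Bx (k + 1)) j (hj : w.1.1 j = 0),
        (g.comp ((Q (ins j fun i => ρ (j.succAbove i))).comp (EB j))) (res j w.1 hj) = g (Q ρ w) := by
      intro w j hj
      change g (Q _ (EB j _)) = _
      congr 1
      apply Subtype.ext
      have h1 : EB j (res j w.1 hj) = w := Subtype.ext (emb_res j w.1 hj)
      rw [h1]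
      funext i
      refine hoff j _ hj _ _ fun l => ?_
      simp only [hins]
    have H := fun j => (hφ2 j).some
    obtain ⟨G, hG, hG2⟩ := glue (A := I) (fun j p => H j p) (fun j => (H j).continuous) (by
      intro w j j' hj hj' a h
      have hw : w ∈ Bx (k + 1) := ⟨j, hj⟩
      rw [(H j).eq_snd a (res_mem w hj h.symm hj'), (H j').eq_snd a (res_mem w hj' h hj)]
      rw [hTv ⟨w, hw⟩ j hj, hTv ⟨w, hw⟩ j' hj'])
    let φ' : C(Bx (k + 1), YY r PP) := ⟨fun w => G (0, w), hG.comp (by fun_prop)⟩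
    have hhom : φ'.Homotopic (g.comp (Q ρ)) := by
      refine ⟨⟨⟨G, hG⟩, fun w => rfl, fun w => ?_⟩⟩
      obtain ⟨j, hj⟩ := w.2
      change G (1, w) = _
      rw [hG2 1 w j hj, (H j).apply_one]
      exact hTv w j hj
    refine ⟨φ', fun w => ?_, ?_⟩
    · obtain ⟨j, hj⟩ := w.2
      change (G (0, w)).1 = _
      rw [hG2 0 w j hj, (H j).apply_zero, hφ1]
      funext i
      rw [hFB _ w j hj]
    · obtain ⟨y, hy⟩ := hgn.comp_left (Q ρ)
      exact ⟨y, hhom.trans hy⟩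
  obtain ⟨e, he⟩ := exists_simplex_homeo (k + 1)
  have hT : ∀ ρ : NP (k + 1) r, ∃ T : C(Sx (k + 1), YY r PP), ∀ x : Bx (k + 1),
      (T x.1).1 = fun i => FB (fun j => ρ.1 j i) x := by
    intro ρ
    obtain ⟨φ, h1, h2⟩ := hbd ρ.1
    obtain ⟨T, hT⟩ := extend_null _ e he φ h2
    exact ⟨T, fun x => by rw [hT, h1]⟩
  choose T hT using hT
  have hBc : IsClosed (Bx (k + 1)) := by
    have : Bx (k + 1) = ⋃ j, {w : Sx (k + 1) | w.1 j = 0} := by ext; simp [Bx]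
    rw [this]
    exact isClosed_iUnion_of_finite fun j => isClosed_eq
      ((continuous_apply j).comp continuous_subtype_val) continuous_const
  have hF2 : ∀ c, ∃ F2 : C(Sx (k + 1), PP), F2.restrict (Bx (k + 1)) = FB c := fun c =>
    ContinuousMap.exists_restrict_eq hBc (FB c)
  choose F2 hF2 using hF2
  have hF2v : ∀ c (w : Bx (k + 1)), F2 c w.1 = FB c w := fun c w => by
    rw [← hF2]; rfl
  obtain ⟨F, h1, h2, h3⟩ := simplex_cell_norm (n := k + 1) (by omega) (fun c x => F2 c x)
    (fun c => (F2 c).continuous) T (by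
      intro ρ x hx
      rw [hT ρ ⟨x, hx⟩]
      funext i
      exact (hF2v _ ⟨x, hx⟩).symm)
  refine ⟨F, h1, ?_, ?_⟩
  · intro c c' w h
    by_cases hw : w ∈ Bx (k + 1)
    · have hval : ∀ c, F c w = FB c ⟨w, hw⟩ := fun c => by rw [h2 c w hw]; exact hF2v c ⟨w, hw⟩
      rw [hval, hval]
      obtain ⟨j, hj⟩ := hw
      rw [hFB c _ j hj, hFB c' _ j hj]
      by_cases h4 : (fun i => c (j.succAbove i)) = fun i => c' (j.succAbove i)
      · rw [h4]
      · have : ∃ i, c (j.succAbove i) ≠ c' (j.succAbove i) := by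
          by_contra h5
          push Not at h5
          exact h4 (funext h5)
        obtain ⟨i, hi⟩ := this
        have hz : w.1 (j.succAbove i) = 0 := by
          by_contra h6
          exact hi (h _ h6)
        rw [hF1two c w j _ hj hz (Fin.succAbove_ne j i), hF1two c' w j _ hj hz (Fin.succAbove_ne j i)]
        exact F0_congr X h
    · have : c = c' := by
        funext j
        apply h
        intro hj
        exact hw ⟨j, hj⟩
      rw [this]
  · intro ρ w
    obtain ⟨φ, hφ, _⟩ := h3 (nrm ρ)
    have h4 := (φ w).2
    rw [hφ] at h4
    have h5 := ND_perm h4 (ρ 0)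
    have h6 : (fun i => F (fun j => (nrm ρ).1 j i) w) ∘ (ρ 0) = fun i => F (fun j => ρ j i) w := by
      funext i
      simp only [Function.comp, nrm_spec]
    rwa [h6] at h5

end TTC

open Set
open scoped Topology unitInterval RealInnerProductSpace

namespace TTC

/-- existence of a map without `r`-Tverberg points -/
def NoTv (r : ℕ) (V : Type) [Fintype V] (W : Type) [TopologicalSpace W] : Prop :=
  ∃ f : (V → ℝ) → W, ContinuousOn f (stdSimplex ℝ V) ∧
    ¬ ∃ x : Fin r → V → ℝ, (∀ i, x i ∈ stdSimplex ℝ V) ∧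
      (Pairwise fun i j => Disjoint {a | 0 < x i a} {a | 0 < x j a}) ∧ ∀ i j, f (x i) = f (x j)

lemma disj_iff {V : Type} {x y : V → ℝ} :
    Disjoint {a | 0 < x a} {a | 0 < y a} ↔ ∀ a, 0 < x a → ¬ 0 < y a := by
  rw [Set.disjoint_left]; rfl

lemma NoTv.transport {r : ℕ} {V V' W W' : Type} [Fintype V] [Fintype V'] [TopologicalSpace W]
    [TopologicalSpace W'] (h : NoTv r V W) (e : V ≃ V') (ι : W → W') (hc : Continuous ι)
    (hi : Function.Injective ι) : NoTv r V' W' := by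
  obtain ⟨f, hf, hn⟩ := h
  have hs : ∀ x ∈ stdSimplex ℝ V', x ∘ e ∈ stdSimplex ℝ V := fun x hx =>
    ⟨fun v => hx.1 _, by rw [← hx.2]; exact Equiv.sum_comp e x⟩
  refine ⟨fun x => ι (f (x ∘ e)), ?_, ?_⟩
  · refine hc.comp_continuousOn (hf.comp ?_ hs)
    exact Continuous.continuousOn (continuous_pi fun i => continuous_apply _)
  · rintro ⟨x, h1, h2, h3⟩
    refine hn ⟨fun i => x i ∘ e, fun i => hs _ (h1 i), fun i j hij => ?_, fun i j => hi (h3 i j)⟩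
    exact disj_iff.2 fun a => disj_iff.1 (h2 hij) (e a)

lemma NoTv.lift {r d : ℕ} (hr : 1 ≤ r) {V : Type} [Fintype V]
    (h : NoTv r V (EuclideanSpace ℝ (Fin d))) :
    NoTv r (V ⊕ Fin (r - 1)) (EuclideanSpace ℝ (Fin d) × ℝ) := by
  obtain ⟨f, hf, hn⟩ := h
  obtain ⟨G, hG⟩ := ContinuousMap.exists_restrict_eq (isClosed_stdSimplex ℝ V)
    ⟨_, continuousOn_iff_continuous_domRestrict.1 hf⟩
  have hG2 : ∀ x ∈ stdSimplex ℝ V, G x = f x := fun x hx => by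
    have := DFunLike.congr_fun hG ⟨x, hx⟩
    exact this
  refine ⟨fun x => (G (x ∘ Sum.inl), ∑ a, x (Sum.inr a)), ?_, ?_⟩
  · refine Continuous.continuousOn (Continuous.prodMk (G.continuous.comp ?_) ?_)
    · exact continuous_pi fun i => continuous_apply _
    · fun_prop
  · rintro ⟨x, h1, h2, h3⟩
    have h4 : ∃ i, ∀ a, x i (Sum.inr a) = 0 := by
      by_contra hc
      push Not at hc
      choose a ha using hc
      have hinj : Function.Injective a := by
        intro i j hij
        by_contra hne
        have := (disj_iff.1 (h2 hne)) (Sum.inr (a i)) (lt_of_le_of_ne ((h1 i).1 _) (ha i).symm)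
        rw [hij] at this
        exact this (lt_of_le_of_ne ((h1 j).1 _) (ha j).symm)
      have := Fintype.card_le_of_injective a hinj
      simp at this
      omega
    obtain ⟨i0, h0⟩ := h4
    have h5 : ∀ i, ∑ a, x i (Sum.inr a) = 0 := fun i => by
      have := congrArg Prod.snd (h3 i i0)
      simp only at this
      rw [this]
      exact Finset.sum_eq_zero fun a _ => h0 a
    have hs : ∀ i, x i ∘ Sum.inl ∈ stdSimplex ℝ V := fun i => by
      refine ⟨fun v => (h1 i).1 _, ?_⟩
      have := (h1 i).2
      rw [Fintype.sum_sum_type, h5, add_zero] at this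
      exact this
    refine hn ⟨fun i => x i ∘ Sum.inl, hs, fun i j hij => ?_, fun i j => ?_⟩
    · exact disj_iff.2 fun a => disj_iff.1 (h2 hij) (Sum.inl a)
    · have := congrArg Prod.fst (h3 i j)
      simp only at this
      rw [← hG2 _ (hs i), ← hG2 _ (hs j), this]

/-- color weights -/
def wt {m r : ℕ} (x : Fin m × Fin r → ℝ) (j : Fin m) : ℝ := ∑ a, x (j, a)

lemma wt_mem {m r : ℕ} {x : Fin m × Fin r → ℝ} (hx : x ∈ stdSimplex ℝ (Fin m × Fin r)) :
    wt x ∈ stdSimplex ℝ (Fin m) :=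
  ⟨fun j => Finset.sum_nonneg fun a _ => hx.1 _, by
    rw [← hx.2, Fintype.sum_prod_type]; rfl⟩

lemma wt_continuous {m r : ℕ} : Continuous (wt (m := m) (r := r)) := by
  unfold wt
  fun_prop

lemma NoTv.base {r k : ℕ} (hr : 2 ≤ r) (hnp : ¬ IsPrimePow r) (hk : k + 4 = 3 * r) :
    NoTv r (Fin (k + 2) × Fin r) ((Fin (k + 1) → ℝ) × PP) := by
  classical
  obtain ⟨F, hF, hFc, hFN⟩ := main_F hr hnp hk
  let V := Fin (k + 2) × Fin r
  let Kc : (Fin (k + 2) → Fin r) → Set (V → ℝ) := fun c =>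
    {x | x ∈ stdSimplex ℝ V ∧ ∀ j a, a ≠ c j → x (j, a) = 0}
  have hKc : ∀ c, IsClosed (Kc c) := by
    intro c
    refine (isClosed_stdSimplex ℝ V).inter ?_
    have : {x : V → ℝ | ∀ j a, a ≠ c j → x (j, a) = 0} =
        ⋂ j, ⋂ a, ⋂ (_ : a ≠ c j), {x : V → ℝ | x (j, a) = 0} := by
      ext x; simp only [Set.mem_ofPred_eq, Set.mem_iInter]
    change IsClosed {x : V → ℝ | ∀ j a, a ≠ c j → x (j, a) = 0}
    rw [this]
    exact isClosed_iInter fun j => isClosed_iInter fun a => isClosed_iInter fun _ =>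
      isClosed_eq (continuous_apply _) continuous_const
  let K : Set (V → ℝ) := ⋃ c, Kc c
  have hK : IsClosed K := isClosed_iUnion_of_finite hKc
  have hmem : ∀ x : K, ∃ c, x.1 ∈ Kc c := fun x => mem_iUnion.1 x.2
  let g : K → PP := fun x => F (hmem x).choose ⟨wt x.1, wt_mem (hmem x).choose_spec.1⟩
  have hg : ∀ (x : K) c (hc : x.1 ∈ Kc c), g x = F c ⟨wt x.1, wt_mem hc.1⟩ := by
    intro x c hc
    refine hFc _ _ _ fun j hj => ?_
    have : ∃ a, x.1 (j, a) ≠ 0 := by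
      by_contra h
      push Not at h
      apply hj
      change wt x.1 j = 0
      exact Finset.sum_eq_zero fun a _ => h a
    obtain ⟨a, ha⟩ := this
    have e1 : a = c j := by
      by_contra h
      exact ha (hc.2 j a h)
    have e2 : a = (hmem x).choose j := by
      by_contra h
      exact ha ((hmem x).choose_spec.2 j a h)
    rw [← e1, ← e2]
  have hgc : Continuous g := by
    refine (locallyFinite_of_finite fun c => {x : K | x.1 ∈ Kc c}).continuous ?_ ?_ ?_
    · ext x
      simp only [mem_iUnion, mem_univ, iff_true]
      exact hmem x
    · intro c
      exact (hKc c).preimage continuous_subtype_val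
    · intro c
      rw [continuousOn_iff_continuous_domRestrict]
      have : Set.domRestrict {x : K | x.1 ∈ Kc c} g = fun x => F c ⟨wt x.1.1, wt_mem x.2.1⟩ := by
        funext x
        exact hg x.1 c x.2
      rw [this]
      refine (hF c).comp (Continuous.subtype_mk ?_ _)
      exact wt_continuous.comp (continuous_subtype_val.comp continuous_subtype_val)
  obtain ⟨G, hG⟩ := ContinuousMap.exists_restrict_eq hK ⟨g, hgc⟩
  have hG2 : ∀ x (hx : x ∈ K), G x = g ⟨x, hx⟩ := fun x hx => DFunLike.congr_fun hG ⟨x, hx⟩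
  refine ⟨fun x => (fun j => wt x j.castSucc, G x), ?_, ?_⟩
  · refine Continuous.continuousOn (Continuous.prodMk ?_ G.continuous)
    exact continuous_pi fun j => (continuous_apply _).comp wt_continuous
  · rintro ⟨x, h1, h2, h3⟩
    let i0 : Fin r := ⟨0, by omega⟩
    let w := wt (x i0)
    have hw : ∀ i, wt (x i) = w := by
      intro i
      have e1 : ∀ j : Fin (k + 1), wt (x i) j.castSucc = w j.castSucc := fun j =>
        congrFun (congrArg Prod.fst (h3 i i0)) j
      have e2 := (wt_mem (h1 i)).2
      have e3 := (wt_mem (h1 i0)).2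
      rw [Fin.sum_univ_castSucc] at e2 e3
      simp only [e1] at e2
      funext j
      refine Fin.lastCases ?_ (fun j => ?_) j
      · change _ = wt (x i0) _
        change _ + _ = (1 : ℝ) at e2
        change ∑ i : Fin (k + 1), wt (x i0) i.castSucc + _ = (1 : ℝ) at e2
        linarith
      · exact e1 j
    have hc : ∀ i j, ∃ a, (w j = 0 → a = i) ∧ (w j ≠ 0 → 0 < x i (j, a)) := by
      intro i j
      by_cases hj : w j = 0
      · exact ⟨i, fun _ => rfl, fun h => absurd hj h⟩
      · have : ∃ a, x i (j, a) ≠ 0 := by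
          by_contra h
          push Not at h
          apply hj
          rw [← hw i]
          exact Finset.sum_eq_zero fun a _ => h a
        obtain ⟨a, ha⟩ := this
        exact ⟨a, fun h => absurd h hj, fun _ => lt_of_le_of_ne ((h1 i).1 _) ha.symm⟩
    choose c hc1 hc2 using hc
    have hinj : ∀ j, Function.Injective fun i => c i j := by
      intro j i i' h
      simp only at h
      by_cases hj : w j = 0
      · rw [hc1 i j hj, hc1 i' j hj] at h
        exact h
      · by_contra hne
        refine (disj_iff.1 (h2 hne)) (j, c i j) (hc2 i j hj) ?_
        rw [h]
        exact hc2 i' j hj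
    let ρ : Fin (k + 2) → Equiv.Perm (Fin r) := fun j =>
      Equiv.ofBijective (fun i => c i j) (Finite.injective_iff_bijective.1 (hinj j))
    have hxK : ∀ i, x i ∈ Kc (c i) := by
      intro i
      refine ⟨h1 i, fun j a ha => ?_⟩
      by_cases hj : w j = 0
      · rw [← hw i] at hj
        exact (Finset.sum_eq_zero_iff_of_nonneg (fun a _ => (h1 i).1 _)).1 hj a (Finset.mem_univ _)
      · obtain ⟨i', hi'⟩ := (ρ j).surjective a
        change c i' j = a at hi'
        subst hi'
        have hne : i' ≠ i := fun h => ha (by rw [h])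
        have := (disj_iff.1 (h2 hne)) _ (hc2 i' j hj)
        exact le_antisymm (not_lt.1 this) ((h1 i).1 _)
    have hGx : ∀ i, G (x i) = F (fun j => ρ j i) ⟨w, wt_mem (h1 i0)⟩ := by
      intro i
      rw [hG2 _ (mem_iUnion.2 ⟨c i, hxK i⟩), hg _ _ (hxK i)]
      congr 1
      exact Subtype.ext (hw i)
    apply hFN ρ ⟨w, wt_mem (h1 i0)⟩
    intro i i'
    simp only
    rw [← hGx, ← hGx]
    exact congrArg Prod.snd (h3 i i')

lemma good_all {r : ℕ} (hr : 2 ≤ r) (hnp : ¬ IsPrimePow r) (e : ℕ) :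
    NoTv r (Fin ((3 * r + e + 1) * (r - 1) + 1)) (EuclideanSpace ℝ (Fin (3 * r + e))) := by
  obtain ⟨q, rfl⟩ : ∃ q, r = q + 2 := ⟨r - 2, by omega⟩
  induction e with
  | zero =>
    have h := NoTv.base (k := 3 * q + 2) hr hnp (by ring)
    refine h.transport (Fintype.equivFinOfCardEq ?_) (ContinuousLinearEquiv.ofFinrankEq (𝕜 := ℝ) ?_)
      (ContinuousLinearEquiv.continuous _) (ContinuousLinearEquiv.injective _)
    · simp only [Fintype.card_prod, Fintype.card_fin, add_zero]
      rw [show q + 2 - 1 = q + 1 by omega]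
      ring
    · rw [Module.finrank_prod]
      simp
      ring
  | succ e ih =>
    have h := NoTv.lift (by omega) ih
    refine h.transport (Fintype.equivFinOfCardEq ?_) (ContinuousLinearEquiv.ofFinrankEq (𝕜 := ℝ) ?_)
      (ContinuousLinearEquiv.continuous _) (ContinuousLinearEquiv.injective _)
    · simp only [Fintype.card_sum, Fintype.card_fin]
      rw [show q + 2 - 1 = q + 1 by omega]
      ring
    · rw [Module.finrank_prod]
      simp
      ring

end TTC

theorem statement3 (r d : ℕ) (hr : 6 ≤ r) (hnp : ¬ IsPrimePow r) (hd : 3 * r ≤ d)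
    (N : ℕ) (hN : N = (d + 1) * (r - 1)) :
    ∃ f : (Fin (N + 1) → ℝ) → EuclideanSpace ℝ (Fin d),
      ContinuousOn f (stdSimplex ℝ (Fin (N + 1))) ∧
      ¬ ∃ x : Fin r → (Fin (N + 1) → ℝ),
          (∀ i, x i ∈ stdSimplex ℝ (Fin (N + 1))) ∧
          (Pairwise fun i j => Disjoint {a | 0 < x i a} {a | 0 < x j a}) ∧
          (∀ i j, f (x i) = f (x j)) := by
  obtain ⟨e, rfl⟩ := Nat.exists_eq_add_of_le hd
  subst hN
  exact TTC.good_all (by omega) hnp e
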